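/- arXiv:1810.03894 — 5 statements merged into one kernel-verified Lean document; each statement's English description precedes it below -/
import Mathlib

section
/- Let G be a 2-connected simple graph with n ≥ 3 vertices such that d(u) + d(v) ≥ n − 1 for every pair of vertices u, v at distance 2. Then G is Hamiltonian, unless n is odd and G belongs to ψ_n. -/
open Finset SimpleGraph
open scoped Classical

/-- `G` belongs to the class `ψ_{2m+1}`, i.e. `G = Z_m ∨ (K^c_m + {u})`: the vertex set splits
into `A ∪ B ∪ {u}` with `|A| = |B| = m`, `B ∪ {u}` is independent, every vertex of `B ∪ {u}`
is adjacent to every vertex of `A`, and the edges inside `A` are arbitrary. -/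
def InPsi {V : Type*} [Fintype V] [DecidableEq V] (G : SimpleGraph V) (m : ℕ) : Prop :=
  ∃ (A B : Finset V) (u : V),
    A.card = m ∧ B.card = m ∧ u ∉ A ∧ u ∉ B ∧ Disjoint A B ∧ A ∪ B ∪ {u} = Finset.univ ∧
    (∀ x ∈ B ∪ {u}, ∀ y ∈ B ∪ {u}, ¬G.Adj x y) ∧
    (∀ x ∈ B ∪ {u}, ∀ a ∈ A, G.Adj x a)

/-- `G` is 2-connected: it has at least 3 vertices and removing at most one vertex
leaves a connected graph. -/
def TwoConnected {V : Type*} [Fintype V] (G : SimpleGraph V) : Prop :=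
  3 ≤ Fintype.card V ∧ ∀ S : Set V, S.ncard ≤ 1 → (G.induce Sᶜ).Connected

namespace LongCycle

variable {V : Type*}

/-- `l` lists the vertices of a walk in `G` from `a` to `b`. -/
structure IsTrack (G : SimpleGraph V) (a b : V) (l : List V) : Prop where
  chain : l.IsChain G.Adj
  head : l.head? = some a
  last : l.getLast? = some b

/-- `l` lists the vertices of a cycle in `G`, starting at `a` and ending at `b`
(edges are regarded as cycles of length two). -/
structure IsCyc (G : SimpleGraph V) (a b : V) (l : List V) : Prop extends IsTrack G a b l where
  adj : G.Adj b a
  nodup : l.Nodup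

section Lists

variable {G : SimpleGraph V} {a b c d x y v w : V} {l l' Q R S P C : List V}

lemma IsTrack.singleton (G : SimpleGraph V) (a : V) : IsTrack G a a [a] :=
  ⟨by simp, by simp, by simp⟩

lemma IsTrack.append (h : IsTrack G a b l) (h' : IsTrack G c d l') (hbc : G.Adj b c) :
    IsTrack G a d (l ++ l') := by
  refine ⟨?_, ?_, ?_⟩
  · rw [List.isChain_append]
    refine ⟨h.chain, h'.chain, ?_⟩
    simp [h.last, h'.head, hbc]
  · simp [h.head]
  · simp [h'.last]

lemma IsTrack.reverse (h : IsTrack G a b l) : IsTrack G b a l.reverse := by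
  refine ⟨?_, by simp [h.last], by simp [h.head]⟩
  rw [List.isChain_reverse]
  exact h.chain.imp fun _ _ h => h.symm

lemma IsTrack.split (h : IsTrack G a b (l ++ l')) (hl : l ≠ []) (hl' : l' ≠ []) :
    ∃ c d, IsTrack G a c l ∧ IsTrack G d b l' ∧ G.Adj c d := by
  obtain ⟨h1, h2, h3⟩ := List.isChain_append.1 h.chain
  obtain ⟨d, hd⟩ : ∃ d, l'.head? = some d := by
    cases l' <;> simp_all
  obtain ⟨c, hc⟩ : ∃ c, l.getLast? = some c :=
    ⟨l.getLast hl, List.getLast?_eq_some_getLast hl⟩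
  refine ⟨c, d, ⟨h1, ?_, hc⟩, ⟨h2, hd, ?_⟩, h3 c hc d hd⟩
  · have := h.head
    cases l <;> simp_all
  · have := h.last
    have e := List.getLast?_eq_some_getLast hl'
    simp_all

lemma IsTrack.head_mem (h : IsTrack G a b l) : a ∈ l := List.mem_of_head? h.head

lemma IsTrack.last_mem (h : IsTrack G a b l) : b ∈ l := List.mem_of_getLast? h.last

lemma IsTrack.ne_nil (h : IsTrack G a b l) : l ≠ [] := List.ne_nil_of_mem h.head_mem

/-- Splitting a walk between two consecutive entries. -/
lemma IsTrack.split_cons_cons (h : IsTrack G a b (R ++ x :: y :: S)) :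
    IsTrack G a x (R ++ [x]) ∧ IsTrack G y b (y :: S) := by
  have h' : IsTrack G a b ((R ++ [x]) ++ (y :: S)) := by simpa using h
  obtain ⟨c, d, h1, h2, -⟩ := h'.split (by simp) (by simp)
  have e1 := h1.last
  have e2 := h2.head
  simp at e1 e2
  subst e1 e2
  exact ⟨h1, h2⟩

/-- A cyclic list may be cut at any place. -/
lemma IsCyc.rotate (h : IsCyc G a b (l ++ l')) (hl : l ≠ []) (hl' : l' ≠ []) :
    ∃ c d, IsTrack G a c l ∧ IsTrack G d b l' ∧ G.Adj c d ∧ IsCyc G d c (l' ++ l) := by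
  obtain ⟨c, d, h1, h2, h3⟩ := h.toIsTrack.split hl hl'
  exact ⟨c, d, h1, h2, h3, h2.append h1 h.adj, h3, (List.perm_append_comm.nodup_iff).1 h.nodup⟩

/-- Rotating a cyclic list so that a given vertex comes last. -/
lemma IsCyc.rotate_last (h : IsCyc G a b C) (hv : v ∈ C) :
    ∃ d D, IsCyc G d v D ∧ D.Perm C := by
  obtain ⟨s, t, rfl⟩ := List.append_of_mem hv
  rcases eq_or_ne t [] with rfl | ht
  · have := h.last
    simp at this
    subst this
    exact ⟨a, _, h, List.Perm.refl _⟩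
  · have h' : IsCyc G a b ((s ++ [v]) ++ t) := by simpa using h
    obtain ⟨c, d, h1, -, -, h4⟩ := h'.rotate (by simp) ht
    have := h1.last
    simp at this
    subst this
    exact ⟨d, _, h4, by simpa using (List.perm_append_comm (l₁ := t) (l₂ := s ++ [v]))⟩

/-- Rotating a cyclic list so that a given vertex comes first. -/
lemma IsCyc.rotate_head (h : IsCyc G a b C) (hv : v ∈ C) :
    ∃ d D, IsCyc G v d D ∧ D.Perm C := by
  obtain ⟨s, t, rfl⟩ := List.append_of_mem hv
  rcases eq_or_ne s [] with rfl | hs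
  · have := h.head
    simp at this
    subst this
    exact ⟨b, _, h, List.Perm.refl _⟩
  · obtain ⟨c, d, -, h2, -, h4⟩ := h.rotate hs (by simp)
    have := h2.head
    simp at this
    subst this
    exact ⟨c, _, h4, List.perm_append_comm⟩

lemma countP_add_countP_le (p q : V → Prop) [DecidablePred p] [DecidablePred q] (L : List V)
    (hL : L.IsChain fun y z => ¬(q y ∧ p z)) (hp : ∀ y ∈ L.head?, ¬p y) :
    L.countP p + L.countP q ≤ L.length := by
  have key : ∀ L : List V, L.IsChain (fun y z => ¬(q y ∧ p z)) →
      L.countP p + L.countP q ≤ L.length + (L.head?.toList.countP p) := by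
    intro L
    induction L with
    | nil => simp
    | cons x L ih =>
      intro h
      cases L with
      | nil => by_cases hx : p x <;> by_cases hq : q x <;> simp [hx, hq]
      | cons z L =>
        rw [List.isChain_cons_cons] at h
        have := ih h.2
        have h1 := h.1
        rw [List.countP_cons, List.countP_cons (p := (q ·))]
        by_cases hx : p x <;> by_cases hq : q x <;> by_cases hz : p z <;>
          simp [hx, hq, hz] at this h1 ⊢ <;> omega
  have := key L hL
  have h0 : L.head?.toList.countP p = 0 := by
    rw [List.countP_eq_zero]
    intro y hy
    simpa using hp y (by simpa using hy)
  omega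

section Longest

variable {k : ℕ} (hmax : ∀ a b l, IsCyc G a b l → l.length ≤ k)

include hmax

/-- A path cannot be inserted between consecutive vertices of a longest cycle. -/
lemma not_adj_of_longest (hC : IsCyc G a b C) (hk : C.length = k) (hP : IsTrack G x y P)
    (hnd : (C ++ P).Nodup) (hbx : G.Adj b x) : ¬G.Adj y a := by
  intro h
  have := hmax _ _ _ ⟨hC.toIsTrack.append hP hbx, h, hnd⟩
  have := List.length_pos_of_ne_nil hP.ne_nil
  simp at *
  omega

lemma not_adj_second_of_longest (hC : IsCyc G a b (a :: c :: S))
    (hk : (a :: c :: S).length = k)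
    (hP : IsTrack G x y P) (hxy : x ≠ y)
    (hnd : ((a :: c :: S) ++ P).Nodup) (hbx : G.Adj b x) : ¬G.Adj y c := by
  intro h
  have h1 : IsTrack G c b (c :: S) :=
    (IsTrack.split_cons_cons (R := []) (by simpa using hC.toIsTrack)).2
  have := hmax _ _ _ ⟨h1.append hP hbx, h, by simp at hnd ⊢; grind⟩
  have : 2 ≤ P.length := by
    have h1 := hP.head
    have h2 := hP.last
    match P with
    | [] => simp at h1
    | [z] => simp at h1 h2; grind
    | _ :: _ :: _ => simp
  simp at *
  omega

lemma isChain_of_longest (hC : IsCyc G a b C) (hk : C.length = k) (hP : IsTrack G x y P)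
    (hnd : (C ++ P).Nodup) : C.IsChain fun u v => ¬(G.Adj x u ∧ G.Adj y v) := by
  rw [List.isChain_iff_forall_rel_of_append_cons_cons]
  rintro u v R S rfl ⟨h1, h2⟩
  have hC' : IsCyc G a b ((R ++ [u]) ++ (v :: S)) := by simpa using hC
  obtain ⟨c, d, t1, t2, -, t3⟩ := hC'.rotate (by simp) (by simp)
  have e1 := t1.last
  have e2 := t2.head
  simp at e1 e2
  subst e1 e2
  refine not_adj_of_longest hmax t3 (by simp at *; omega) hP ?_ h1.symm h2
  refine (List.Perm.nodup_iff ?_).1 hnd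
  have := List.perm_append_comm (l₁ := R ++ [u]) (l₂ := v :: S)
  simpa using this.append_right P

variable {Q₁ Q₂ : List V} {v₁ v₂ : V}

lemma not_adj_succ_succ (h1 : IsTrack G a v₂ Q₁) (h2 : IsTrack G b v₁ Q₂)
    (hk : (Q₁ ++ Q₂).length = k) (hP : IsTrack G x y P) (hnd : (Q₁ ++ Q₂ ++ P).Nodup)
    (hx : G.Adj v₁ x) (hy : G.Adj v₂ y) : ¬G.Adj a b := by
  intro h
  have t := (h1.append hP.reverse hy).append h2.reverse hx.symm
  have := hmax _ _ _ ⟨t, h.symm, by simp [List.nodup_append] at hnd ⊢; grind⟩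
  have := List.length_pos_of_ne_nil hP.ne_nil
  simp at *
  omega

lemma not_common_adj (h1 : IsTrack G a v₂ Q₁) (h2 : IsTrack G b v₁ Q₂)
    (hk : (Q₁ ++ Q₂).length = k) (hP : IsTrack G x y P) (hnd : (Q₁ ++ Q₂ ++ P).Nodup)
    (hx : G.Adj v₁ x) (hy : G.Adj v₂ y) (hw : w ∉ Q₁ ++ Q₂ ++ P) :
    ¬(G.Adj a w ∧ G.Adj b w) := by
  rintro ⟨ha, hb⟩
  have t := ((h1.append hP.reverse hy).append h2.reverse hx.symm).append
    (IsTrack.singleton G w) hb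
  have := hmax _ _ _ ⟨t, ha.symm, by simp [List.nodup_append] at hnd hw ⊢; grind⟩
  simp at *
  omega

lemma isChain_crossing (h1 : IsTrack G a v₂ Q₁) (h2 : IsTrack G b v₁ Q₂)
    (hk : (Q₁ ++ Q₂).length = k) (hP : IsTrack G x y P) (hnd : (Q₁ ++ Q₂ ++ P).Nodup)
    (hx : G.Adj v₁ x) (hy : G.Adj v₂ y) :
    Q₁.IsChain fun u v => ¬(G.Adj b u ∧ G.Adj a v) := by
  rw [List.isChain_iff_forall_rel_of_append_cons_cons]
  rintro u v R S rfl ⟨hb, ha⟩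
  obtain ⟨t1, t2⟩ := h1.split_cons_cons
  have t := ((t1.append h2 hb.symm).append hP hx).append t2.reverse hy.symm
  have := hmax _ _ _ ⟨t, ha.symm, by simp [List.nodup_append] at hnd ⊢; grind⟩
  have := List.length_pos_of_ne_nil hP.ne_nil
  simp at *
  omega

end Longest

end Lists

section Avoid

variable {G : SimpleGraph V} {S : Set V} {u v w : V}

/-- The graph `G` with all edges meeting `S` removed. -/
def avoid (G : SimpleGraph V) (S : Set V) : SimpleGraph V where
  Adj u v := G.Adj u v ∧ u ∉ S ∧ v ∉ S
  symm := ⟨fun _ _ h => ⟨h.1.symm, h.2.2, h.2.1⟩⟩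
  loopless := ⟨fun _ h => h.1.ne rfl⟩

lemma exists_isTrack_of_reachable (h : (avoid G S).Reachable u v) (hu : u ∉ S) :
    ∃ l, IsTrack G u v l ∧ l.Nodup ∧ ∀ w ∈ l, w ∉ S ∧ (avoid G S).Reachable u w := by
  obtain ⟨p, hp⟩ := h.exists_isPath
  refine ⟨p.support, ⟨p.isChain_adj_support.imp fun _ _ h => h.1, ?_, ?_⟩, hp.support_nodup, ?_⟩
  · rw [List.head?_eq_some_head p.support_ne_nil, Walk.head_support]
  · rw [List.getLast?_eq_some_getLast p.support_ne_nil, Walk.getLast_support]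
  · intro w hw
    have hr : (avoid G S).Reachable u w := ⟨p.takeUntil w hw⟩
    refine ⟨?_, hr⟩
    obtain ⟨q⟩ := hr.symm
    cases q with
    | nil => exact hu
    | cons h _ => exact h.2.1

/-- A walk leaving a set `s` crosses an edge between `s` and its complement. -/
lemma exists_adj_of_reachable {K : SimpleGraph V} (s : V → Prop) (h : K.Reachable u v)
    (hu : s u) (hv : ¬s v) : ∃ x y, K.Adj x y ∧ s x ∧ ¬s y := by
  obtain ⟨p⟩ := h
  induction p with
  | nil => exact absurd hu hv
  | @cons a b c hab p ih =>
    by_cases hb : s b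
    · exact ih hb hv
    · exact ⟨a, b, hab, hu, hb⟩

lemma reachable_of_twoConnected [Fintype V] (h : TwoConnected G) (hu : u ≠ w) (hv : v ≠ w) :
    (avoid G {w}).Reachable u v := by
  have hc := (h.2 {w} (by simp)).preconnected ⟨u, by simpa using hu⟩ ⟨v, by simpa using hv⟩
  let f : G.induce ({w}ᶜ : Set V) →g avoid G {w} :=
    ⟨Subtype.val, fun {x y} hxy => ⟨hxy, x.2, y.2⟩⟩
  exact hc.map f

lemma exists_isCyc_of_twoConnected [Fintype V] (h : TwoConnected G) :
    ∃ a b l, IsCyc G a b l ∧ 3 ≤ l.length := by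
  have hex : ∀ x t : V, x ≠ t → ∃ y, y ≠ t ∧ G.Adj x y := by
    intro x t hxt
    obtain ⟨z, hz⟩ : ∃ z, z ∉ ({x, t} : Finset V) := by
      by_contra! hz
      have := Finset.card_le_card (fun z _ => hz z : Finset.univ ⊆ ({x, t} : Finset V))
      have h2 : ({x, t} : Finset V).card ≤ 2 := Finset.card_le_two
      have := h.1
      rw [Finset.card_univ] at *
      omega
    simp only [Finset.mem_insert, Finset.mem_singleton, not_or] at hz
    obtain ⟨p⟩ := reachable_of_twoConnected h hxt hz.2
    cases p with
    | nil => exact absurd rfl hz.1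
    | @cons _ b _ hab p => exact ⟨b, hab.2.2, hab.1⟩
  obtain ⟨t⟩ : Nonempty V := Fintype.card_pos_iff.1 (by have := h.1; omega)
  obtain ⟨x, hx⟩ : ∃ x, x ≠ t := Fintype.exists_ne_of_one_lt_card (by have := h.1; omega) t
  obtain ⟨y, -, hxy⟩ := hex x t hx
  obtain ⟨z, hzy, hxz⟩ := hex x y hxy.ne
  obtain ⟨l, hl, hnd, hlx⟩ := exists_isTrack_of_reachable
    (reachable_of_twoConnected h hxy.ne' hxz.ne') (by simpa using hxy.ne')
  refine ⟨y, x, l ++ [x], ⟨hl.append (IsTrack.singleton G x) hxz.symm, hxy, ?_⟩, ?_⟩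
  · rw [List.nodup_append]
    refine ⟨hnd, by simp, ?_⟩
    intro a ha b hb
    simp at hb
    subst hb
    exact (hlx a ha).1
  · have h1 := hl.head
    have h2 := hl.last
    match l with
    | [] => simp at h1
    | [c] => simp at h1 h2; grind
    | _ :: _ :: _ => simp

lemma exists_longest_isCyc [Fintype V] (h : TwoConnected G) :
    ∃ a b l, IsCyc G a b l ∧ 3 ≤ l.length ∧
      ∀ a' b' l', IsCyc G a' b' l' → l'.length ≤ l.length := by
  obtain ⟨a, b, l, hl, h3⟩ := exists_isCyc_of_twoConnected h
  let s : ℕ → Prop := fun n => ∃ a b l, IsCyc G a b l ∧ l.length = n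
  have hb : ∀ n, s n → n ≤ Fintype.card V := by
    rintro n ⟨a, b, l, hl, rfl⟩
    exact hl.nodup.length_le_card
  have hs : s l.length := ⟨a, b, l, hl, rfl⟩
  obtain ⟨a', b', l', hl', he⟩ := Nat.findGreatest_spec (P := s) (hb _ hs) hs
  refine ⟨a', b', l', hl', ?_, ?_⟩
  · rw [he]
    exact h3.trans (Nat.le_findGreatest (hb _ hs) hs)
  · intro c d m hm
    rw [he]
    exact Nat.le_findGreatest (hb _ ⟨c, d, m, hm, rfl⟩) ⟨c, d, m, hm, rfl⟩

lemma isHamiltonian_of_isCyc [Fintype V] [DecidableEq V] {a b : V} {l : List V}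
    (hl : IsCyc G a b l) (h3 : 3 ≤ l.length) (hall : ∀ v, v ∈ l) : G.IsHamiltonian := by
  intro _
  have hw : ∃ p : G.Walk a b, p.support = l := by
    have h1 := hl.head
    have h2 := hl.last
    have e1 := List.head?_eq_some_head hl.ne_nil
    have e2 := List.getLast?_eq_some_getLast hl.ne_nil
    have e1' : l.head hl.ne_nil = a := by grind
    have e2' : l.getLast hl.ne_nil = b := by grind
    exact ⟨(Walk.ofSupport l hl.ne_nil hl.chain).copy e1' e2', by simp [Walk.support_ofSupport]⟩
  obtain ⟨p, rfl⟩ := hw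
  have hp : p.IsPath := by rw [Walk.isPath_def]; exact hl.nodup
  refine ⟨b, Walk.cons hl.adj p, ?_⟩
  rw [Walk.isHamiltonianCycle_iff_isCycle_and_support_count_tail_eq_one]
  refine ⟨?_, ?_⟩
  · rw [Walk.cons_isCycle_iff]
    refine ⟨hp, fun he => ?_⟩
    have hlen : p.length = 1 := by
      exact hp.length_eq_one_of_mem_edges (by rwa [Sym2.eq_swap])
    rw [Walk.length_support] at h3
    omega
  · intro v
    simpa using List.count_eq_one_of_mem hl.nodup (hall v)

end Avoid

section Component

variable {G : SimpleGraph V} {a b x y v v₁ v₂ : V} {C D Q₁ Q₂ : List V} {H : Finset V} {k : ℕ}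

/-- `H` is a connected component of `G` with the vertices of `C` removed. -/
structure IsComp (G : SimpleGraph V) (C : List V) (H : Finset V) : Prop where
  not_mem : ∀ x ∈ H, x ∉ C
  closed : ∀ x ∈ H, ∀ y, G.Adj x y → y ∉ C → y ∈ H
  track : ∀ x ∈ H, ∀ y ∈ H, ∃ P, IsTrack G x y P ∧ P.Nodup ∧ ∀ w ∈ P, w ∈ H

lemma IsComp.perm (h : IsComp G C H) (hp : D.Perm C) : IsComp G D H :=
  ⟨fun x hx => by rw [hp.mem_iff]; exact h.not_mem x hx,
    fun x hx y hxy hy => h.closed x hx y hxy (by rwa [hp.mem_iff] at hy), h.track⟩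

lemma IsComp.nodup_append (h : IsComp G C H) {P : List V} (hC : C.Nodup) (hP : P.Nodup)
    (hPH : ∀ w ∈ P, w ∈ H) : (C ++ P).Nodup := by
  rw [List.nodup_append]
  refine ⟨hC, hP, ?_⟩
  rintro u hu w hw rfl
  exact h.not_mem u (hPH u hw) hu

lemma IsComp.nodup_append_singleton (hH : IsComp G C {x}) (hC : C.Nodup) :
    (C ++ [x]).Nodup := hH.nodup_append hC (by simp) (by simp)

lemma exists_isComp [Fintype V] {h : V} (hh : h ∉ C) : ∃ H, h ∈ H ∧ IsComp G C H := by
  refine ⟨Finset.univ.filter fun y => (avoid G {v | v ∈ C}).Reachable h y, by simp, ?_⟩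
  have hnot : ∀ x, (avoid G {v | v ∈ C}).Reachable h x → x ∉ C := by
    intro x hx
    obtain ⟨q⟩ := hx.symm
    cases q with
    | nil => exact hh
    | cons h _ => exact h.2.1
  refine ⟨?_, ?_, ?_⟩
  · intro x hx
    simp only [Finset.mem_filter, Finset.mem_univ, true_and] at hx
    exact hnot x hx
  · intro x hx y hxy hy
    simp only [Finset.mem_filter, Finset.mem_univ, true_and] at hx ⊢
    refine hx.trans (SimpleGraph.Adj.reachable ?_)
    exact ⟨hxy, hnot x hx, hy⟩
  · intro x hx y hy
    simp only [Finset.mem_filter, Finset.mem_univ, true_and] at hx hy ⊢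
    obtain ⟨l, h1, h2, h3⟩ := exists_isTrack_of_reachable (hx.symm.trans hy) (hnot x hx)
    exact ⟨l, h1, h2, fun w hw => hx.trans (h3 w hw).2⟩

lemma dist_eq_two (hxa : x ≠ a) (hn : ¬G.Adj x a) (h1 : G.Adj x v) (h2 : G.Adj v a) :
    G.dist x a = 2 :=
  le_antisymm (dist_le (Walk.cons h1 (Walk.cons h2 Walk.nil)))
    ((h1.reachable.trans h2.reachable).one_lt_dist_of_ne_of_not_adj hxa hn)

lemma not_adj_component (hmax : ∀ a b l, IsCyc G a b l → l.length ≤ k)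
    (hH : IsComp G D H) (hD : IsCyc G a v D) (hk : D.length = k)
    (hx : x ∈ H) (hvx : G.Adj v x) (hy : y ∈ H) : ¬G.Adj y a := by
  obtain ⟨P, h1, h2, h3⟩ := hH.track x hx y hy
  exact not_adj_of_longest hmax hD hk h1 (hH.nodup_append hD.nodup h2 h3) hvx

variable [Fintype V] [DecidableEq V]

lemma degree_eq_countP_add (hD : D.Nodup) (a : V) :
    G.degree a = D.countP (G.Adj a ·) + (G.neighborFinset a \ D.toFinset).card := by
  have h1 : D.countP (G.Adj a ·) = (G.neighborFinset a ∩ D.toFinset).card := by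
    rw [List.countP_eq_length_filter, ← List.toFinset_card_of_nodup (hD.filter _)]
    congr 1
    ext z
    simp [and_comm]
  rw [h1, Finset.card_inter_add_card_sdiff, card_neighborFinset_eq_degree]

lemma IsComp.degree_lt (h : IsComp G C H) (hC : C.Nodup) (hx : x ∈ H) :
    G.degree x + 1 ≤ C.countP (G.Adj x ·) + H.card := by
  rw [degree_eq_countP_add hC x]
  have : G.neighborFinset x \ C.toFinset ⊆ H.erase x := by
    intro z hz
    simp only [Finset.mem_sdiff, mem_neighborFinset, List.mem_toFinset] at hz
    exact Finset.mem_erase.2 ⟨hz.1.ne', h.closed x hx z hz.1 hz.2⟩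
  have h1 := Finset.card_le_card this
  rw [Finset.card_erase_of_mem hx] at h1
  have : 0 < H.card := Finset.card_pos.2 ⟨x, hx⟩
  omega

section Longest

variable (hmax : ∀ a b l, IsCyc G a b l → l.length ≤ k)

include hmax

lemma degree_add_degree_le (hH : IsComp G (Q₁ ++ Q₂) H) (h1 : IsTrack G a v₂ Q₁)
    (h2 : IsTrack G b v₁ Q₂) (h12 : G.Adj v₂ b) (h21 : G.Adj v₁ a) (hnd : (Q₁ ++ Q₂).Nodup)
    (hk : (Q₁ ++ Q₂).length = k) (hx : x ∈ H) (hy : y ∈ H) (hvx : G.Adj v₁ x)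
    (hvy : G.Adj v₂ y) : G.degree a + G.degree b + H.card ≤ Fintype.card V := by
  obtain ⟨P, hP, hPn, hPH⟩ := hH.track x hx y hy
  have hndP := hH.nodup_append hnd hPn hPH
  have hp : (Q₂ ++ Q₁).Perm (Q₁ ++ Q₂) := List.perm_append_comm
  have hk' : (Q₂ ++ Q₁).length = k := by rw [hp.length_eq, hk]
  have hD : IsCyc G a v₁ (Q₁ ++ Q₂) := ⟨h1.append h2 h12, h21, hnd⟩
  have hD' : IsCyc G b v₂ (Q₂ ++ Q₁) := ⟨h2.append h1 h21, h12, hp.nodup_iff.2 hnd⟩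
  have c1 := countP_add_countP_le (G.Adj a ·) (G.Adj b ·) Q₁
    (isChain_crossing hmax h1 h2 hk hP hndP hvx hvy) (by simp [h1.head])
  have hndP' : (Q₂ ++ Q₁ ++ P.reverse).Nodup :=
    (hp.append P.reverse_perm).nodup_iff.2 hndP
  have c2 := countP_add_countP_le (G.Adj b ·) (G.Adj a ·) Q₂
    (isChain_crossing hmax h2 h1 hk' hP.reverse hndP' hvy hvx) (by simp [h2.head])
  have ha : ∀ z ∈ H, ¬G.Adj z a := fun z hz => not_adj_component hmax hH hD hk hx hvx hz
  have hb : ∀ z ∈ H, ¬G.Adj z b := fun z hz =>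
    not_adj_component hmax (hH.perm hp) hD' hk' hy hvy hz
  rw [degree_eq_countP_add hnd a, degree_eq_countP_add hnd b]
  simp only [List.countP_append]
  have hdis : Disjoint (G.neighborFinset a \ (Q₁ ++ Q₂).toFinset)
      (G.neighborFinset b \ (Q₁ ++ Q₂).toFinset) := by
    rw [Finset.disjoint_left]
    intro w hw hw'
    simp only [Finset.mem_sdiff, mem_neighborFinset, List.mem_toFinset] at hw hw'
    refine not_common_adj hmax h1 h2 hk hP hndP hvx hvy (w := w) ?_ ⟨hw.1, hw'.1⟩
    intro hwm
    rcases List.mem_append.1 hwm with hwm | hwm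
    · exact hw.2 hwm
    · exact ha w (hPH w hwm) hw.1.symm
  have hsub : (G.neighborFinset a \ (Q₁ ++ Q₂).toFinset) ∪
      (G.neighborFinset b \ (Q₁ ++ Q₂).toFinset) ⊆ ((Q₁ ++ Q₂).toFinset ∪ H)ᶜ := by
    intro w hw
    simp only [Finset.mem_union, Finset.mem_sdiff, mem_neighborFinset, List.mem_toFinset] at hw
    simp only [Finset.mem_compl, Finset.mem_union, List.mem_toFinset, not_or]
    rcases hw with hw | hw
    · exact ⟨hw.2, fun h => ha w h hw.1.symm⟩
    · exact ⟨hw.2, fun h => hb w h hw.1.symm⟩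
  have hcard := Finset.card_le_card hsub
  have hdisH : Disjoint (Q₁ ++ Q₂).toFinset H := by
    rw [Finset.disjoint_left]
    intro w hw hw'
    exact hH.not_mem w hw' (List.mem_toFinset.1 hw)
  have huniv := Finset.card_add_card_compl ((Q₁ ++ Q₂).toFinset ∪ H)
  rw [Finset.card_union_of_disjoint hdisH, List.toFinset_card_of_nodup hnd] at huniv
  rw [Finset.card_union_of_disjoint hdis] at hcard
  simp only [List.length_append] at huniv
  omega

lemma component_attachment (hk3 : 3 ≤ k)
    (hdeg : ∀ u v : V, G.dist u v = 2 → Fintype.card V - 1 ≤ G.degree u + G.degree v)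
    (hH : IsComp G C H) (hC : IsCyc G a b C) (hk : C.length = k)
    (hx : x ∈ H) (hy : y ∈ H) (hv₁ : v₁ ∈ C) (hv₂ : v₂ ∈ C) (hne : v₁ ≠ v₂)
    (hvx : G.Adj v₁ x) (hvy : G.Adj v₂ y) :
    Fintype.card V ≤ C.countP (G.Adj x ·) + C.countP (G.Adj y ·) + H.card ∧ x = y := by
  obtain ⟨d, D, hD, hp⟩ := hC.rotate_last hv₁
  have hH' := hH.perm hp
  rw [← hp.countP_eq, ← hp.countP_eq]
  have hkD : D.length = k := by rw [hp.length_eq, hk]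
  have hlow : Fintype.card V ≤ D.countP (G.Adj x ·) + D.countP (G.Adj y ·) + H.card := by
    obtain ⟨s, t, rfl⟩ := List.append_of_mem (hp.mem_iff.2 hv₂)
    have ht : t ≠ [] := by
      rintro rfl
      have := hD.last
      simp at this
      exact hne this.symm
    have hs : s ++ v₂ :: t = (s ++ [v₂]) ++ t := by simp
    rw [hs] at hD hH' hkD ⊢
    obtain ⟨c, e, t1, t2, t3, t4⟩ := hD.rotate (by simp) ht
    obtain rfl : c = v₂ := by
      have := t1.last
      simpa using this.symm
    have hcyc := not_adj_component hmax hH' hD hkD hx hvx hx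
    have hp' : (t ++ (s ++ [c])).Perm ((s ++ [c]) ++ t) := List.perm_append_comm
    have hcyc' := not_adj_component hmax (hH'.perm hp') t4 (by rw [hp'.length_eq, hkD]) hy hvy hy
    have g1 := hdeg x d (dist_eq_two (fun h => hH'.not_mem x hx (h ▸ hD.head_mem)) hcyc
      hvx.symm hD.adj)
    have g2 := hdeg y e (dist_eq_two (fun h => hH'.not_mem y hy
      (h ▸ hp'.mem_iff.1 t4.head_mem)) hcyc' hvy.symm t3)
    have g3 := degree_add_degree_le hmax hH' t1 t2 t3 hD.adj hD.nodup hkD hx hy hvx hvy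
    have g4 := hH'.degree_lt hD.nodup hx
    have g5 := hH'.degree_lt hD.nodup hy
    have : 0 < Fintype.card V := Fintype.card_pos_iff.2 ⟨x⟩
    omega
  refine ⟨hlow, ?_⟩
  by_contra hxy
  have hcard : D.length + H.card ≤ Fintype.card V := by
    rw [← List.toFinset_card_of_nodup hD.nodup, ← Finset.card_union_of_disjoint]
    · exact Finset.card_le_univ _
    · rw [Finset.disjoint_left]
      intro w hw hw'
      exact hH'.not_mem w hw' (List.mem_toFinset.1 hw)
  obtain ⟨P, hP, hPn, hPH⟩ := hH'.track x hx y hy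
  have hnd := hH'.nodup_append hD.nodup hPn hPH
  match D with
  | [] => simp at hkD; omega
  | [_] => simp at hkD; omega
  | d' :: e :: S =>
    obtain rfl : d' = d := by simpa using hD.head
    have n1 := not_adj_component hmax hH' hD hkD hx hvx hx
    have n2 := not_adj_component hmax hH' hD hkD hx hvx hy
    have n3 := not_adj_second_of_longest hmax hD hkD hP hxy hnd hvx
    have hch := isChain_of_longest hmax hD hkD hP hnd
    have := countP_add_countP_le (G.Adj y ·) (G.Adj x ·) (e :: S)
      (List.isChain_cons_cons.1 hch).2 (by simpa using n3)
    rw [List.countP_cons_of_neg (l := e :: S) (by simpa using n1),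
      List.countP_cons_of_neg (l := e :: S) (by simpa using n2)] at hlow
    simp only [List.length_cons] at *
    omega

end Longest

end Component

section Extremal

variable {G : SimpleGraph V} {a b x v w z : V} {C D : List V} {H : Finset V} {k : ℕ}

lemma IsComp.exists_attachment [Fintype V] (hH : IsComp G C H) (h2c : TwoConnected G)
    (hz : z ∈ H) (hzw : z ≠ w) (hv : v ∈ C) (hvw : v ≠ w) :
    ∃ x u, x ∈ H ∧ u ∈ C ∧ x ≠ w ∧ u ≠ w ∧ G.Adj u x := by
  obtain ⟨x, u, hxu, hx, hu⟩ := exists_adj_of_reachable (· ∈ H)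
    (reachable_of_twoConnected h2c hzw hvw) hz (fun h => hH.not_mem v h hv)
  refine ⟨x, u, hx, ?_, hxu.2.1, hxu.2.2, hxu.1.symm⟩
  by_contra huC
  exact hu (hH.closed x hx u hxu.1 huC)

variable [Fintype V] [DecidableEq V]

/-- In a graph satisfying the degree condition, a longest cycle which is not Hamiltonian misses
only one vertex, which is adjacent to at least half of the vertices of the cycle. -/
lemma exists_unique_missing (hmax : ∀ a b l, IsCyc G a b l → l.length ≤ k) (hk3 : 3 ≤ k)
    (h2c : TwoConnected G)
    (hdeg : ∀ u v : V, G.dist u v = 2 → Fintype.card V - 1 ≤ G.degree u + G.degree v)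
    (hC : IsCyc G a b C) (hk : C.length = k) (hz : z ∉ C) :
    ∃ x, IsComp G C {x} ∧ Fintype.card V ≤ 2 * C.countP (G.Adj x ·) + 1 := by
  obtain ⟨H, hzH, hH⟩ := exists_isComp (G := G) hz
  have hab : a ≠ b := hC.adj.ne'
  obtain ⟨x, v₁, hx, hv₁, -, -, hvx⟩ := hH.exists_attachment h2c (w := b) hzH
    (fun h => hz (h ▸ hC.last_mem)) hC.head_mem hab
  obtain ⟨c, hc, hcv⟩ : ∃ c ∈ C, c ≠ v₁ := by
    by_cases h : a = v₁
    · exact ⟨b, hC.last_mem, by rw [← h]; exact hab.symm⟩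
    · exact ⟨a, hC.head_mem, h⟩
  obtain ⟨y, v₂, hy, hv₂, -, hne, hvy⟩ := hH.exists_attachment h2c (w := v₁) hzH
    (fun h => hz (h ▸ hv₁)) hc hcv
  obtain ⟨hle, rfl⟩ := component_attachment hmax hk3 hdeg hH hC hk hx hy hv₁ hv₂ hne.symm hvx hvy
  have hHx : H = {x} := by
    rw [Finset.eq_singleton_iff_unique_mem]
    refine ⟨hx, fun u hu => ?_⟩
    by_contra hux
    obtain ⟨t, v₃, ht, hv₃, htx, -, hvt⟩ := hH.exists_attachment h2c (w := x) hu hux hC.head_mem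
      (fun h => hH.not_mem x hx (h ▸ hC.head_mem))
    by_cases h31 : v₃ = v₁
    · subst h31
      exact htx (component_attachment hmax hk3 hdeg hH hC hk ht hx hv₃ hv₂ hne.symm hvt hvy).2
    · exact htx (component_attachment hmax hk3 hdeg hH hC hk ht hx hv₃ hv₁ h31 hvt hvx).2
  subst hHx
  refine ⟨x, hH, ?_⟩
  rw [Finset.card_singleton] at hle
  omega

omit [Fintype V] in
/-- If `x` is adjacent to half of the vertices of a longest cycle, then the neighbours of `x`
alternate with the other vertices along the cycle. -/
lemma adj_pred (hmax : ∀ a b l, IsCyc G a b l → l.length ≤ k) (hk3 : 3 ≤ k)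
    (hH : IsComp G C {x}) (hC : IsCyc G a v C) (hk : C.length = k)
    (hle : k ≤ 2 * C.countP (G.Adj x ·)) (ha : ¬G.Adj x a) : G.Adj x v := by
  by_contra hv
  have hch := isChain_of_longest hmax hC hk (IsTrack.singleton G x)
    (hH.nodup_append_singleton hC.nodup)
  obtain ⟨L, rfl⟩ : ∃ L, C = L ++ [v] :=
    ⟨C.dropLast, (List.dropLast_append_getLast? v hC.last).symm⟩
  have hL : L.head? = some a := by
    have := hC.head
    cases L with
    | nil => simp at hk; omega
    | cons c L => simpa using this
  have := countP_add_countP_le (G.Adj x ·) (G.Adj x ·) L (List.isChain_append.1 hch).1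
    (by simpa [hL] using ha)
  rw [List.countP_append, List.countP_singleton, if_neg (by simpa using hv)] at hle
  simp at hk
  omega

lemma inPsi_of_missing (hmax : ∀ a b l, IsCyc G a b l → l.length ≤ k) (hk3 : 3 ≤ k)
    (hdeg : ∀ u v : V, G.dist u v = 2 → Fintype.card V - 1 ≤ G.degree u + G.degree v)
    (hC : IsCyc G a b C) (hk : C.length = k) (hH : IsComp G C {x})
    (hle : Fintype.card V ≤ 2 * C.countP (G.Adj x ·) + 1) :
    ∃ m : ℕ, Fintype.card V = 2 * m + 1 ∧ InPsi G m := by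
  have hxC : x ∉ C := hH.not_mem x (by simp)
  have hkV : k + 1 ≤ Fintype.card V := by
    have := (hH.nodup_append_singleton hC.nodup).length_le_card
    simpa [hk] using this
  have hlek : k ≤ 2 * C.countP (G.Adj x ·) := by omega
  have hpred : ∀ {c v D}, IsCyc G c v D → D.Perm C → ¬G.Adj x c → G.Adj x v := by
    intro c v D hD hp hc
    exact adj_pred hmax hk3 (hH.perm hp) hD (by rw [hp.length_eq, hk])
      (by rw [hp.countP_eq]; exact hlek) hc
  have hnotadj : ∀ c ∈ C, ∀ d ∈ C, ¬G.Adj x c → ¬G.Adj x d → ¬G.Adj c d := by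
    intro c hc d hd hxc hxd
    by_cases hcd : c = d
    · subst hcd; exact G.irrefl
    obtain ⟨v, D, hD, hp⟩ := hC.rotate_head hc
    obtain ⟨s, t, rfl⟩ := List.append_of_mem (hp.mem_iff.2 hd)
    have hs : s ≠ [] := by
      rintro rfl
      have := hD.head
      simp at this
      exact hcd this.symm
    obtain ⟨u, e, t1, t2, -, t4⟩ := hD.rotate hs (by simp)
    obtain rfl : d = e := by simpa using t2.head
    exact not_adj_succ_succ hmax t1 t2 (by rw [hp.length_eq, hk]) (IsTrack.singleton G x)
      ((hH.perm hp).nodup_append_singleton hD.nodup) (hpred hD hp hxc).symm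
      (hpred t4 (List.perm_append_comm.trans hp) hxd).symm
  have hupper : 2 * C.countP (G.Adj x ·) ≤ k := by
    obtain ⟨c, hc, hxc⟩ : ∃ c ∈ C, ¬G.Adj x c := by
      by_contra! hall
      exact not_adj_of_longest hmax hC hk (IsTrack.singleton G x)
        (hH.nodup_append_singleton hC.nodup) (hall b hC.last_mem).symm (hall a hC.head_mem)
    obtain ⟨v, D, hD, hp⟩ := hC.rotate_head hc
    have := countP_add_countP_le (G.Adj x ·) (G.Adj x ·) D
      (isChain_of_longest hmax hD (by rw [hp.length_eq, hk]) (IsTrack.singleton G x)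
        ((hH.perm hp).nodup_append_singleton hD.nodup)) (by simpa [hD.head] using hxc)
    rw [hp.countP_eq, hp.length_eq] at this
    omega
  have hcard : Fintype.card V = k + 1 := by omega
  have hmem : ∀ z, z ∉ C → z = x := by
    intro z hz
    by_contra hzx
    have hnd : (z :: (C ++ [x])).Nodup :=
      List.nodup_cons.2 ⟨by simp [hz, hzx], hH.nodup_append_singleton hC.nodup⟩
    have := hnd.length_le_card
    simp at this
    omega
  have hdx : G.degree x = C.countP (G.Adj x ·) := by
    have h1 := hH.degree_lt hC.nodup (Finset.mem_singleton_self x)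
    have h2 := degree_eq_countP_add (G := G) hC.nodup x
    rw [Finset.card_singleton] at h1
    omega
  have hfull : ∀ c ∈ C, ¬G.Adj x c → ∀ y, G.Adj x y → G.Adj c y := by
    intro c hc hxc y hxy
    have hsub : G.neighborFinset c ⊆ G.neighborFinset x := by
      intro w hw
      rw [mem_neighborFinset] at hw ⊢
      by_contra hxw
      by_cases hwC : w ∈ C
      · exact hnotadj c hc w hwC hxc hxw hw
      · obtain rfl := hmem w hwC
        exact hxc hw.symm
    obtain ⟨v, D, hD, hp⟩ := hC.rotate_head hc
    have hdist := dist_eq_two (fun h : x = c => hxC (h ▸ hc)) hxc (hpred hD hp hxc) hD.adj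
    have := hdeg x c hdist
    have heq := Finset.eq_of_subset_of_card_le hsub (by
      rw [card_neighborFinset_eq_degree, card_neighborFinset_eq_degree]; omega)
    rw [← mem_neighborFinset, heq, mem_neighborFinset]
    exact hxy
  refine ⟨G.degree x, by omega, G.neighborFinset x, (G.neighborFinset x ∪ {x})ᶜ, x,
    card_neighborFinset_eq_degree .., ?_, by simp, by simp, ?_, ?_, ?_, ?_⟩
  · rw [Finset.card_compl, Finset.card_union_of_disjoint (by simp),
      card_neighborFinset_eq_degree, Finset.card_singleton]
    omega
  · exact disjoint_compl_right.mono_left Finset.subset_union_left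
  · ext w
    by_cases h : w = x <;> simp [h]
  all_goals
    have hB : ∀ c ∈ (G.neighborFinset x ∪ {x})ᶜ ∪ {x}, ¬G.Adj x c ∧ (c = x ∨ c ∈ C) := by
      intro c hc
      refine ⟨?_, ?_⟩
      · rcases eq_or_ne c x with rfl | hcx
        · exact G.irrefl
        · simpa [hcx] using hc
      · by_contra! h
        exact h.1 (hmem c h.2)
  · intro c hc d hd
    obtain ⟨c1, rfl | c2⟩ := hB c hc
    · exact (hB d hd).1
    · obtain ⟨d1, rfl | d2⟩ := hB d hd
      · exact fun h => c1 h.symm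
      · exact hnotadj c c2 d d2 c1 d1
  · intro c hc y hy
    rw [mem_neighborFinset] at hy
    obtain ⟨c1, rfl | c2⟩ := hB c hc
    · exact hy
    · exact hfull c c2 c1 y hy

end Extremal

end LongCycle

/-- A 2-connected graph with `n ≥ 3` vertices in which `d(u) + d(v) ≥ n - 1` for every pair of
vertices at distance 2 is Hamiltonian, unless `n` is odd and `G ∈ ψ_n`. -/
theorem stmt_1 {V : Type*} [Fintype V] [DecidableEq V] (G : SimpleGraph V)
    (hn : 3 ≤ Fintype.card V) (h2c : TwoConnected G)
    (hdeg : ∀ u v : V, G.dist u v = 2 →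
      Fintype.card V - 1 ≤ G.degree u + G.degree v) :
    G.IsHamiltonian ∨ ∃ m : ℕ, Fintype.card V = 2 * m + 1 ∧ InPsi G m := by
  obtain ⟨a, b, C, hC, h3, hmax⟩ := LongCycle.exists_longest_isCyc h2c
  by_cases hall : ∀ v, v ∈ C
  · exact Or.inl (LongCycle.isHamiltonian_of_isCyc hC h3 hall)
  · obtain ⟨z, hz⟩ := not_forall.1 hall
    obtain ⟨x, hx, hle⟩ := LongCycle.exists_unique_missing hmax h3 h2c hdeg hC rfl hz
    exact Or.inr (LongCycle.inPsi_of_missing hmax h3 hdeg hC rfl hx hle)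
end

section
/- Let G be a 2-connected simple graph with n ≥ 3 vertices such that d(u) + d(v) ≥ n − 1 for every pair of nonadjacent vertices u, v of G. Then G is Hamiltonian, unless n is odd and G belongs to ψ_n. -/
open Finset SimpleGraph
open scoped Classical

namespace SimpleGraph

variable {V : Type*} {G : SimpleGraph V}

/-- The list `l` enumerates, without repetition, the vertices of a closed walk of `G`. -/
def IsCyclicList (G : SimpleGraph V) (l : List V) : Prop :=
  l.Nodup ∧ l.IsChain G.Adj ∧ ∀ a ∈ l.getLast?, ∀ b ∈ l.head?, G.Adj a b

/-- `c` runs periodically around a cyclic sequence of `N` distinct vertices of `G`, consecutive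
ones being adjacent. -/
structure IsPeriodicCycle (G : SimpleGraph V) (c : ℕ → V) (N : ℕ) : Prop where
  pos : 0 < N
  periodic : ∀ i, c (i + N) = c i
  adj : ∀ i, G.Adj (c i) (c (i + 1))
  injOn : ∀ s, Set.InjOn c (Set.Ico s (s + N))

/-- The first `k` values of `f` are the successive vertices of a path of `G`. -/
structure IsPathSeq (G : SimpleGraph V) (f : ℕ → V) (k : ℕ) : Prop where
  injOn : Set.InjOn f (Set.Iio k)
  adj : ∀ i, i + 1 < k → G.Adj (f i) (f (i + 1))

theorem _root_.List.Ico.isChain_of_forall {R : ℕ → ℕ → Prop} {a b : ℕ}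
    (h : ∀ i, a ≤ i → i + 1 < b → R i (i + 1)) : (List.Ico a b).IsChain R := by
  rw [List.isChain_iff_getElem]
  intro i hi
  simp only [List.Ico.length] at hi
  simpa [List.Ico, Nat.add_assoc] using h (a + i) (by omega) (by omega)

theorem _root_.List.Ico.head?_eq {a b : ℕ} (h : a < b) : (List.Ico a b).head? = some a := by
  rw [List.Ico.eq_cons h, List.head?_cons]

theorem _root_.List.Ico.getLast?_eq {a b : ℕ} (h : a < b) :
    (List.Ico a b).getLast? = some (b - 1) := by
  obtain ⟨b, rfl⟩ : ∃ k, b = k + 1 := ⟨b - 1, by omega⟩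
  rw [List.Ico.succ_top (by omega)]
  simp

theorem IsCyclicList.isHamiltonian [Fintype V] [DecidableEq V] {l : List V}
    (hl : G.IsCyclicList l) (hcard : l.length = Fintype.card V) (h3 : 3 ≤ Fintype.card V) :
    G.IsHamiltonian := by
  obtain ⟨hnd, hch, hcl⟩ := hl
  have hne : l ≠ [] := by rintro rfl; simp at hcard; omega
  have hadj : G.Adj (l.getLast hne) (l.head hne) :=
    hcl _ (List.getLast?_eq_getLast_of_ne_nil hne ▸ rfl) _ (List.head?_eq_some_head hne ▸ rfl)
  have hp : (Walk.ofSupport l hne hch).IsPath := by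
    rw [Walk.isPath_def, Walk.support_ofSupport]; exact hnd
  refine fun _ ↦ ⟨_, Walk.cons hadj (Walk.ofSupport l hne hch), ?_⟩
  rw [Walk.isHamiltonianCycle_iff_isCycle_and_length_eq,
    Walk.isCycle_iff_isPath_tail_and_le_length]
  simp only [Walk.length_cons, Walk.length_ofSupport]
  refine ⟨⟨?_, by omega⟩, by omega⟩
  simpa using hp

theorem IsCyclicList.exists_isPeriodicCycle {l : List V} (hl : G.IsCyclicList l) (hne : l ≠ []) :
    ∃ c, G.IsPeriodicCycle c l.length ∧ ∀ i, c i ∈ l := by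
  obtain ⟨hnd, hch, hcl⟩ := hl
  have hpos : 0 < l.length := List.length_pos_iff.2 hne
  have hadj : G.Adj (l.getLast hne) (l.head hne) :=
    hcl _ (List.getLast?_eq_getLast_of_ne_nil hne ▸ rfl) _ (List.head?_eq_some_head hne ▸ rfl)
  refine ⟨fun i ↦ l[i % l.length]'(Nat.mod_lt _ hpos),
    ⟨hpos, by simp, fun i ↦ ?_, fun s i hi j hj h ↦ ?_⟩, by simp⟩
  · have hlt := Nat.mod_lt i hpos
    by_cases h : i % l.length + 1 < l.length
    · have h1 : (i + 1) % l.length = i % l.length + 1 := by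
        rw [Nat.add_mod, Nat.mod_eq_of_lt (show 1 < l.length by omega), Nat.mod_eq_of_lt h]
      simp only [h1]
      exact hch.getElem _ h
    · have h2 : i % l.length = l.length - 1 := by omega
      have h1 : (i + 1) % l.length = 0 := by
        rw [← Nat.mod_add_mod, h2, Nat.sub_add_cancel hpos, Nat.mod_self]
      simp only [h1, h2]
      rw [List.getLast_eq_getElem, List.head_eq_getElem_zero] at hadj
      exact hadj
  · have h' : i ≡ j [MOD l.length] := (hnd.getElem_inj_iff).1 h
    simp only [Set.mem_Ico] at hi hj
    rcases le_total i j with hij | hij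
    · obtain ⟨t, ht⟩ := (Nat.modEq_iff_dvd' hij).1 h'
      rcases Nat.eq_zero_or_pos t with rfl | htp
      · omega
      · have := Nat.le_mul_of_pos_right l.length htp
        omega
    · obtain ⟨t, ht⟩ := (Nat.modEq_iff_dvd' hij).1 h'.symm
      rcases Nat.eq_zero_or_pos t with rfl | htp
      · omega
      · have := Nat.le_mul_of_pos_right l.length htp
        omega

/-- Reordering an injective sequence of vertices along a cyclic list of indices. -/
theorem isCyclicList_map {f : ℕ → V} {s : Set ℕ} (hf : Set.InjOn f s) {L : List ℕ}
    (hs : ∀ i ∈ L, i ∈ s) (hnd : L.Nodup) (hch : L.IsChain fun i j ↦ G.Adj (f i) (f j))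
    (hcl : ∀ a ∈ L.getLast?, ∀ b ∈ L.head?, G.Adj (f a) (f b)) : G.IsCyclicList (L.map f) := by
  refine ⟨hnd.map_on fun i hi j hj h ↦ hf (hs i hi) (hs j hj) h, (List.isChain_map f).2 hch, ?_⟩
  simpa using hcl

/-- A Hamiltonian cycle through one vertex `u` and a reordering of a sequence avoiding `u`. -/
theorem isHamiltonian_of_cons_map [Fintype V] [DecidableEq V] (h3 : 3 ≤ Fintype.card V)
    {f : ℕ → V} {u : V} {s : Set ℕ} (hf : Set.InjOn f s) (hu : ∀ i, f i ≠ u) {L : List ℕ}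
    (hs : ∀ i ∈ L, i ∈ s) (hnd : L.Nodup) (hlen : L.length + 1 = Fintype.card V)
    (hch : L.IsChain fun i j ↦ G.Adj (f i) (f j))
    (hlast : ∀ a ∈ L.getLast?, G.Adj (f a) u) (hhead : ∀ b ∈ L.head?, G.Adj u (f b)) :
    G.IsHamiltonian := by
  have hne : L ≠ [] := by rintro rfl; simp at hlen; omega
  refine IsCyclicList.isHamiltonian (l := u :: L.map f) ⟨?_, ?_, ?_⟩ (by simpa using hlen) h3
  · refine List.nodup_cons.2 ⟨by simpa using fun i _ ↦ hu i, ?_⟩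
    exact hnd.map_on fun i hi j hj h ↦ hf (hs i hi) (hs j hj) h
  · rw [List.isChain_cons, List.isChain_map]
    refine ⟨by simpa using hhead, hch⟩
  · obtain ⟨a, ha⟩ : ∃ a, L.getLast? = some a := ⟨_, List.getLast?_eq_getLast_of_ne_nil hne⟩
    have := hlast a ha
    simpa [List.getLast?_cons, ha] using this

theorem Preconnected.exists_adj_boundary (h : G.Preconnected) {S : Set V} {x y : V}
    (hx : x ∈ S) (hy : y ∉ S) : ∃ a ∈ S, ∃ b ∉ S, G.Adj a b := by
  obtain ⟨p⟩ := h x y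
  obtain ⟨d, -, h1, h2⟩ := p.exists_boundary_dart S hx hy
  exact ⟨_, h1, _, h2, d.adj⟩

namespace IsPeriodicCycle

variable {c : ℕ → V} {N : ℕ}

theorem periodic_mul (h : G.IsPeriodicCycle c N) (i t : ℕ) : c (i + N * t) = c i := by
  induction t with
  | zero => simp
  | succ t ih => rw [Nat.mul_succ, ← Nat.add_assoc, h.periodic, ih]

/-- Every value is taken in every window of length `N`. -/
theorem exists_mem_Ico (h : G.IsPeriodicCycle c N) (s j : ℕ) :
    ∃ i, s ≤ i ∧ i < s + N ∧ c i = c j := by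
  have hN := h.pos
  refine ⟨s + (j + s * N - s) % N, by omega, by have := Nat.mod_lt (j + s * N - s) hN; omega, ?_⟩
  have hs : s ≤ s * N := Nat.le_mul_of_pos_right s hN
  rw [← h.periodic_mul _ ((j + s * N - s) / N), Nat.add_assoc, Nat.mod_add_div,
    show s + (j + s * N - s) = j + s * N by omega, Nat.mul_comm s N, h.periodic_mul]

theorem apply_mod (h : G.IsPeriodicCycle c N) (i : ℕ) : c (i % N) = c i := by
  rw [← h.periodic_mul _ (i / N), Nat.mod_add_div]

theorem eq_iff_modEq (h : G.IsPeriodicCycle c N) {i j : ℕ} : c i = c j ↔ i ≡ j [MOD N] := by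
  refine ⟨fun hij ↦ ?_, fun hij ↦ by rw [← h.apply_mod i, ← h.apply_mod j, hij]⟩
  refine h.injOn 0 ?_ ?_ (by rw [h.apply_mod, h.apply_mod, hij])
  · simpa using Nat.mod_lt i h.pos
  · simpa using Nat.mod_lt j h.pos

theorem succ_eq_succ_iff (h : G.IsPeriodicCycle c N) {i j : ℕ} :
    c (i + 1) = c (j + 1) ↔ c i = c j := by
  rw [h.eq_iff_modEq, h.eq_iff_modEq]
  exact ⟨Nat.ModEq.add_right_cancel' 1, Nat.ModEq.add_right 1⟩

theorem card_image [DecidableEq V] (h : G.IsPeriodicCycle c N) :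
    ((range N).image c).card = N := by
  rw [card_image_of_injOn, card_range]
  exact fun i hi j hj ↦ h.injOn 0 (by simpa using hi) (by simpa using hj)

theorem apply_mem_image [DecidableEq V] (h : G.IsPeriodicCycle c N) (i : ℕ) :
    c i ∈ (range N).image c := by
  obtain ⟨j, -, hj, hc⟩ := h.exists_mem_Ico 0 i
  exact mem_image.2 ⟨j, by simpa using hj, hc⟩

theorem exists_isPathSeq_succ [Fintype V] [DecidableEq V] (h : G.IsPeriodicCycle c N)
    (hG : G.Preconnected) (hN : N < Fintype.card V) : ∃ f, G.IsPathSeq f (N + 1) := by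
  obtain ⟨v, hv⟩ : ∃ v, v ∉ (range N).image c := by
    by_contra! hall
    have := card_le_card (fun v _ ↦ hall v : (univ : Finset V) ⊆ _)
    rw [h.card_image, card_univ] at this
    omega
  obtain ⟨_, ⟨i, rfl⟩, b, hb, hab⟩ := hG.exists_adj_boundary (S := Set.range c) (x := c 0) (y := v)
    ⟨0, rfl⟩ (by rintro ⟨i, rfl⟩; exact hv (h.apply_mem_image i))
  have hb' : ∀ j, c j ≠ b := fun j hj ↦ hb ⟨j, hj⟩
  refine ⟨fun j ↦ Nat.casesOn j b fun j ↦ c (i + j), ?_, ?_⟩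
  · rintro (_ | j) hj (_ | k) hk hjk
    · rfl
    · exact absurd hjk.symm (hb' _)
    · exact absurd hjk (hb' _)
    · simp only [Set.mem_Iio] at hj hk
      have := h.injOn i (Set.mem_Ico.2 ⟨by omega, by omega⟩)
        (Set.mem_Ico.2 ⟨by omega, by omega⟩) hjk
      omega
  · rintro (_ | j) hj
    · exact hab.symm
    · exact h.adj (i + j)

section Spanning

variable [Fintype V] [DecidableEq V] {u : V}

theorem exists_of_ne (h : G.IsPeriodicCycle c N) (hN : N + 1 = Fintype.card V)
    (hu : ∀ i, c i ≠ u) {v : V} (hv : v ≠ u) (s : ℕ) : ∃ i, s ≤ i ∧ i < s + N ∧ c i = v := by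
  have huniv : insert u ((range N).image c) = univ := by
    rw [← card_eq_iff_eq_univ, card_insert_of_notMem (by simpa using fun i _ ↦ hu i), h.card_image,
      hN]
  have hmem := huniv ▸ mem_univ v
  obtain ⟨j, -, rfl⟩ := Finset.mem_image.1 ((mem_insert.1 hmem).resolve_left hv)
  exact h.exists_mem_Ico s j

theorem not_adj_succ (h : G.IsPeriodicCycle c N) (hN : N + 1 = Fintype.card V)
    (h3 : 3 ≤ Fintype.card V) (hham : ¬G.IsHamiltonian) (hu : ∀ i, c i ≠ u) {i : ℕ}
    (hi : G.Adj u (c i)) : ¬G.Adj u (c (i + 1)) := by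
  intro hi'
  have hpos := h.pos
  have hper := h.periodic i
  refine hham (isHamiltonian_of_cons_map h3 (h.injOn (i + 1)) hu (L := List.Ico (i + 1) (i + 1 + N))
    (by simp) (List.Ico.nodup _ _) (by simp [hN])
    (List.Ico.isChain_of_forall fun j _ _ ↦ h.adj j) ?_ ?_)
  · rw [List.Ico.getLast?_eq (by omega), show i + 1 + N - 1 = i + N by omega]
    simpa [hper] using hi.symm
  · rw [List.Ico.head?_eq (by omega)]
    simpa using hi'

theorem not_adj_succ_succ (h : G.IsPeriodicCycle c N) (hN : N + 1 = Fintype.card V)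
    (h3 : 3 ≤ Fintype.card V) (hham : ¬G.IsHamiltonian) (hu : ∀ i, c i ≠ u) {i j : ℕ}
    (hi : G.Adj u (c i)) (hj : G.Adj u (c j)) : ¬G.Adj (c (i + 1)) (c (j + 1)) := by
  intro hij
  obtain ⟨t, ht1, ht2, htj⟩ := h.exists_mem_Ico (i + 1) j
  have htj' : c (t + 1) = c (j + 1) := h.succ_eq_succ_iff.2 htj
  have hpos := h.pos
  have hper := h.periodic i
  rw [← htj'] at hij
  rw [← htj] at hj
  have hti : t ≠ i + N := by
    rintro rfl
    rw [show i + N + 1 = i + 1 + N by omega, h.periodic] at hij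
    exact hij.ne rfl
  refine hham (isHamiltonian_of_cons_map h3 (h.injOn (i + 1)) hu
    (L := (List.Ico (i + 1) (t + 1)).reverse ++ List.Ico (t + 1) (i + 1 + N))
    ?_ ?_ ?_ ?_ ?_ ?_)
  · simp; omega
  · simp [List.nodup_append, List.Ico.nodup]; omega
  · simp; omega
  · rw [List.isChain_append, List.isChain_reverse, List.getLast?_reverse,
      List.Ico.head?_eq (by omega), List.Ico.head?_eq (by omega)]
    exact ⟨List.Ico.isChain_of_forall fun j _ _ ↦ (h.adj j).symm,
      List.Ico.isChain_of_forall fun j _ _ ↦ h.adj j, by simpa using hij⟩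
  · rw [List.getLast?_append, List.Ico.getLast?_eq (by omega),
      show i + 1 + N - 1 = i + N by omega]
    simpa [hper] using hi.symm
  · rw [List.head?_append, List.head?_reverse, List.Ico.getLast?_eq (by omega)]
    simpa using hj

theorem card_successors (h : G.IsPeriodicCycle c N) (hN : N + 1 = Fintype.card V)
    (hu : ∀ i, c i ≠ u) :
    (univ.filter fun v ↦ ∃ i, G.Adj u (c i) ∧ c (i + 1) = v).card = G.degree u := by
  have h1 : (univ.filter fun v ↦ ∃ i, G.Adj u (c i) ∧ c (i + 1) = v) =
      ((range N).filter fun i ↦ G.Adj u (c i)).image fun i ↦ c (i + 1) := by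
    ext v
    simp only [mem_filter, mem_univ, true_and, Finset.mem_image, mem_range]
    constructor
    · rintro ⟨i, hi, rfl⟩
      obtain ⟨j, -, hj, hji⟩ := h.exists_mem_Ico 0 i
      exact ⟨j, ⟨by omega, hji ▸ hi⟩, h.succ_eq_succ_iff.2 hji⟩
    · rintro ⟨i, ⟨-, hi⟩, rfl⟩
      exact ⟨i, hi, rfl⟩
  have h2 : G.neighborFinset u = ((range N).filter fun i ↦ G.Adj u (c i)).image c := by
    ext v
    simp only [mem_neighborFinset, Finset.mem_image, mem_filter, mem_range]
    constructor
    · intro hv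
      obtain ⟨i, -, hi, rfl⟩ := h.exists_of_ne hN hu hv.ne' 0
      exact ⟨i, ⟨by omega, hv⟩, rfl⟩
    · rintro ⟨i, ⟨-, hi⟩, rfl⟩
      exact hi
  rw [← card_neighborFinset_eq_degree, h1, h2, card_image_of_injOn, card_image_of_injOn]
  · intro i hi j hj
    simp only [coe_filter, mem_range, Set.mem_ofPred_eq] at hi hj
    exact h.injOn 0 (by simpa using hi.1) (by simpa using hj.1)
  · intro i hi j hj hij
    simp only [coe_filter, mem_range, Set.mem_ofPred_eq] at hi hj
    have := h.injOn 1 (Set.mem_Ico.2 ⟨by omega, by omega⟩) (Set.mem_Ico.2 ⟨by omega, by omega⟩) hij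
    omega

/-- On a cycle missing only `u`, the successor of a neighbour of `u` is adjacent to every
vertex that is neither `u` nor such a successor. -/
theorem succ_adj_of_forall_ne (h : G.IsPeriodicCycle c N) (hN : N + 1 = Fintype.card V)
    (h3 : 3 ≤ Fintype.card V) (hham : ¬G.IsHamiltonian) (hu : ∀ i, c i ≠ u)
    (hdeg : ∀ u v : V, u ≠ v → ¬G.Adj u v → Fintype.card V - 1 ≤ G.degree u + G.degree v)
    {i : ℕ} (hi : G.Adj u (c i)) {v : V} (hvu : v ≠ u)
    (hv : ∀ j, G.Adj u (c j) → c (j + 1) ≠ v) : G.Adj (c (i + 1)) v := by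
  set B := univ.filter fun v ↦ ∃ i, G.Adj u (c i) ∧ c (i + 1) = v with hB
  have hnadj := h.not_adj_succ hN h3 hham hu hi
  have hd := hdeg _ _ (hu (i + 1)).symm hnadj
  have huB : u ∉ B := by simpa [hB] using fun j _ ↦ hu (j + 1)
  have hsub : G.neighborFinset (c (i + 1)) ⊆ (insert u B)ᶜ := by
    intro w hw
    rw [mem_neighborFinset] at hw
    rw [mem_compl, mem_insert, not_or]
    refine ⟨?_, ?_⟩
    · rintro rfl
      exact hnadj hw.symm
    · simp only [hB, mem_filter, mem_univ, true_and, not_exists, not_and]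
      rintro j hj rfl
      exact h.not_adj_succ_succ hN h3 hham hu hi hj hw
  have heq := eq_of_subset_of_card_le hsub (by
    rw [card_compl, card_insert_of_notMem huB, hB, h.card_successors hN hu,
      card_neighborFinset_eq_degree]
    omega)
  rw [← mem_neighborFinset, heq, mem_compl, mem_insert, not_or]
  refine ⟨hvu, ?_⟩
  simpa [hB] using hv

theorem adj_succ_succ (h : G.IsPeriodicCycle c N) (hN : N + 1 = Fintype.card V)
    (h3 : 3 ≤ Fintype.card V) (hham : ¬G.IsHamiltonian) (hu : ∀ i, c i ≠ u)
    (hdeg : ∀ u v : V, u ≠ v → ¬G.Adj u v → Fintype.card V - 1 ≤ G.degree u + G.degree v)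
    (hu2 : ∀ w, ∃ v, v ≠ w ∧ G.Adj u v) {i : ℕ} (hi : G.Adj u (c i)) : G.Adj u (c (i + 2)) := by
  by_contra hi2
  have hi1 := h.not_adj_succ hN h3 hham hu hi
  have hper := h.periodic i
  obtain ⟨v, hvi, huv⟩ := hu2 (c i)
  obtain ⟨j, hj1, hj2, rfl⟩ := h.exists_of_ne hN hu huv.ne' i
  have hji : j ≠ i := by rintro rfl; exact hvi rfl
  have hji1 : j ≠ i + 1 := by rintro rfl; exact hi1 huv
  have hji2 : j ≠ i + 2 := by rintro rfl; exact hi2 huv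
  have key : ∀ {k l : ℕ}, G.Adj u (c k) → ¬G.Adj u (c l) → G.Adj (c (k + 1)) (c (l + 1)) := by
    intro k l hk hl
    refine h.succ_adj_of_forall_ne hN h3 hham hu hdeg hk (hu _) fun t ht htl ↦ hl ?_
    rwa [← h.succ_eq_succ_iff.1 htl]
  refine hham (isHamiltonian_of_cons_map h3 (h.injOn (i + 1)) hu
    (L := (List.Ico (j + 1) (i + 1 + N)).reverse ++ (i + 2) :: (i + 1) :: List.Ico (i + 3) (j + 1))
    ?_ ?_ ?_ ?_ ?_ ?_)
  · simp; omega
  · simp [List.nodup_append, List.Ico.nodup]; grind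
  · simp; omega
  · rw [List.isChain_append, List.isChain_reverse, List.getLast?_reverse,
      List.Ico.head?_eq (by omega), List.isChain_cons_cons, List.isChain_cons,
      List.Ico.head?_eq (by omega)]
    refine ⟨List.Ico.isChain_of_forall fun j _ _ ↦ (h.adj j).symm,
      ⟨(h.adj (i + 1)).symm, ?_, List.Ico.isChain_of_forall fun j _ _ ↦ h.adj j⟩, ?_⟩
    · simpa using key hi hi2
    · simpa using key huv hi1
  · rw [List.getLast?_append, List.getLast?_cons, List.getLast?_cons,
      List.Ico.getLast?_eq (by omega)]
    simpa using huv.symm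
  · rw [List.head?_append, List.head?_reverse, List.Ico.getLast?_eq (by omega),
      show i + 1 + N - 1 = i + N by omega]
    simpa [hper] using hi

theorem inPsi (h : G.IsPeriodicCycle c N) (hN : N + 1 = Fintype.card V)
    (h3 : 3 ≤ Fintype.card V) (hham : ¬G.IsHamiltonian) (hu : ∀ i, c i ≠ u)
    (hdeg : ∀ u v : V, u ≠ v → ¬G.Adj u v → Fintype.card V - 1 ≤ G.degree u + G.degree v)
    (hu2 : ∀ w, ∃ v, v ≠ w ∧ G.Adj u v) :
    Fintype.card V = 2 * G.degree u + 1 ∧ InPsi G (G.degree u) := by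
  set B := univ.filter fun v ↦ ∃ i, G.Adj u (c i) ∧ c (i + 1) = v with hB
  have hBc : B.card = G.degree u := h.card_successors hN hu
  have huA : u ∉ G.neighborFinset u := by simp
  have huB : u ∉ B := by simpa [hB] using fun j _ ↦ hu (j + 1)
  have hAB : Disjoint (G.neighborFinset u) B := by
    rw [Finset.disjoint_left]
    intro v hv hvB
    obtain ⟨i, hi, rfl⟩ : ∃ i, G.Adj u (c i) ∧ c (i + 1) = v := by simpa [hB] using hvB
    exact h.not_adj_succ hN h3 hham hu hi (by simpa using hv)
  have hunion : G.neighborFinset u ∪ B ∪ {u} = univ := by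
    refine eq_univ_of_forall fun v ↦ ?_
    by_cases hvu : v = u
    · simp [hvu]
    obtain ⟨w, -, huw⟩ := hu2 u
    obtain ⟨i, -, -, rfl⟩ := h.exists_of_ne hN hu huw.ne' 0
    have halt : ∀ t, G.Adj u (c (i + t)) ∨ G.Adj u (c (i + t + 1)) := by
      intro t
      induction t with
      | zero => exact Or.inl huw
      | succ t ih =>
        exact ih.symm.imp id fun h' ↦ h.adj_succ_succ hN h3 hham hu hdeg hu2 h'
    obtain ⟨j, hj, -, rfl⟩ := h.exists_of_ne hN hu hvu (i + 1)
    obtain ⟨t, rfl⟩ : ∃ t, j = i + t + 1 := ⟨j - i - 1, by omega⟩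
    rcases halt t with ht | ht
    · have : c (i + t + 1) ∈ B := by simpa [hB] using ⟨i + t, ht, rfl⟩
      simp [this]
    · simp [ht]
  refine ⟨?_, G.neighborFinset u, B, u, card_neighborFinset_eq_degree .., hBc, huA, huB, hAB,
    hunion, ?_, ?_⟩
  · rw [← card_univ, ← hunion, card_union_of_disjoint (by simp [huB]), card_union_of_disjoint hAB,
      hBc, card_neighborFinset_eq_degree, card_singleton]
    omega
  · have hB' : ∀ x ∈ B ∪ {u}, x = u ∨ ∃ i, G.Adj u (c i) ∧ c (i + 1) = x := by
      intro x hx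
      simpa [hB, or_comm] using hx
    intro x hx y hy
    rcases hB' x hx with rfl | ⟨i, hi, rfl⟩ <;> rcases hB' y hy with rfl | ⟨j, hj, rfl⟩
    · exact G.loopless.irrefl _
    · exact h.not_adj_succ hN h3 hham hu hj
    · exact fun hadj ↦ h.not_adj_succ hN h3 hham hu hi hadj.symm
    · exact h.not_adj_succ_succ hN h3 hham hu hi hj
  · intro x hx a ha
    rcases mem_union.1 hx with hx | hx
    · obtain ⟨i, hi, rfl⟩ : ∃ i, G.Adj u (c i) ∧ c (i + 1) = x := by simpa [hB] using hx
      have hua : G.Adj u a := by simpa using ha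
      refine h.succ_adj_of_forall_ne hN h3 hham hu hdeg hi hua.ne' ?_
      rintro j hj rfl
      exact h.not_adj_succ hN h3 hham hu hj hua
    · rw [mem_singleton.1 hx]
      simpa using ha

end Spanning

end IsPeriodicCycle

end SimpleGraph

namespace TwoConnected

variable {V : Type*} [Fintype V] {G : SimpleGraph V}

theorem preconnected (h : TwoConnected G) : G.Preconnected := by
  have h0 := (h.2 ∅ (by simp)).preconnected
  rw [Set.compl_empty] at h0
  exact (induceUnivIso G).preconnected_iff.1 h0

theorem exists_adj_boundary (h : TwoConnected G) {w x y : V} {S : Set V} (hx : x ∈ S) (hy : y ∉ S)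
    (hxw : x ≠ w) (hyw : y ≠ w) : ∃ a ∈ S, ∃ b ∉ S, a ≠ w ∧ b ≠ w ∧ G.Adj a b := by
  obtain ⟨a, ha, b, hb, hab⟩ := (h.2 {w} (by simp)).preconnected.exists_adj_boundary
    (S := {v | (v : V) ∈ S}) (x := ⟨x, hxw⟩) (y := ⟨y, hyw⟩) hx hy
  exact ⟨a, ha, b, hb, a.2, b.2, hab⟩

theorem exists_adj_ne (h : TwoConnected G) (u w : V) : ∃ v, v ≠ w ∧ G.Adj u v := by
  classical
  have key : ∀ w, w ≠ u → ∃ v, v ≠ w ∧ G.Adj u v := by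
    intro w hw
    obtain ⟨y, hy⟩ : ∃ y, y ∉ ({u, w} : Finset V) := by
      by_contra! hall
      have h1 := Finset.card_le_card (fun v _ ↦ hall v : (univ : Finset V) ⊆ _)
      have h2 := Finset.card_le_two (a := u) (b := w)
      have h3 := h.1
      rw [card_univ] at h1
      omega
    simp only [Finset.mem_insert, Finset.mem_singleton, not_or] at hy
    obtain ⟨a, rfl, b, -, -, hb, hab⟩ := h.exists_adj_boundary (S := {u}) (x := u) rfl hy.1 hw.symm
      hy.2
    exact ⟨b, hb, hab⟩
  by_cases hw : w = u
  · obtain ⟨w', hw'⟩ := Fintype.exists_ne_of_one_lt_card (by have := h.1; omega) u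
    obtain ⟨v, -, hv⟩ := key w' hw'
    exact ⟨v, by rw [hw]; exact hv.ne', hv⟩
  · exact key w hw

end TwoConnected

namespace SimpleGraph

namespace IsPathSeq

variable {V : Type*} {G : SimpleGraph V} {f : ℕ → V} {k : ℕ}

theorem isCyclicList_of_crossing (h : G.IsPathSeq f k) {i : ℕ} (hi : i + 1 < k)
    (h0 : G.Adj (f 0) (f (i + 1))) (h1 : G.Adj (f (k - 1)) (f i)) :
    ∃ l, G.IsCyclicList l ∧ l.length = k := by
  refine ⟨_, isCyclicList_map h.injOn
    (L := List.Ico 0 (i + 1) ++ (List.Ico (i + 1) k).reverse) ?_ ?_ ?_ ?_, ?_⟩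
  · simp; omega
  · simp [List.nodup_append, List.Ico.nodup]; grind
  · rw [List.isChain_append, List.isChain_reverse, List.head?_reverse, List.Ico.getLast?_eq hi,
      List.Ico.getLast?_eq (by omega)]
    exact ⟨List.Ico.isChain_of_forall fun j _ _ ↦ h.adj j (by omega),
      List.Ico.isChain_of_forall fun j _ _ ↦ (h.adj j (by omega)).symm, by simpa using h1.symm⟩
  · rw [List.getLast?_append, List.head?_append, List.getLast?_reverse, List.Ico.head?_eq hi,
      List.Ico.head?_eq (by omega)]
    simpa using h0.symm
  · simp; omega

theorem isCyclicList_of_skip (h : G.IsPathSeq f k) {i : ℕ} (hi0 : 0 < i) (hi : i + 1 < k)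
    (h0 : G.Adj (f 0) (f (i + 1))) (h1 : G.Adj (f (k - 1)) (f (i - 1))) :
    ∃ l, G.IsCyclicList l ∧ l.length + 1 = k ∧ f i ∉ l := by
  refine ⟨_, isCyclicList_map h.injOn
    (L := List.Ico 0 i ++ (List.Ico (i + 1) k).reverse) ?_ ?_ ?_ ?_, ?_, ?_⟩
  · simp; omega
  · simp [List.nodup_append, List.Ico.nodup]; grind
  · rw [List.isChain_append, List.isChain_reverse, List.head?_reverse, List.Ico.getLast?_eq hi,
      List.Ico.getLast?_eq (by omega)]
    exact ⟨List.Ico.isChain_of_forall fun j _ _ ↦ h.adj j (by omega),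
      List.Ico.isChain_of_forall fun j _ _ ↦ (h.adj j (by omega)).symm, by simpa using h1.symm⟩
  · rw [List.getLast?_append, List.head?_append, List.getLast?_reverse, List.Ico.head?_eq hi,
      List.Ico.head?_eq (by omega)]
    simpa using h0.symm
  · simp; omega
  · simp only [List.mem_map, not_exists, not_and]
    intro j hj hji
    simp at hj
    have := h.injOn (Set.mem_Iio.2 (by omega)) (Set.mem_Iio.2 (by omega)) hji
    omega

theorem isCyclicList_of_chord (h : G.IsPathSeq f k) {a b : ℕ} (hab : a + 1 < b) (hb : b < k)
    (hadj : G.Adj (f a) (f b)) (h0 : G.Adj (f 0) (f (a + 1)))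
    (h1 : G.Adj (f (k - 1)) (f (b - 1))) : ∃ l, G.IsCyclicList l ∧ l.length = k := by
  refine ⟨_, isCyclicList_map h.injOn
    (L := List.Ico 0 (a + 1) ++ (List.Ico b k ++ (List.Ico (a + 1) b).reverse)) ?_ ?_ ?_ ?_, ?_⟩
  · simp; omega
  · simp [List.nodup_append, List.Ico.nodup]; grind
  · rw [List.isChain_append, List.isChain_append, List.isChain_reverse, List.head?_reverse,
      List.head?_append, List.Ico.getLast?_eq hab, List.Ico.getLast?_eq hb, List.Ico.head?_eq hb,
      List.Ico.getLast?_eq (by omega)]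
    exact ⟨List.Ico.isChain_of_forall fun j _ _ ↦ h.adj j (by omega),
      ⟨List.Ico.isChain_of_forall fun j _ _ ↦ h.adj j (by omega),
      List.Ico.isChain_of_forall fun j _ _ ↦ (h.adj j (by omega)).symm, by simpa using h1⟩,
      by simpa using hadj⟩
  · rw [List.getLast?_append, List.getLast?_append, List.head?_append, List.getLast?_reverse,
      List.Ico.head?_eq hab, List.Ico.head?_eq (by omega)]
    simpa using h0.symm
  · simp; omega

/-- If no edges from the two ends of a path cross, and all neighbours of the ends are on the path,
then the degrees of the ends are bounded by the number of steps met by one of these edges. -/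
theorem degree_add_degree_le [Fintype V] (hk : 0 < k)
    (h0 : ∀ v, G.Adj (f 0) v → ∃ i < k, f i = v)
    (h1 : ∀ v, G.Adj (f (k - 1)) v → ∃ i < k, f i = v)
    (hcross : ∀ i, i + 1 < k → G.Adj (f 0) (f (i + 1)) → ¬G.Adj (f (k - 1)) (f i)) :
    G.degree (f 0) + G.degree (f (k - 1)) ≤ ((range (k - 1)).filter fun i ↦
      G.Adj (f 0) (f (i + 1)) ∨ G.Adj (f (k - 1)) (f i)).card := by
  rw [filter_or, card_union_of_disjoint]
  · refine add_le_add ?_ ?_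
    · rw [← card_neighborFinset_eq_degree]
      refine (card_le_card fun v hv ↦ ?_).trans (card_image_le (f := fun i ↦ f (i + 1)))
      rw [mem_neighborFinset] at hv
      obtain ⟨_ | i, hi, rfl⟩ := h0 v hv
      · exact absurd rfl hv.ne
      · exact Finset.mem_image.2 ⟨i, mem_filter.2 ⟨Finset.mem_range.2 (by omega), hv⟩, rfl⟩
    · rw [← card_neighborFinset_eq_degree]
      refine (card_le_card fun v hv ↦ ?_).trans (card_image_le (f := f))
      rw [mem_neighborFinset] at hv
      obtain ⟨i, hi, rfl⟩ := h1 v hv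
      have : i ≠ k - 1 := by rintro rfl; exact hv.ne rfl
      exact Finset.mem_image.2 ⟨i, mem_filter.2 ⟨Finset.mem_range.2 (by omega), hv⟩, rfl⟩
  · rw [Finset.disjoint_filter]
    exact fun i hi ↦ hcross i (by have := Finset.mem_range.1 hi; omega)

theorem cons (h : G.IsPathSeq f k) {v : V} (hadj : G.Adj (f 0) v) (hv : ∀ i < k, f i ≠ v) :
    ∃ g, G.IsPathSeq g (k + 1) := by
  refine ⟨fun j ↦ Nat.casesOn j v f, ?_, ?_⟩
  · rintro (_ | i) hi (_ | j) hj hij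
    · rfl
    · exact absurd hij.symm (hv j (by simpa using hj))
    · exact absurd hij (hv i (by simpa using hi))
    · rw [h.injOn (by simpa using hi) (by simpa using hj) hij]
  · rintro (_ | i) hi
    · exact hadj.symm
    · exact h.adj i (by omega)

theorem reverse (h : G.IsPathSeq f k) : G.IsPathSeq (fun i ↦ f (k - 1 - i)) k := by
  refine ⟨fun i hi j hj hij ↦ ?_, fun i hi ↦ ?_⟩
  · simp only [Set.mem_Iio] at hi hj
    have := h.injOn (Set.mem_Iio.2 (by omega)) (Set.mem_Iio.2 (by omega)) hij
    omega
  · have := (h.adj (k - 1 - (i + 1)) (by omega)).symm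
    rwa [show k - 1 - (i + 1) + 1 = k - 1 - i by omega] at this

variable [Fintype V]

theorem exists_succ (h : G.IsPathSeq f k) (hk : 0 < k) (hkn : k < Fintype.card V)
    (h2c : TwoConnected G)
    (hdeg : ∀ u v : V, u ≠ v → ¬G.Adj u v → Fintype.card V - 1 ≤ G.degree u + G.degree v) :
    ∃ g, G.IsPathSeq g (k + 1) := by
  by_contra hno
  have h0 : ∀ v, G.Adj (f 0) v → ∃ i < k, f i = v := by
    intro v hv
    by_contra! hne
    exact hno (h.cons hv hne)
  have h1 : ∀ v, G.Adj (f (k - 1)) v → ∃ i < k, f i = v := by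
    intro v hv
    by_contra! hne
    exact hno (h.reverse.cons (v := v) (by simpa using hv) fun i _ ↦ hne _ (by omega))
  have hcross : ∀ i, i + 1 < k → G.Adj (f 0) (f (i + 1)) → ¬G.Adj (f (k - 1)) (f i) := by
    intro i hi hi0 hi1
    obtain ⟨l, hl, rfl⟩ := h.isCyclicList_of_crossing hi hi0 hi1
    obtain ⟨c, hc, -⟩ := hl.exists_isPeriodicCycle (List.length_pos_iff.1 hk)
    exact hno (hc.exists_isPathSeq_succ h2c.preconnected hkn)
  have hle := degree_add_degree_le hk h0 h1 hcross
  have hle' := hle.trans (card_filter_le _ _)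
  rw [card_range] at hle'
  obtain ⟨v, -, hv⟩ := h2c.exists_adj_ne (f 0) (f 0)
  obtain ⟨i, hi, rfl⟩ := h0 v hv
  have hi0 : i ≠ 0 := by rintro rfl; exact hv.ne rfl
  have hne : f 0 ≠ f (k - 1) := by
    intro he
    have := h.injOn (Set.mem_Iio.2 (by omega)) (Set.mem_Iio.2 (by omega)) he
    omega
  have hnadj : ¬G.Adj (f 0) (f (k - 1)) := by
    intro ha
    refine hcross (k - 2) (by omega) (by rwa [show k - 2 + 1 = k - 1 by omega]) ?_
    have := (h.adj (k - 2) (by omega)).symm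
    rwa [show k - 2 + 1 = k - 1 by omega] at this
  have := hdeg _ _ hne hnadj
  omega

/-- A Hamiltonian path closes up to a Hamiltonian cycle or to a cycle missing one vertex. -/
theorem exists_isCyclicList (h : G.IsPathSeq f (Fintype.card V)) (h2c : TwoConnected G)
    (hdeg : ∀ u v : V, u ≠ v → ¬G.Adj u v → Fintype.card V - 1 ≤ G.degree u + G.degree v) :
    (∃ l, G.IsCyclicList l ∧ l.length = Fintype.card V) ∨
      ∃ l u, G.IsCyclicList l ∧ l.length + 1 = Fintype.card V ∧ u ∉ l := by
  have h3 := h2c.1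
  set n := Fintype.card V with hn
  by_contra! hno
  obtain ⟨hno1, hno2⟩ := hno
  have hsurj : ∀ v, ∃ i < n, f i = v := by
    intro v
    have himg : (range n).image f = univ := by
      rw [← card_eq_iff_eq_univ, card_image_of_injOn, card_range]
      simpa using h.injOn
    simpa using (Finset.ext_iff.1 himg v).2 (mem_univ v)
  have hcross : ∀ i, i + 1 < n → G.Adj (f 0) (f (i + 1)) → ¬G.Adj (f (n - 1)) (f i) := by
    intro i hi hi0 hi1
    obtain ⟨l, hl, hln⟩ := h.isCyclicList_of_crossing hi hi0 hi1
    exact hno1 l hl hln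
  have hskip : ∀ i, 0 < i → i + 1 < n → G.Adj (f 0) (f (i + 1)) →
      ¬G.Adj (f (n - 1)) (f (i - 1)) := by
    intro i hi0 hi h0 h1
    obtain ⟨l, hl, hln, hil⟩ := h.isCyclicList_of_skip hi0 hi h0 h1
    exact hil (hno2 l _ hl hln)
  have hne : f 0 ≠ f (n - 1) := by
    intro he
    have := h.injOn (Set.mem_Iio.2 (by omega)) (Set.mem_Iio.2 (by omega)) he
    omega
  have hnadj : ¬G.Adj (f 0) (f (n - 1)) := by
    intro ha
    refine hcross (n - 2) (by omega) (by rwa [show n - 2 + 1 = n - 1 by omega]) ?_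
    have := (h.adj (n - 2) (by omega)).symm
    rwa [show n - 2 + 1 = n - 1 by omega] at this
  have hor : ∀ i < n - 1, G.Adj (f 0) (f (i + 1)) ∨ G.Adj (f (n - 1)) (f i) := by
    have hle := degree_add_degree_le (by omega) (fun v _ ↦ hsurj v) (fun v _ ↦ hsurj v) hcross
    have hd := hdeg _ _ hne hnadj
    have heq := eq_of_subset_of_card_le (filter_subset _ _) (by
      rw [card_range]; exact hd.trans hle)
    exact fun i hi ↦ Finset.filter_eq_self.1 heq i (Finset.mem_range.2 hi)
  have hdown : ∀ i, 0 < i → i + 1 < n → G.Adj (f 0) (f (i + 1)) → G.Adj (f 0) (f i) := by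
    intro i hi0 hi ha
    have := (hor (i - 1) (by omega)).resolve_right (hskip i hi0 hi ha)
    rwa [Nat.sub_add_cancel hi0] at this
  obtain ⟨p, hp0, hpn, hpadj, hpmax⟩ : ∃ p, 0 < p ∧ p + 1 < n ∧ G.Adj (f 0) (f p) ∧
      ¬G.Adj (f 0) (f (p + 1)) := by
    by_contra! hall
    have : ∀ i, i + 1 < n → G.Adj (f 0) (f (i + 1)) := by
      intro i
      induction i with
      | zero => exact fun hi ↦ h.adj 0 hi
      | succ i ih => exact fun hi ↦ hall (i + 1) (by omega) hi (ih (by omega))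
    apply hnadj
    have := this (n - 2) (by omega)
    rwa [show n - 2 + 1 = n - 1 by omega] at this
  have hlow : ∀ d < p, G.Adj (f 0) (f (p - d)) := by
    intro d
    induction d with
    | zero => exact fun _ ↦ hpadj
    | succ d ih =>
      intro hd
      refine hdown _ (by omega) (by omega) ?_
      rw [show p - (d + 1) + 1 = p - d by omega]
      exact ih (by omega)
  have hhigh : ∀ d, p + d + 1 < n → ¬G.Adj (f 0) (f (p + d + 1)) := by
    intro d
    induction d with
    | zero => exact fun _ ↦ hpmax
    | succ d ih => exact fun hd ha ↦ ih (by omega) (hdown _ (by omega) hd ha)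
  have hinj : ∀ {i j}, i < n → j < n → f i = f j → i = j := fun hi hj hij ↦
    h.injOn (Set.mem_Iio.2 hi) (Set.mem_Iio.2 hj) hij
  obtain ⟨_, ⟨a, ha, rfl⟩, y, hy, -, hyp, hadj⟩ := h2c.exists_adj_boundary (w := f p) (x := f 0)
    (y := f (p + 1)) (S := {v | ∃ i < p, f i = v}) ⟨0, hp0, rfl⟩
    (by rintro ⟨i, hi, he⟩; have := hinj (by omega) (by omega) he; omega)
    (fun he ↦ by have := hinj (by omega) (by omega) he; omega)
    (fun he ↦ by have := hinj (by omega) (by omega) he; omega)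
  obtain ⟨b, hb, rfl⟩ := hsurj y
  have hbp : p < b := by
    have h1 : ¬b < p := fun hlt ↦ hy ⟨b, hlt, rfl⟩
    have h2 : b ≠ p := by rintro rfl; exact hyp rfl
    omega
  obtain ⟨l, hl, hln⟩ := h.isCyclicList_of_chord (a := a) (b := b) (by omega) hb hadj
    (by
      have := hlow (p - (a + 1)) (by omega)
      rwa [show p - (p - (a + 1)) = a + 1 by omega] at this)
    (by
      refine (hor (b - 1) (by omega)).resolve_left ?_
      have := hhigh (b - p - 1) (by omega)
      rwa [show p + (b - p - 1) + 1 = b - 1 + 1 by omega] at this)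
  exact hno1 l hl hln

end IsPathSeq

end SimpleGraph

/-- A 2-connected graph with `n ≥ 3` vertices in which `d(u) + d(v) ≥ n - 1` for every pair
of nonadjacent vertices is Hamiltonian, unless `n` is odd and `G ∈ ψ_n`. -/
theorem stmt_2 {V : Type*} [Fintype V] [DecidableEq V] (G : SimpleGraph V)
    (hn : 3 ≤ Fintype.card V) (h2c : TwoConnected G)
    (hdeg : ∀ u v : V, u ≠ v → ¬G.Adj u v →
      Fintype.card V - 1 ≤ G.degree u + G.degree v) :
    G.IsHamiltonian ∨ ∃ m : ℕ, Fintype.card V = 2 * m + 1 ∧ InPsi G m := by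
  by_cases hham : G.IsHamiltonian
  · exact Or.inl hham
  right
  obtain ⟨f, hf⟩ : ∃ f, G.IsPathSeq f (Fintype.card V) := by
    obtain ⟨v⟩ : Nonempty V := Fintype.card_pos_iff.1 (by omega)
    have key : ∀ k, 1 ≤ k → k ≤ Fintype.card V → ∃ f, G.IsPathSeq f k := by
      intro k hk
      induction k, hk using Nat.le_induction with
      | base =>
        refine fun _ ↦ ⟨fun _ ↦ v, fun i hi j hj _ ↦ ?_, fun i hi ↦ by omega⟩
        simp only [Set.mem_Iio] at hi hj
        omega
      | succ k hk ih =>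
        intro hkn
        obtain ⟨f, hf⟩ := ih (by omega)
        exact hf.exists_succ hk hkn h2c hdeg
    exact key _ (by omega) le_rfl
  rcases hf.exists_isCyclicList h2c hdeg with ⟨l, hl, hln⟩ | ⟨l, u, hl, hln, hul⟩
  · exact absurd (hl.isHamiltonian hln hn) hham
  · obtain ⟨c, hc, hcl⟩ := hl.exists_isPeriodicCycle (by rintro rfl; simp at hln; omega)
    exact ⟨G.degree u, hc.inPsi hln hn hham (fun i hi ↦ hul (hi ▸ hcl i)) hdeg
      (h2c.exists_adj_ne u)⟩
end

section
/- Let G be an OTG with n vertices, let u and v be nonadjacent vertices of G with d(u) + d(v) ≥ n + 1, and let X ⊆ V(G) be a nonempty vertex subset. Then X is an H-force set of G if and only if X is an H-force set of the graph G + uv obtained from G by adding the edge uv. -/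
open Finset SimpleGraph
open scoped Classical

/-- `X` is a Hamiltonian cycle enforcing set (H-force set) of `G`: `X` is nonempty and
every cycle of `G` containing all vertices of `X` is a Hamiltonian cycle. -/
def IsHForceSet {V : Type*} [Fintype V] [DecidableEq V] (G : SimpleGraph V)
    (X : Finset V) : Prop :=
  X.Nonempty ∧ ∀ (v : V) (c : G.Walk v v), c.IsCycle → (∀ x ∈ X, x ∈ c.support) →
    c.IsHamiltonianCycle

/-- The H-force number of `G`: the smallest cardinality of an H-force set of `G`. -/
noncomputable def hForce {V : Type*} [Fintype V] [DecidableEq V] (G : SimpleGraph V) : ℕ :=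
  sInf {k | ∃ X : Finset V, IsHForceSet G X ∧ X.card = k}

/-- `G` satisfies the condition of Ore's theorem: `d(u) + d(v) ≥ n` for every pair of
nonadjacent vertices `u, v`. -/
def IsOTG {V : Type*} [Fintype V] (G : SimpleGraph V) : Prop :=
  ∀ u v : V, u ≠ v → ¬G.Adj u v → Fintype.card V ≤ G.degree u + G.degree v

namespace SimpleGraph.Walk

variable {V : Type*} {G : SimpleGraph V} {u v : V}

/-- A cycle is Hamiltonian if and only if it visits every vertex. -/
lemma IsCycle.isHamiltonianCycle_iff [DecidableEq V] {a : V} {c : G.Walk a a} (hc : c.IsCycle) :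
    c.IsHamiltonianCycle ↔ ∀ x, x ∈ c.support := by
  refine ⟨fun h => h.mem_support, fun h => ⟨hc, hc.isPath_tail.isHamiltonian_of_mem fun x => ?_⟩⟩
  rw [support_tail_of_not_nil _ hc.not_nil]
  obtain rfl | hx := eq_or_ne x a
  · exact end_mem_tail_support hc.not_nil
  · have := h x
    rw [← cons_tail_support, List.mem_cons] at this
    exact this.resolve_left hx

/-- An edge of a cycle can be cut out, leaving a path between its ends on the same vertices. -/
lemma IsCycle.exists_isPath_of_mem_edges [DecidableEq V] {a : V} {c : G.Walk a a}
    (hc : c.IsCycle) (he : s(u, v) ∈ c.edges) :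
    ∃ q : G.Walk v u, q.IsPath ∧ s(u, v) ∉ q.edges ∧ ∀ x, x ∈ q.support ↔ x ∈ c.support := by
  have hu : u ∈ c.support := c.fst_mem_support_of_mem_edges he
  have hc' : (c.rotate u hu).IsCycle := hc.rotate hu
  have he' : s(u, v) ∈ (c.rotate u hu).edges := (c.rotate_edges u hu).mem_iff.mpr he
  simp only [← c.mem_support_rotate_iff u hu]
  generalize c.rotate u hu = d at hc' he'
  have key : ∀ d : G.Walk u u, d.IsCycle → v = d.snd →
      ∃ q : G.Walk v u, q.IsPath ∧ s(u, v) ∉ q.edges ∧ ∀ x, x ∈ q.support ↔ x ∈ d.support := by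
    rintro (_ | ⟨h, q⟩) hd hv
    · simp at hd
    · obtain rfl : v = _ := by simpa using hv
      rw [cons_isCycle_iff] at hd
      refine ⟨q, hd.1, hd.2, fun x => ?_⟩
      simp only [support_cons, List.mem_cons, iff_or_self]
      rintro rfl
      exact q.end_mem_support
  by_cases hv : v = d.snd
  · exact key d hc' hv
  · have hv' : v = d.reverse.snd := by
      cases d with
      | nil => simp at hc'
      | cons h q =>
        have hq := ((cons_isCycle_iff _ _).mp hc').1
        have hmem : s(u, v) ∈ q.edges := by
          simp only [edges_cons, List.mem_cons, Sym2.congr_right] at he'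
          simp only [snd_cons] at hv
          exact he'.resolve_left hv
        have := hq.eq_penultimate_of_mem_edges hmem
        rw [snd_reverse, penultimate_cons_of_not_nil]
        · exact this
        · exact not_nil_of_isCycle_cons hc'
    simpa using key d.reverse hc'.reverse hv'

/-- Ore's rotation: two crossing chords at the ends of a path close it up to a cycle. -/
lemma IsPath.exists_isCycle_of_crossing {p : G.Walk u v} (hp : p.IsPath) (hadj : ¬G.Adj u v)
    {i : ℕ} (hi : i < p.length) (hu : G.Adj u (p.getVert (i + 1)))
    (hv : G.Adj v (p.getVert i)) :
    ∃ (w : V) (c : G.Walk w w), c.IsCycle ∧ ∀ x, x ∈ c.support ↔ x ∈ p.support := by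
  set r := (p.take i).append (cons hv.symm (p.drop (i + 1)).reverse) with hr
  have hsupp : r.support.Perm p.support := by
    have : r.support = p.support.take (i + 1) ++ (p.support.drop (i + 1)).reverse := by
      simp only [hr, support_append, support_take, support_cons, List.tail_cons, support_reverse,
        drop_support_eq_support_drop_min]
      rw [min_eq_left (by lia)]
    rw [this]
    refine ((List.reverse_perm _).append_left _).trans ?_
    rw [List.take_append_drop]
  have hrp : r.IsPath := .mk' (hsupp.nodup_iff.mpr hp.support_nodup)
  have hlen : r.length = p.length := by
    have := hsupp.length_eq
    simpa using this
  refine ⟨_, cons hu.symm r, (cons_isCycle_iff _ _).mpr ⟨hrp, fun he => ?_⟩, fun x => ?_⟩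
  · have h1 := hrp.length_eq_one_of_mem_edges (Sym2.eq_swap ▸ he)
    exact hadj (adj_of_length_eq_one (hlen ▸ h1))
  · rw [support_cons, List.mem_cons, ← hsupp.mem_iff, or_iff_right_iff_imp]
    rintro rfl
    exact r.end_mem_support

/-- If no crossing chords exist, the ends of a path have few neighbours on the path. -/
lemma card_neighborFinset_inter_support_add_le [Fintype V] [DecidableEq V] (p : G.Walk u v)
    [Fintype (G.neighborSet u)] [Fintype (G.neighborSet v)]
    (h : ∀ i < p.length, G.Adj u (p.getVert (i + 1)) → ¬G.Adj v (p.getVert i)) :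
    (G.neighborFinset u ∩ p.support.toFinset).card +
      (G.neighborFinset v ∩ p.support.toFinset).card ≤ p.length := by
  set A := {i ∈ range p.length | G.Adj u (p.getVert (i + 1))} with hA
  set B := {i ∈ range p.length | G.Adj v (p.getVert i)} with hB
  have hAc : (G.neighborFinset u ∩ p.support.toFinset).card ≤ A.card := by
    refine (card_le_card ?_).trans (card_image_le (f := fun i => p.getVert (i + 1)))
    intro x hx
    simp only [mem_inter, mem_neighborFinset, List.mem_toFinset,
      mem_support_iff_exists_getVert] at hx
    obtain ⟨hux, k, rfl, hk⟩ := hx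
    obtain _ | k := k
    · simp at hux
    · simp only [mem_image, hA, mem_filter, mem_range]
      exact ⟨k, ⟨by lia, hux⟩, rfl⟩
  have hBc : (G.neighborFinset v ∩ p.support.toFinset).card ≤ B.card := by
    refine (card_le_card ?_).trans (card_image_le (f := p.getVert))
    intro x hx
    simp only [mem_inter, mem_neighborFinset, List.mem_toFinset,
      mem_support_iff_exists_getVert] at hx
    obtain ⟨hvx, k, rfl, hk⟩ := hx
    obtain rfl | hk := hk.eq_or_lt
    · simp at hvx
    · simp only [mem_image, hB, mem_filter, mem_range]
      exact ⟨k, ⟨hk, hvx⟩, rfl⟩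
  have hdisj : Disjoint A B := by
    rw [Finset.disjoint_left]
    intro i hiA hiB
    simp only [hA, hB, mem_filter, mem_range] at hiA hiB
    exact h i hiA.1 hiA.2 hiB.2
  calc _ ≤ A.card + B.card := add_le_add hAc hBc
    _ = (A ∪ B).card := (card_union_of_disjoint hdisj).symm
    _ ≤ (range p.length).card :=
      card_le_card (union_subset (filter_subset _ _) (filter_subset _ _))
    _ = p.length := card_range _

/-- A non-spanning path whose nonadjacent ends have degree sum greater than the order of the graph
lies on the vertices of some non-spanning cycle. -/
lemma IsPath.exists_isCycle_support_subset [Fintype V] {p : G.Walk u v}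
    [Fintype (G.neighborSet u)] [Fintype (G.neighborSet v)] (hp : p.IsPath)
    (huv : u ≠ v) (hadj : ¬G.Adj u v) (hdeg : Fintype.card V + 1 ≤ G.degree u + G.degree v)
    {y : V} (hy : y ∉ p.support) :
    ∃ (w : V) (c : G.Walk w w), c.IsCycle ∧ p.support ⊆ c.support ∧ ∃ z, z ∉ c.support := by
  by_cases h : ∀ i < p.length, G.Adj u (p.getVert (i + 1)) → ¬G.Adj v (p.getVert i)
  · have hS := p.card_neighborFinset_inter_support_add_le h
    set S := p.support.toFinset with hSdef
    have hScard : S.card = p.length + 1 := by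
      rw [hSdef, List.toFinset_card_of_nodup hp.support_nodup, length_support]
    have hcompl : Sᶜ.card + S.card = Fintype.card V := by
      rw [card_compl]; exact Nat.sub_add_cancel (card_le_univ S)
    have hu := card_inter_add_card_sdiff (G.neighborFinset u) S
    have hv := card_inter_add_card_sdiff (G.neighborFinset v) S
    have hunion := card_union_add_card_inter (G.neighborFinset u \ S) (G.neighborFinset v \ S)
    have hle : (G.neighborFinset u \ S ∪ G.neighborFinset v \ S).card ≤ Sᶜ.card :=
      card_le_card fun x hx => by simp only [mem_union, mem_sdiff] at hx; simp; tauto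
    rw [card_neighborFinset_eq_degree] at hu hv
    have htwo : 1 < ((G.neighborFinset u \ S) ∩ (G.neighborFinset v \ S)).card := by lia
    obtain ⟨w, hw, z, hz, hwz⟩ := one_lt_card.mp htwo
    simp only [mem_inter, mem_sdiff, mem_neighborFinset, hSdef, List.mem_toFinset] at hw hz
    have hq : (p.concat hw.2.1).IsPath := hp.concat hw.1.2 _
    refine ⟨w, cons hw.1.1.symm (p.concat hw.2.1),
      (cons_isCycle_iff _ _).mpr ⟨hq, fun he => ?_⟩, fun x hx => ?_, z, ?_⟩
    · have h1 := hq.length_eq_one_of_mem_edges (Sym2.eq_swap ▸ he)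
      rw [length_concat] at h1
      exact huv (eq_of_length_eq_zero (p := p) (by lia))
    · simp [support_concat, hx]
    · simp [support_concat, hz.1.2, hwz.symm]
  · push Not at h
    obtain ⟨i, hi, hui, hvi⟩ := h
    obtain ⟨w, c, hc, hs⟩ := hp.exists_isCycle_of_crossing hadj hi hui hvi
    exact ⟨w, c, hc, fun x hx => (hs x).mpr hx, y, fun hyc => hy ((hs y).mp hyc)⟩

end SimpleGraph.Walk

/-- If `u, v` are nonadjacent vertices of an OTG `G` with `d(u) + d(v) ≥ n + 1`, then a nonempty
set `X` is an H-force set of `G` iff it is an H-force set of `G + uv`. -/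
theorem stmt_3 {V : Type*} [Fintype V] [DecidableEq V] (G : SimpleGraph V)
    (hOTG : IsOTG G) (u v : V) (huv : u ≠ v) (hadj : ¬G.Adj u v)
    (hdeg : Fintype.card V + 1 ≤ G.degree u + G.degree v)
    (X : Finset V) (hX : X.Nonempty) :
    IsHForceSet G X ↔ IsHForceSet (G ⊔ SimpleGraph.edge u v) X := by
  refine ⟨fun ⟨_, hF⟩ => ⟨hX, fun a c hc hXc => ?_⟩, fun ⟨_, hF⟩ => ⟨hX, fun a c hc hXc => ?_⟩⟩
  · rw [hc.isHamiltonianCycle_iff]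
    intro y
    by_contra hy
    have hG : ∀ e ∈ (G ⊔ SimpleGraph.edge u v).edgeSet, e ≠ s(u, v) → e ∈ G.edgeSet := by
      intro e
      induction e with
      | _ x y =>
        simp only [mem_edgeSet, sup_adj, edge_adj, ne_eq, Sym2.eq_iff]
        tauto
    by_cases he : s(u, v) ∈ c.edges
    · obtain ⟨q, hq, hqe, hqs⟩ := hc.exists_isPath_of_mem_edges he
      have hqG : ∀ e ∈ q.edges, e ∈ G.edgeSet := fun e hmem =>
        hG e (q.edges_subset_edgeSet hmem) (by rintro rfl; exact hqe hmem)
      obtain ⟨w, d, hd, hsub, z, hz⟩ := (hq.transfer hqG).exists_isCycle_support_subset huv.symm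
        (fun h => hadj h.symm) (by lia) (y := y) (by rwa [Walk.support_transfer, hqs])
      rw [Walk.support_transfer] at hsub
      exact hz ((hF w d hd fun x hx => hsub ((hqs x).mpr (hXc x hx))).mem_support z)
    · have hcG : ∀ e ∈ c.edges, e ∈ G.edgeSet := fun e hmem =>
        hG e (c.edges_subset_edgeSet hmem) (by rintro rfl; exact he hmem)
      have := (hF a (c.transfer G hcG) (hc.transfer hcG)
        (by simpa only [Walk.support_transfer] using hXc)).mem_support y
      rw [Walk.support_transfer] at this
      exact hy this
  · have hle : G ≤ G ⊔ SimpleGraph.edge u v := le_sup_left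
    have h := hF a (c.mapLe hle) (hc.mapLe hle)
      (by simpa only [Walk.support_mapLe_eq_support] using hXc)
    rw [hc.isHamiltonianCycle_iff]
    intro x
    simpa only [Walk.support_mapLe_eq_support] using h.mem_support x
end

section
/- Let G be an OTG with n vertices and let C_w(G) be its weak closure. Then a nonempty set X ⊆ V(G) is an H-force set of G if and only if X is an H-force set of C_w(G); in particular h(G) = h(C_w(G)). -/
open Finset SimpleGraph
open scoped Classical

/-- One step of the weak-closure process: `H` is obtained from `G` by joining one pair of
nonadjacent vertices whose degree sum is at least `n + 1`. -/
def WeakStep {V : Type*} [Fintype V] (G H : SimpleGraph V) : Prop :=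
  ∃ u v : V, u ≠ v ∧ ¬G.Adj u v ∧ Fintype.card V + 1 ≤ G.degree u + G.degree v ∧
    H = G ⊔ SimpleGraph.edge u v

/-- `H` is a weak closure of `G`: it is obtained from `G` by a finite sequence of weak-closure
steps, and no pair of nonadjacent vertices of `H` has degree sum at least `n + 1`. -/
def IsWeakClosure {V : Type*} [Fintype V] (G H : SimpleGraph V) : Prop :=
  Relation.ReflTransGen WeakStep G H ∧
    ∀ u v : V, u ≠ v → ¬H.Adj u v → H.degree u + H.degree v < Fintype.card V + 1

/-- A cycle is Hamiltonian iff it visits every vertex. -/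
theorem isHamiltonianCycle_iff_forall_mem_support {V : Type*} [DecidableEq V] {G : SimpleGraph V}
    {v : V} {c : G.Walk v v} (hc : c.IsCycle) :
    c.IsHamiltonianCycle ↔ ∀ w, w ∈ c.support := by
  refine ⟨fun h w => h.mem_support w, fun h => ?_⟩
  rw [Walk.isHamiltonianCycle_isCycle_and_isHamiltonian_tail]
  refine ⟨hc, hc.isPath_tail.isHamiltonian_of_mem fun w => ?_⟩
  rw [Walk.support_tail_of_not_nil c hc.not_nil]
  rcases (Walk.mem_support_iff c).1 (h w) with rfl | hw
  · exact Walk.end_mem_tail_support hc.not_nil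
  · exact hw

/-- H-force sets phrased through supports: every cycle through `X` visits every vertex. -/
theorem isHForceSet_iff_forall_mem_support {V : Type*} [Fintype V] [DecidableEq V]
    {G : SimpleGraph V} {X : Finset V} :
    IsHForceSet G X ↔ X.Nonempty ∧ ∀ (v : V) (c : G.Walk v v), c.IsCycle →
      (∀ x ∈ X, x ∈ c.support) → ∀ w, w ∈ c.support := by
  refine and_congr_right fun _ => forall₂_congr fun v c => forall_congr' fun hc => ?_
  rw [isHamiltonianCycle_iff_forall_mem_support hc]

/-- H-force sets are inherited by spanning subgraphs. -/
theorem IsHForceSet.anti {V : Type*} [Fintype V] [DecidableEq V] {G H : SimpleGraph V}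
    (hGH : G ≤ H) {X : Finset V} (hX : IsHForceSet H X) : IsHForceSet G X := by
  rw [isHForceSet_iff_forall_mem_support] at hX ⊢
  refine ⟨hX.1, fun v c hc hXc w => ?_⟩
  have := hX.2 v (c.mapLe hGH) (hc.mapLe hGH) (by simpa using hXc) w
  simpa using this

/-- A path of length at least two whose ends are adjacent closes up to a cycle. -/
theorem isCycle_cons_of_isPath {V : Type*} {G : SimpleGraph V} {a b : V} {q : G.Walk b a}
    (h : G.Adj a b) (hq : q.IsPath) (hl : 2 ≤ q.length) : (Walk.cons h q).IsCycle := by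
  refine (Walk.cons_isCycle_iff q h).2 ⟨hq, fun he => ?_⟩
  have := hq.length_eq_one_of_mem_edges (by rwa [Sym2.eq_swap])
  omega

/-- Rerouting a path along a crossing pair of chords `a ~ pᵢ₊₁`, `b ~ pᵢ` gives a cycle on the
same vertices. -/
theorem exists_isCycle_of_crossing {V : Type*} {G : SimpleGraph V} {a b : V} {p : G.Walk a b}
    (hp : p.IsPath) (hl : 2 ≤ p.length) {i : ℕ} (hi : i < p.length)
    (ha : G.Adj a (p.getVert (i + 1))) (hb : G.Adj b (p.getVert i)) :
    ∃ c : G.Walk a a, c.IsCycle ∧ ∀ w, w ∈ c.support ↔ w ∈ p.support := by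
  set q := (p.drop (i + 1)).append (Walk.cons hb (p.take i).reverse) with hq
  have hperm : q.support.Perm p.support := by
    have h1 : q.support = p.support.drop (i + 1) ++ (p.support.take (i + 1)).reverse := by
      simp [hq, Walk.support_append, Walk.drop_support_eq_support_drop_min, Walk.support_take,
        Nat.min_eq_left (Nat.succ_le_of_lt hi)]
    rw [h1]
    refine (List.Perm.append_left _ (List.reverse_perm _)).trans ?_
    refine List.perm_append_comm.trans ?_
    rw [List.take_append_drop]
  have hlen : q.length = p.length := by
    have := hperm.length_eq
    simpa using this
  refine ⟨Walk.cons ha q, ?_, fun w => ?_⟩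
  · refine isCycle_cons_of_isPath ha ?_ (by omega)
    rw [Walk.isPath_def]
    exact hperm.nodup_iff.2 hp.support_nodup
  · have : a ∈ p.support := p.start_mem_support
    rw [Walk.support_cons, List.mem_cons, hperm.mem_iff]
    exact ⟨by rintro (rfl | h) <;> assumption, Or.inr⟩

/-- Closing a path through a common neighbour of its ends that lies off the path. -/
theorem exists_isCycle_of_common_neighbor {V : Type*} {G : SimpleGraph V} {a b w : V}
    {p : G.Walk a b} (hp : p.IsPath) (hab : a ≠ b) (hw : w ∉ p.support) (ha : G.Adj a w)
    (hb : G.Adj b w) :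
    ∃ c : G.Walk w w, c.IsCycle ∧ ∀ x, x ∈ c.support ↔ x = w ∨ x ∈ p.support := by
  refine ⟨Walk.cons ha.symm (p.concat hb), ?_, fun x => ?_⟩
  · have : p.length ≠ 0 := fun h => hab (Walk.eq_of_length_eq_zero h)
    exact isCycle_cons_of_isPath ha.symm (hp.concat hw hb) (by rw [Walk.length_concat]; omega)
  · simp [Walk.support_concat]
    tauto

/-- If the ends of a path have degree sum exceeding the order of the graph, either the path has a
crossing pair of chords or its ends have two common neighbours off the path. -/
theorem exists_crossing_or_common_neighbors {V : Type*} [Fintype V] {G : SimpleGraph V} {a b : V}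
    {p : G.Walk a b} (hp : p.IsPath)
    (hdeg : Fintype.card V + 1 ≤ G.degree a + G.degree b) :
    (∃ i < p.length, G.Adj a (p.getVert (i + 1)) ∧ G.Adj b (p.getVert i)) ∨
      1 < #{w | w ∉ p.support ∧ G.Adj a w ∧ G.Adj b w} := by
  by_contra! hcon
  obtain ⟨hno, hcard⟩ := hcon
  set S := p.support.toFinset with hS
  have hScard : #S = p.length + 1 := by
    rw [hS, List.toFinset_card_of_nodup hp.support_nodup, Walk.length_support]
  let I := {i ∈ range p.length | G.Adj a (p.getVert (i + 1))}
  let J := {i ∈ range p.length | G.Adj b (p.getVert i)}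
  have hIJ : #I + #J ≤ p.length := by
    rw [← card_union_of_disjoint, ← card_range p.length]
    · exact card_le_card (union_subset (filter_subset _ _) (filter_subset _ _))
    · rw [Finset.disjoint_left]
      intro i hi hj
      simp only [I, J, mem_filter, mem_range] at hi hj
      exact hno i hi.1 hi.2 hj.2
  have hA : #(G.neighborFinset a ∩ S) ≤ #I := by
    refine (card_le_card (t := I.image fun i => p.getVert (i + 1)) fun x hx => ?_).trans
      card_image_le
    simp only [hS, mem_inter, mem_neighborFinset, List.mem_toFinset,
      Walk.mem_support_iff_exists_getVert] at hx
    obtain ⟨hax, i, rfl, hi⟩ := hx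
    rcases i with _ | i
    · simp at hax
    · exact mem_image.2 ⟨i, by simp [I, hax]; omega, rfl⟩
  have hB : #(G.neighborFinset b ∩ S) ≤ #J := by
    refine (card_le_card (t := J.image p.getVert) fun x hx => ?_).trans card_image_le
    simp only [hS, mem_inter, mem_neighborFinset, List.mem_toFinset,
      Walk.mem_support_iff_exists_getVert] at hx
    obtain ⟨hbx, i, rfl, hi⟩ := hx
    rcases hi.lt_or_eq with hi | rfl
    · exact mem_image.2 ⟨i, by simp [J, hbx, hi], rfl⟩
    · simp at hbx
  have hdisj : (G.neighborFinset a \ S) ∩ (G.neighborFinset b \ S) =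
      ({w | w ∉ p.support ∧ G.Adj a w ∧ G.Adj b w} : Finset V) := by
    ext w
    simp [hS]
    tauto
  have hunion : #((G.neighborFinset a \ S) ∪ (G.neighborFinset b \ S)) ≤ #Sᶜ := by
    refine card_le_card fun x hx => ?_
    simp only [mem_union, mem_sdiff] at hx
    rw [mem_compl]
    tauto
  have h1 := card_union_add_card_inter (G.neighborFinset a \ S) (G.neighborFinset b \ S)
  have h2 := card_inter_add_card_sdiff (G.neighborFinset a) S
  have h3 := card_inter_add_card_sdiff (G.neighborFinset b) S
  have h4 := card_add_card_compl S
  rw [hdisj] at h1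
  rw [card_neighborFinset_eq_degree] at h2 h3
  omega

/-- A cycle through the edge `uv` contains a spanning path between `u` and `v` avoiding it. -/
theorem exists_isPath_of_mem_edges_isCycle {V : Type*} {G : SimpleGraph V} {w u v : V}
    {c : G.Walk w w} (hc : c.IsCycle) (he : s(u, v) ∈ c.edges) :
    ∃ p : G.Walk v u, p.IsPath ∧ 2 ≤ p.length ∧ s(u, v) ∉ p.edges ∧
      ∀ x, x ∈ p.support ↔ x ∈ c.support := by
  have key : ∀ d : G.Walk u u, d.IsCycle → d.snd = v →
      ∃ p : G.Walk v u, p.IsPath ∧ 2 ≤ p.length ∧ s(u, v) ∉ p.edges ∧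
        ∀ x, x ∈ p.support ↔ x ∈ d.support := by
    rintro d hd rfl
    have hd' := hd
    rw [← Walk.cons_tail_eq d hd.not_nil, Walk.cons_isCycle_iff] at hd'
    refine ⟨d.tail, hd'.1, ?_, hd'.2, fun x => ?_⟩
    · have := hd.three_le_length
      have := Walk.length_tail_add_one hd.not_nil
      omega
    · rw [← Walk.cons_support_tail hd.not_nil, List.mem_cons]
      exact ⟨Or.inr, by rintro (rfl | h); exacts [Walk.end_mem_support _, h]⟩
  have hu : u ∈ c.support := Walk.fst_mem_support_of_mem_edges c he
  have hrot := hc.rotate hu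
  have hmem : v ∈ (c.rotate u hu).toSubgraph.neighborSet u := by
    rw [Subgraph.mem_neighborSet, ← Subgraph.mem_edgeSet, Walk.mem_edges_toSubgraph]
    exact (Walk.rotate_edges c u hu).mem_iff.2 he
  rw [hrot.neighborSet_toSubgraph_endpoint] at hmem
  rcases hmem with h | h
  · obtain ⟨p, h1, h2, h3, h4⟩ := key _ hrot h.symm
    exact ⟨p, h1, h2, h3, fun x => by rw [h4, Walk.mem_support_rotate_iff]⟩
  · obtain ⟨p, h1, h2, h3, h4⟩ := key _ hrot.reverse (by rw [Walk.snd_reverse]; exact h.symm)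
    exact ⟨p, h1, h2, h3, fun x => by
      rw [h4, Walk.support_reverse, List.mem_reverse, Walk.mem_support_rotate_iff]⟩

/-- Joining two vertices of degree sum at least `n + 1` preserves H-force sets. -/
theorem IsHForceSet.sup_edge {V : Type*} [Fintype V] [DecidableEq V] {G : SimpleGraph V}
    {u v : V} (huv : u ≠ v) (hdeg : Fintype.card V + 1 ≤ G.degree u + G.degree v)
    {X : Finset V} (hX : IsHForceSet G X) : IsHForceSet (G ⊔ SimpleGraph.edge u v) X := by
  rw [isHForceSet_iff_forall_mem_support] at hX ⊢
  refine ⟨hX.1, fun w c hc hXc => ?_⟩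
  have hedge : ∀ e ∈ (G ⊔ SimpleGraph.edge u v).edgeSet, e ≠ s(u, v) → e ∈ G.edgeSet := by
    intro e he hne
    rw [edgeSet_sup, edgeSet_edge_of_ne huv] at he
    exact he.resolve_right hne
  by_cases he : s(u, v) ∈ c.edges
  · obtain ⟨q, hq, hql, hqe, hqs⟩ := exists_isPath_of_mem_edges_isCycle hc he
    have hqG : ∀ e ∈ q.edges, e ∈ G.edgeSet := fun e h =>
      hedge e (q.edges_subset_edgeSet h) (by rintro rfl; exact hqe h)
    let p := q.transfer G hqG
    have hp : p.IsPath := hq.transfer hqG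
    have hps : ∀ x, x ∈ p.support ↔ x ∈ c.support := fun x => by
      rw [Walk.support_transfer, hqs]
    have hpl : 2 ≤ p.length := by rwa [Walk.length_transfer]
    rcases exists_crossing_or_common_neighbors hp (by omega) with ⟨i, hi, ha, hb⟩ | hcard
    · obtain ⟨d, hd, hds⟩ := exists_isCycle_of_crossing hp hpl hi ha hb
      intro x
      rw [← hps, ← hds]
      exact hX.2 _ d hd (fun y hy => by rw [hds, hps]; exact hXc y hy) x
    · obtain ⟨y, hy, z, hz, hyz⟩ := one_lt_card.1 hcard
      simp only [mem_filter, mem_univ, true_and] at hy hz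
      obtain ⟨d, hd, hds⟩ := exists_isCycle_of_common_neighbor hp huv.symm hy.1 hy.2.1 hy.2.2
      have := hX.2 _ d hd (fun x hx => by rw [hds, hps]; exact Or.inr (hXc x hx)) z
      rw [hds] at this
      exact absurd this (by rintro (rfl | h); exacts [hyz rfl, hz.1 h])
  · have hcG : ∀ e ∈ c.edges, e ∈ G.edgeSet := fun e h =>
      hedge e (c.edges_subset_edgeSet h) (by rintro rfl; exact he h)
    simpa using hX.2 w (c.transfer G hcG) (hc.transfer hcG) (by simpa using hXc)

/-- One weak-closure step does not change the H-force sets. -/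
theorem WeakStep.isHForceSet_iff {V : Type*} [Fintype V] [DecidableEq V] {G H : SimpleGraph V}
    (h : WeakStep G H) (X : Finset V) : IsHForceSet G X ↔ IsHForceSet H X := by
  obtain ⟨u, v, huv, -, hdeg, rfl⟩ := h
  exact ⟨fun hX => hX.sup_edge huv hdeg, fun hX => hX.anti le_sup_left⟩

/-- A nonempty set `X` is an H-force set of an OTG `G` iff it is an H-force set of the weak
closure `C_w(G)`; in particular `h(G) = h(C_w(G))`. -/
theorem stmt_6 {V : Type*} [Fintype V] [DecidableEq V] (G Gw : SimpleGraph V)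
    (hOTG : IsOTG G) (hw : IsWeakClosure G Gw) :
    (∀ X : Finset V, X.Nonempty → (IsHForceSet G X ↔ IsHForceSet Gw X)) ∧
    hForce G = hForce Gw := by
  have key : ∀ X : Finset V, IsHForceSet G X ↔ IsHForceSet Gw X := by
    intro X
    have hsteps := hw.1
    clear hw
    induction hsteps with
    | refl => rfl
    | tail _ hstep ih => exact ih.trans (hstep.isHForceSet_iff X)
  exact ⟨fun X _ => key X, by simp only [hForce, key]⟩
end

section
/- Let G be an OTG with n ≥ 5 vertices. Then the H-force number h(G) equals n − 2, or n/2, or n. -/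
open Finset SimpleGraph
open scoped Classical

namespace HForce

variable {V : Type*}

/-- `l` lists the vertices of a walk of `G` from `a` to `b`. -/
structure IsSeg (G : SimpleGraph V) (a : V) (l : List V) (b : V) : Prop where
  chain : l.IsChain G.Adj
  head : l.head? = some a
  last : l.getLast? = some b

/-- `l` lists the vertices of a closed walk of `G`. -/
def IsClosedList (G : SimpleGraph V) (l : List V) : Prop :=
  ∃ a b, IsSeg G a l b ∧ G.Adj b a

/-- `l` lists every element of `S` exactly once. -/
def Covers [DecidableEq V] (S : Finset V) (l : List V) : Prop :=
  ∀ x, l.count x = if x ∈ S then 1 else 0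

/-- The number of neighbours of `x` in `S`. -/
noncomputable def degIn (G : SimpleGraph V) (S : Finset V) (x : V) : ℕ :=
  (S.filter (G.Adj x)).card

section Lists

variable {G : SimpleGraph V} {a b c d x y : V} {l l' L R : List V}

lemma IsSeg.single (a : V) : IsSeg G a [a] a := ⟨by simp, by simp, by simp⟩

lemma IsSeg.append (h : IsSeg G a l b) (hbc : G.Adj b c) (h' : IsSeg G c l' d) :
    IsSeg G a (l ++ l') d := by
  obtain ⟨h1, h2, h3⟩ := h
  obtain ⟨h1', h2', h3'⟩ := h'
  refine ⟨?_, ?_, ?_⟩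
  · rw [List.isChain_append]
    refine ⟨h1, h1', ?_⟩
    simp [h3, h2', hbc]
  · simp [List.head?_append, h2]
  · simp [List.getLast?_append, h3']

lemma IsSeg.cons (hab : G.Adj a b) (h : IsSeg G b l c) : IsSeg G a (a :: l) c :=
  (IsSeg.single a).append hab h

lemma IsSeg.reverse (h : IsSeg G a l b) : IsSeg G b l.reverse a := by
  obtain ⟨h1, h2, h3⟩ := h
  refine ⟨?_, ?_, ?_⟩
  · rw [List.isChain_reverse]
    exact h1.imp fun _ _ h => h.symm
  · simp [h3]
  · simp [h2]

lemma IsSeg.split (h : IsSeg G a (L ++ x :: y :: R) b) :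
    IsSeg G a (L ++ [x]) x ∧ G.Adj x y ∧ IsSeg G y (y :: R) b := by
  obtain ⟨h1, h2, h3⟩ := h
  rw [List.isChain_append_cons_cons] at h1
  refine ⟨⟨h1.1, ?_, by simp⟩, h1.2.1, ⟨h1.2.2, by simp, ?_⟩⟩
  · cases L <;> simp_all
  · simpa [List.getLast?_append, List.getLast?_cons_cons] using h3

lemma IsSeg.exists_cons (h : IsSeg G a l b) : ∃ t, l = a :: t := by
  obtain ⟨h1, h2, h3⟩ := h
  cases l <;> simp_all

lemma IsSeg.exists_concat (h : IsSeg G a l b) : ∃ t, l = t ++ [b] :=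
  List.getLast?_eq_some_iff.1 h.last

lemma IsSeg.head_mem (h : IsSeg G a l b) : a ∈ l := by
  obtain ⟨t, rfl⟩ := h.exists_cons; simp

lemma IsSeg.last_mem (h : IsSeg G a l b) : b ∈ l := by
  obtain ⟨t, rfl⟩ := h.exists_concat; simp

lemma IsClosedList.rotate (h : IsClosedList G (L ++ x :: R)) :
    ∃ b, IsSeg G x (x :: R ++ L) b ∧ G.Adj b x := by
  obtain ⟨a, b, h, hba⟩ := h
  rcases List.eq_nil_or_concat' L with rfl | ⟨L', z, rfl⟩
  · obtain ⟨t, ht⟩ := h.exists_cons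
    simp at ht
    obtain ⟨rfl, rfl⟩ := ht
    exact ⟨b, by simpa using h, hba⟩
  · rw [List.append_assoc] at h
    obtain ⟨h1, h2, h3⟩ := IsSeg.split (L := L') (x := z) (y := x) (R := R) (by simpa using h)
    exact ⟨z, by simpa using h3.append hba h1, h2⟩

lemma countP_add_countP_le (P Q : V → Prop) (x : V) (l : List V)
    (h : (x :: l).IsChain fun a b => ¬(P b ∧ Q a)) :
    l.countP (P ·) + (x :: l).dropLast.countP (Q ·) ≤ l.length ∧
    (l.countP (P ·) + (x :: l).dropLast.countP (Q ·) = l.length →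
      (x :: l).IsChain fun a b => P b ↔ ¬ Q a) := by
  induction l generalizing x with
  | nil => simp
  | cons y t ih =>
    rw [List.isChain_cons_cons] at h
    obtain ⟨h1, h2⟩ := ih y h.2
    have h0 := h.1
    rw [List.isChain_cons_cons]
    simp only [List.dropLast_cons_cons, List.countP_cons, List.length_cons, decide_eq_true_eq]
    constructor
    · split_ifs <;> first | omega | tauto
    · intro he
      refine ⟨?_, h2 ?_⟩
      · refine ⟨fun hP hQ => h0 ⟨hP, hQ⟩, fun hQ => ?_⟩
        by_contra hP
        simp [hP, hQ] at he
        omega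
      · split_ifs at he <;> first | omega | tauto

lemma card_filter_eq_countP [DecidableEq V] {S : Finset V} {P : V → Prop} (hl : l.Nodup)
    (h : ∀ x, P x → (x ∈ l ↔ x ∈ S)) : (S.filter P).card = l.countP (P ·) := by
  rw [List.countP_eq_length_filter, ← List.toFinset_card_of_nodup (hl.filter _)]
  congr 1
  ext x
  simp only [Finset.mem_filter, List.mem_toFinset, List.mem_filter, decide_eq_true_eq]
  have := h x
  tauto

variable [DecidableEq V] {S : Finset V}

lemma Covers.nodup (h : Covers S l) : l.Nodup := by
  rw [List.nodup_iff_count_le_one]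
  intro x
  rw [h x]; split_ifs <;> simp

lemma Covers.mem (h : Covers S l) : x ∈ l ↔ x ∈ S := by
  rw [← List.count_pos_iff, h x]; split_ifs <;> simp_all

lemma covers_of_nodup (h : l.Nodup) (h' : ∀ x, x ∈ l ↔ x ∈ S) : Covers S l := by
  intro x
  by_cases hx : x ∈ l
  · rw [List.count_eq_one_of_mem h hx, if_pos ((h' x).1 hx)]
  · rw [List.count_eq_zero_of_not_mem hx, if_neg (by rwa [← h' x])]

lemma Covers.length (h : Covers S l) : l.length = S.card := by
  rw [← List.toFinset_card_of_nodup h.nodup]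
  congr 1
  ext; simp [h.mem]

lemma Covers.perm (h : Covers S l) (hp : ∀ x, l'.count x = l.count x) : Covers S l' :=
  fun x => by rw [hp, h]

/-- The endpoints of a walk that cannot be rearranged into a cycle satisfy complementary
adjacencies along the walk. -/
lemma IsSeg.crossing (h : IsSeg G a l b) (hl : l.Nodup) (hS : ∀ x ∈ l, x ∈ S)
    (ha : ∀ x ∈ S, G.Adj a x → x ∈ l) (hb : ∀ x ∈ S, G.Adj b x → x ∈ l)
    (hc : ∀ l' : List V, (∀ x, l'.count x = l.count x) → ¬ IsClosedList G l') :
    ¬ G.Adj a b ∧ degIn G S a + degIn G S b + 1 ≤ l.length ∧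
    (degIn G S a + degIn G S b + 1 = l.length →
      l.IsChain fun x y => G.Adj a y ↔ ¬ G.Adj b x) := by
  have hda : degIn G S a = l.countP (G.Adj a ·) :=
    card_filter_eq_countP hl fun x hx => ⟨hS x, fun h' => ha x h' hx⟩
  have hdb : degIn G S b = l.countP (G.Adj b ·) :=
    card_filter_eq_countP hl fun x hx => ⟨hS x, fun h' => hb x h' hx⟩
  have hab : ¬ G.Adj a b := fun hab => hc l (fun _ => rfl) ⟨a, b, h, hab.symm⟩
  have hno : l.IsChain fun x y => ¬ (G.Adj a y ∧ G.Adj b x) := by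
    rw [List.isChain_iff_forall_rel_of_append_cons_cons]
    rintro x y L R rfl ⟨h1, h2⟩
    obtain ⟨s1, -, s2⟩ := h.split
    refine hc _ ?_ ⟨a, y, s1.append h2.symm s2.reverse, h1.symm⟩
    intro z
    simp [List.count_append, List.count_cons]
  obtain ⟨t, rfl⟩ := h.exists_cons
  obtain ⟨u, hu⟩ := h.exists_concat
  obtain ⟨h1, h2⟩ := countP_add_countP_le _ _ _ _ hno
  have e1 : (a :: t).countP (G.Adj a ·) = t.countP (G.Adj a ·) := by simp
  have e2 : (a :: t).countP (G.Adj b ·) = (a :: t).dropLast.countP (G.Adj b ·) := by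
    rw [hu]; simp
  rw [hda, hdb, e1, e2]
  exact ⟨hab, by simpa using h1, fun he => h2 (by simpa using he)⟩

end Lists

/-- `S` induces a subgraph without Hamiltonian cycle whose degree sums miss the bound of Ore's
theorem by at most one. -/
structure IsCritical [DecidableEq V] (G : SimpleGraph V) (S : Finset V) : Prop where
  three_le : 3 ≤ S.card
  ore : ∀ x ∈ S, ∀ y ∈ S, x ≠ y → ¬ G.Adj x y → S.card ≤ degIn G S x + degIn G S y + 1
  not_closed : ∀ l, Covers S l → ¬ IsClosedList G l

section Critical

variable [DecidableEq V] {G : SimpleGraph V} {S : Finset V} {a b w x y z : V} {l L R : List V}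

omit [DecidableEq V] in
lemma IsSeg.eq_singleton (h : IsSeg G a l a) (hl : l.Nodup) : l = [a] := by
  obtain ⟨t, rfl⟩ := h.exists_cons
  rcases List.eq_nil_or_concat' t with rfl | ⟨t, z, rfl⟩
  · rfl
  · have := h.last
    rw [← List.cons_append, List.getLast?_append] at this
    simp at this
    subst this
    simp at hl

omit [DecidableEq V] in
lemma degIn_le_of_forall {T : Finset V} (h : ∀ y ∈ S, G.Adj x y → y ∈ T) :
    degIn G S x ≤ T.card :=
  Finset.card_le_card fun y hy => by
    rw [Finset.mem_filter] at hy
    exact h y hy.1 hy.2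

lemma IsCritical.exists_seg_length (hS : IsCritical G S) (k : ℕ) (hk : k + 1 ≤ S.card) :
    ∃ a l b, IsSeg G a l b ∧ l.Nodup ∧ (∀ x ∈ l, x ∈ S) ∧ l.length = k + 1 := by
  induction k with
  | zero =>
    obtain ⟨x, hx⟩ := Finset.card_pos.1 hk
    exact ⟨x, [x], x, IsSeg.single x, by simp, by simpa using hx, rfl⟩
  | succ k ih =>
    obtain ⟨a, l, b, hl, hnd, hlS, hlen⟩ := ih (by omega)
    by_contra hno
    have hhead : ∀ a l b, IsSeg G a l b → l.Nodup → (∀ x ∈ l, x ∈ S) → l.length = k + 1 →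
        ∀ u ∈ S, G.Adj a u → u ∈ l := by
      intro a l b hl hnd hlS hlen u hu hau
      by_contra hul
      refine hno ⟨u, u :: l, b, hl.cons hau.symm, List.nodup_cons.2 ⟨hul, hnd⟩, ?_, by simp [hlen]⟩
      simpa [hu] using hlS
    have ha := hhead a l b hl hnd hlS hlen
    have hb : ∀ u ∈ S, G.Adj b u → u ∈ l := by
      simpa using hhead b l.reverse a hl.reverse (by simpa using hnd) (by simpa using hlS)
        (by simpa using hlen)
    have hall : ∀ x ∈ l, ∀ u ∈ S, G.Adj x u → u ∈ l := by
      by_cases hc : ∃ l' : List V, (∀ x, l'.count x = l.count x) ∧ IsClosedList G l'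
      · obtain ⟨l', hp, hcl⟩ := hc
        intro x hx u hu hxu
        have hp := List.perm_iff_count.2 hp
        obtain ⟨L, R, rfl⟩ := List.append_of_mem (hp.mem_iff.2 hx)
        obtain ⟨b', hb', -⟩ := hcl.rotate
        have hp' : (x :: R ++ L).Perm l := List.perm_append_comm.trans hp
        exact hp'.mem_iff.1 (hhead _ _ _ hb' (hp'.nodup_iff.2 hnd)
          (fun y hy => hlS y (hp'.mem_iff.1 hy)) (hp'.length_eq.trans hlen) u hu hxu)
      · push Not at hc
        obtain ⟨h1, h2, -⟩ := hl.crossing hnd hlS ha hb hc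
        by_cases hab : a = b
        · subst hab
          obtain rfl := hl.eq_singleton hnd
          simpa using ha
        · have := hS.ore a (hlS a hl.head_mem) b (hlS b hl.last_mem) hab h1
          omega
    have hcard : l.toFinset.card = k + 1 := by rw [List.toFinset_card_of_nodup hnd, hlen]
    obtain ⟨u, huS, hul⟩ : ∃ u ∈ S, u ∉ l := by
      by_contra hcon
      push Not at hcon
      have : S.card ≤ l.toFinset.card := Finset.card_le_card fun x hx => by simpa using hcon x hx
      omega
    have hau : ¬ G.Adj a u := fun h => hul (ha u huS h)
    have h0 := hS.ore a (hlS a hl.head_mem) u huS (by rintro rfl; exact hul hl.head_mem) hau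
    have h1 : degIn G S a ≤ (l.toFinset.erase a).card :=
      degIn_le_of_forall fun y hy h => by simpa [h.ne'] using ha y hy h
    have h2 : degIn G S u ≤ ((S \ l.toFinset).erase u).card :=
      degIn_le_of_forall fun y hy h => by
        simp only [Finset.mem_erase, Finset.mem_sdiff, List.mem_toFinset]
        exact ⟨h.ne', hy, fun hyl => hul (hall y hyl u huS h.symm)⟩
    rw [Finset.card_erase_of_mem (by simpa using hl.head_mem)] at h1
    rw [Finset.card_erase_of_mem (by simp [huS, hul]), Finset.card_sdiff_of_subset
      (fun x hx => hlS x (by simpa using hx))] at h2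
    omega

lemma IsCritical.exists_seg (hS : IsCritical G S) :
    ∃ a l b, IsSeg G a l b ∧ Covers S l := by
  have := hS.three_le
  obtain ⟨a, l, b, h, hnd, hlS, hlen⟩ := hS.exists_seg_length (S.card - 1) (by omega)
  refine ⟨a, l, b, h, covers_of_nodup hnd ?_⟩
  have : l.toFinset = S := Finset.eq_of_subset_of_card_le (fun x hx => hlS x (by simpa using hx))
    (by rw [List.toFinset_card_of_nodup hnd]; omega)
  simp [← this]

/-- The complementary adjacencies of the endpoints of a Hamiltonian path. -/
lemma IsCritical.complement (hS : IsCritical G S) (h : IsSeg G a l b) (hl : Covers S l) :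
    ¬ G.Adj a b ∧ degIn G S a + degIn G S b + 1 = S.card ∧
      l.IsChain fun x y => G.Adj a y ↔ ¬ G.Adj b x := by
  obtain ⟨h1, h2, h3⟩ := h.crossing hl.nodup (fun x hx => hl.mem.1 hx)
    (fun x hx _ => hl.mem.2 hx) (fun x hx _ => hl.mem.2 hx)
    fun l' hl' => hS.not_closed l' (hl.perm hl')
  have hne : a ≠ b := by
    rintro rfl
    have := hl.length
    rw [h.eq_singleton hl.nodup] at this
    have := hS.three_le
    simp at *
    omega
  have := hS.ore a (hl.mem.1 h.head_mem) b (hl.mem.1 h.last_mem) hne h1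
  have := hl.length
  exact ⟨h1, by omega, h3 (by omega)⟩

lemma IsCritical.complement_adj (hS : IsCritical G S) (h : IsSeg G a (L ++ x :: y :: R) b)
    (hl : Covers S (L ++ x :: y :: R)) : G.Adj a y ↔ ¬ G.Adj b x :=
  List.isChain_iff_forall_rel_of_append_cons_cons.1 (hS.complement h hl).2.2 rfl

omit [DecidableEq V] in
lemma IsClosedList.rotate_last (h : IsClosedList G (L ++ x :: R)) :
    ∃ a, IsSeg G a (R ++ L ++ [x]) x ∧ G.Adj x a := by
  obtain ⟨a, b, h, hba⟩ := h
  have h' : IsClosedList G (R.reverse ++ x :: L.reverse) :=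
    ⟨b, a, by simpa using h.reverse, hba.symm⟩
  obtain ⟨c, hc, hcx⟩ := h'.rotate
  exact ⟨c, by simpa using hc.reverse, hcx.symm⟩

omit [DecidableEq V] in
lemma IsClosedList.rotate_pair (h : IsClosedList G (L ++ x :: y :: R)) :
    IsSeg G y (y :: R ++ (L ++ [x])) x ∧ G.Adj x y := by
  obtain ⟨b, hb, hby⟩ := IsClosedList.rotate (L := L ++ [x]) (x := y) (R := R) (by simpa using h)
  have : b = x := by
    have := hb.last
    rw [← List.append_assoc, List.getLast?_append] at this
    simpa [eq_comm] using this
  subst this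
  exact ⟨hb, hby⟩

/-- A vertex missed by a cycle of length `|S| - 1` has no two consecutive neighbours on it. -/
lemma IsCritical.not_adj_ends (hS : IsCritical G S) (h : IsSeg G x l y)
    (hl : Covers S (w :: l)) (hy : G.Adj w y) : ¬ G.Adj w x := fun hx =>
  hS.not_closed _ hl ⟨w, y, h.cons hx, hy.symm⟩

lemma IsCritical.not_adj_pair (hS : IsCritical G S) (h : IsClosedList G (L ++ x :: y :: R))
    (hl : Covers S (w :: (L ++ x :: y :: R))) (hx : G.Adj w x) : ¬ G.Adj w y := by
  refine hS.not_adj_ends h.rotate_pair.1 (hl.perm fun z => ?_) hx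
  simp [List.count_append, List.count_cons]
  omega

lemma IsCritical.adj_iff_of_missed (hS : IsCritical G S) (h : IsSeg G z (L ++ x :: y :: R) a)
    (hl : Covers S (w :: (L ++ x :: y :: R))) (ha : G.Adj w a) : G.Adj z y ↔ ¬ G.Adj w x := by
  have := h.append ha.symm (IsSeg.single w)
  simp only [List.append_assoc, List.cons_append] at this
  refine hS.complement_adj this (hl.perm fun z => ?_)
  simp [List.count_append, List.count_cons]
  omega

lemma IsCritical.adj_second_aux (hS : IsCritical G S) {M : List V}
    (h : IsSeg G x (x :: y :: (M ++ b :: c :: R)) a) (hax : G.Adj a x)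
    (hl : Covers S (w :: x :: y :: (M ++ b :: c :: R))) (ha : G.Adj w a) (hb : G.Adj w b) :
    G.Adj w y := by
  by_contra hy
  have hx := hS.not_adj_ends h hl ha
  obtain ⟨m, N, hmN⟩ : ∃ m N, M ++ [b] = m :: N := by cases M <;> simp
  have hMN : M ++ b :: c :: R = m :: (N ++ c :: R) := by
    rw [← List.cons_append, ← hmN]; simp
  have hxm : G.Adj x m := by
    rw [hMN] at h hl
    exact (hS.adj_iff_of_missed (L := [x]) (x := y) (y := m) h hl ha).2 hy
  have hcy : G.Adj c y := by
    have hrot := (IsClosedList.rotate_pair (L := x :: y :: M) (x := b) (y := c) (R := R)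
      ⟨x, a, h, hax⟩).1
    have hrot' : IsSeg G c ((c :: R) ++ x :: y :: (M ++ [b])) b := by simpa using hrot
    refine (hS.adj_iff_of_missed hrot' (hl.perm fun z => ?_) hb).2 hx
    simp [List.count_append, List.count_cons]
    omega
  obtain ⟨-, hxy, h1⟩ := IsSeg.split (L := []) h
  rw [hMN] at h1
  obtain ⟨-, -, h2⟩ := IsSeg.split (L := []) h1
  rw [← hMN] at h2
  obtain ⟨h3, -, h4⟩ := h2.split
  refine hS.not_closed _ (hl.perm fun z => ?_) ⟨w, a, ((h3.reverse.cons hb).append hxm.symm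
    ((IsSeg.single x).append hxy (IsSeg.single y))).append hcy.symm h4, ha.symm⟩
  simp [List.count_append, List.count_cons]
  omega

lemma IsCritical.adj_second (hS : IsCritical G S) (h : IsSeg G x (x :: y :: R) a)
    (hax : G.Adj a x) (hl : Covers S (w :: x :: y :: R)) (ha : G.Adj w a)
    (hw : ∀ z, G.Adj w z → ∃ z' ∈ S, G.Adj w z' ∧ z' ≠ z) : G.Adj w y := by
  obtain ⟨b, hbS, hb, hba⟩ := hw a ha
  have hx := hS.not_adj_ends h hl ha
  have hmem := hl.mem.2 hbS
  by_cases hby : b = y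
  · rwa [← hby]
  have hbR : b ∈ R := by
    have h1 : b ≠ w := hb.ne'
    have h2 : b ≠ x := by rintro rfl; exact hx hb
    simpa [h1, h2, hby] using hmem
  obtain ⟨M, R', rfl⟩ := List.append_of_mem hbR
  cases R' with
  | nil =>
    have := h.last
    rw [← List.cons_append, ← List.cons_append, List.getLast?_append] at this
    simp at this
    exact absurd this hba
  | cons c R' => exact hS.adj_second_aux h hax hl ha hb

omit [DecidableEq V] in
lemma isChain_or_of_triples (P : V → Prop) (a b : V) (l : List V) (h : P a ∨ P b)
    (h' : ∀ L x y z R, a :: b :: l = L ++ x :: y :: z :: R → P x → P z) :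
    (a :: b :: l).IsChain fun x y => P x ∨ P y := by
  induction l generalizing a b with
  | nil => simpa using h
  | cons c l ih =>
    rw [List.isChain_cons_cons]
    refine ⟨h, ih b c ?_ fun L x y z R he => h' (a :: L) x y z R (by simp [he])⟩
    rcases h with h | h
    · exact Or.inr (h' [] a b c l rfl h)
    · exact Or.inl h

/-- A vertex with two neighbours that is missed by a cycle of length `|S| - 1` is adjacent to
every other vertex of it. -/
lemma IsCritical.adj_or_adj (hS : IsCritical G S) (h : IsSeg G x l a)
    (hax : G.Adj a x) (hl : Covers S (w :: l)) (ha : G.Adj w a)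
    (hw : ∀ z, G.Adj w z → ∃ z' ∈ S, G.Adj w z' ∧ z' ≠ z) :
    l.IsChain fun x y => G.Adj w x ∨ G.Adj w y := by
  obtain ⟨t, rfl⟩ := h.exists_cons
  refine (isChain_or_of_triples (G.Adj w) a x t (Or.inl ha) ?_).tail
  intro L p q r R he hp
  cases L with
  | nil =>
    simp only [List.nil_append, List.cons.injEq] at he
    obtain ⟨rfl, rfl, rfl⟩ := he
    exact hS.adj_second h hax hl ha hw
  | cons c L =>
    simp only [List.cons_append, List.cons.injEq] at he
    obtain ⟨-, he⟩ := he
    rw [he] at h hl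
    obtain ⟨h1, h2⟩ := IsClosedList.rotate_pair ⟨x, a, h, hax⟩
    refine hS.adj_second (R := R ++ (L ++ [p])) (by simpa using h1) h2 (hl.perm fun z => ?_) hp hw
    simp [List.count_append, List.count_cons]
    omega

lemma IsCritical.adj_iff_adj_missed (hS : IsCritical G S) (h : IsSeg G x l a)
    (hax : G.Adj a x) (hl : Covers S (w :: l)) (ha : G.Adj w a)
    (hw : ∀ z, G.Adj w z → ∃ z' ∈ S, G.Adj w z' ∧ z' ≠ z) (hy : y ∈ S) :
    G.Adj x y ↔ G.Adj w y := by
  have hx := hS.not_adj_ends h hl ha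
  have hc := hS.adj_or_adj h hax hl ha hw
  obtain ⟨t, rfl⟩ := h.exists_cons
  have hmem := hl.mem.2 hy
  simp only [List.mem_cons] at hmem
  rcases hmem with rfl | rfl | hyt
  · simpa using fun h : G.Adj _ _ => hx h.symm
  · simpa using hx
  obtain ⟨L, R, rfl⟩ := List.append_of_mem hyt
  obtain ⟨L', z, hL⟩ : ∃ L' z, x :: L = L' ++ [z] :=
    ((List.eq_nil_or_concat' (x :: L)).resolve_left (by simp))
  have he : x :: (L ++ y :: R) = L' ++ z :: y :: R := by
    rw [← List.cons_append, hL]; simp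
  rw [he] at h hl hc
  have h1 := hS.not_adj_pair ⟨x, a, h, hax⟩ hl
  have h2 := List.isChain_iff_forall_rel_of_append_cons_cons.1 hc rfl
  have h3 := hS.adj_iff_of_missed h hl ha
  tauto

/-- `J` is completely joined to the independent set `S \ J`, which has one more element. -/
structure IsUnbalanced (G : SimpleGraph V) (S J : Finset V) : Prop where
  subset : J ⊆ S
  card : 2 * J.card + 1 = S.card
  adj_iff : ∀ x ∈ S, x ∉ J → ∀ y ∈ S, G.Adj x y ↔ y ∈ J

lemma IsCritical.isUnbalanced (hS : IsCritical G S) (h : IsClosedList G l)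
    (hl : Covers S (w :: l)) (hz : z ∈ S) (hwz : G.Adj w z)
    (hw : ∀ z, G.Adj w z → ∃ z' ∈ S, G.Adj w z' ∧ z' ≠ z) :
    IsUnbalanced G S (S.filter (G.Adj w)) := by
  have hzl : z ∈ l := by
    have := hl.mem.2 hz
    simpa [hwz.ne'] using this
  obtain ⟨L, R, rfl⟩ := List.append_of_mem hzl
  obtain ⟨x, hx, hzx⟩ := h.rotate_last
  have hl' : Covers S (w :: (R ++ L ++ [z])) := hl.perm fun z => by
    simp [List.count_append, List.count_cons]; omega
  clear hl hzl h
  generalize R ++ L ++ [z] = c at hx hl'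
  have hw' : w ∈ S := hl'.mem.1 (by simp)
  refine ⟨Finset.filter_subset _ _, ?_, ?_⟩
  · have h1 := (hS.complement (hx.append hwz.symm (IsSeg.single w)) (hl'.perm fun z => by
      simp [List.count_append, List.count_cons])).2.1
    have h2 : degIn G S x = degIn G S w := by
      unfold degIn
      congr 1
      exact Finset.filter_congr fun y hy => hS.adj_iff_adj_missed hx hzx hl' hwz hw hy
    rw [h2, degIn] at h1
    omega
  · intro x' hx'S hx'J y hy
    simp only [Finset.mem_filter, hx'S, true_and, hy] at hx'J ⊢
    by_cases hxw : x' = w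
    · rw [hxw]
    have hx'c : x' ∈ c := by simpa [hxw] using hl'.mem.2 hx'S
    have hc := hS.adj_or_adj hx hzx hl' hwz hw
    obtain ⟨L, R, rfl⟩ := List.append_of_mem hx'c
    rcases List.eq_nil_or_concat' L with rfl | ⟨L', p, rfl⟩
    · obtain ⟨t, ht⟩ := hx.exists_cons
      simp only [List.nil_append, List.cons.injEq] at ht
      obtain ⟨rfl, rfl⟩ := ht
      exact hS.adj_iff_adj_missed hx hzx hl' hwz hw hy
    · simp only [List.append_assoc, List.cons_append, List.nil_append] at hx hl' hc
      have hp := (List.isChain_iff_forall_rel_of_append_cons_cons.1 hc rfl).resolve_right hx'J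
      obtain ⟨h1, h2⟩ := IsClosedList.rotate_pair ⟨x, z, hx, hzx⟩
      refine hS.adj_iff_adj_missed h1 h2 (hl'.perm fun z => ?_) hp hw hy
      simp [List.count_append, List.count_cons]
      omega

/-- `S` is the union of two cliques `insert z A` and `insert z B` meeting in the cut vertex `z`. -/
structure IsCliquePair (G : SimpleGraph V) (S : Finset V) (z : V) (A B : Finset V) : Prop where
  left_nonempty : A.Nonempty
  right_nonempty : B.Nonempty
  disjoint : Disjoint A B
  not_mem_left : z ∉ A
  not_mem_right : z ∉ B
  eq_insert : S = insert z (A ∪ B)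
  adj_left : ∀ x ∈ A, G.Adj x z
  adj_right : ∀ x ∈ B, G.Adj x z
  clique_left : ∀ x ∈ A, ∀ y ∈ A, x ≠ y → G.Adj x y
  clique_right : ∀ x ∈ B, ∀ y ∈ B, x ≠ y → G.Adj x y
  not_adj : ∀ x ∈ A, ∀ y ∈ B, ¬ G.Adj x y

lemma IsCritical.isCliquePair_of_pendant (hS : IsCritical G S) (hw : w ∈ S)
    (hz : ∀ y ∈ S, G.Adj w y → y = z) :
    IsCliquePair G S z {w} ((S.erase w).erase z) := by
  have h3 := hS.three_le
  have hcard : (S.erase w).card = S.card - 1 := Finset.card_erase_of_mem hw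
  have hsub : S.filter (G.Adj w) ⊆ {z} := fun y hy => by
    rw [Finset.mem_filter] at hy
    simpa using hz y hy.1 hy.2
  have hdw : degIn G S w ≤ 1 := (Finset.card_le_card hsub).trans_eq (Finset.card_singleton z)
  have key : ∀ p ∈ S, p ≠ w → ¬ G.Adj w p →
      degIn G S w = 1 ∧ ∀ q ∈ S, q ≠ w → q ≠ p → G.Adj p q := by
    intro p hp hpw hwp
    have h1 := hS.ore w hw p hp hpw.symm hwp
    have hsub' : S.filter (G.Adj p) ⊆ (S.erase w).erase p := fun y hy => by
      rw [Finset.mem_filter] at hy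
      simp only [Finset.mem_erase]
      exact ⟨hy.2.ne', by rintro rfl; exact hwp hy.2.symm, hy.1⟩
    have hc : ((S.erase w).erase p).card = S.card - 2 := by
      rw [Finset.card_erase_of_mem (by simp [hp, hpw]), hcard]; omega
    have hle : degIn G S p ≤ _ := Finset.card_le_card hsub'
    refine ⟨by omega, fun q hq hqw hqp => ?_⟩
    have heq := Finset.eq_of_subset_of_card_le hsub' (by unfold degIn at *; omega)
    have : q ∈ S.filter (G.Adj p) := by rw [heq]; simp [hq, hqw, hqp]
    exact (Finset.mem_filter.1 this).2
  obtain ⟨p, hp⟩ : ((S.erase w).erase z).Nonempty := by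
    rw [← Finset.card_pos]
    have := Finset.pred_card_le_card_erase (s := S.erase w) (a := z)
    omega
  have hadj : ∀ p ∈ (S.erase w).erase z, ¬ G.Adj w p := fun p hp h => by
    simp only [Finset.mem_erase] at hp
    exact hp.1 (hz p hp.2.2 h)
  have hwz : z ∈ S ∧ G.Adj w z := by
    have hp' := hp
    simp only [Finset.mem_erase] at hp'
    have h1 := (key p hp'.2.2 hp'.2.1 (hadj p hp)).1
    obtain ⟨y, hy⟩ := Finset.card_pos.1 (h1.symm ▸ Nat.one_pos : 0 < degIn G S w)
    have := hsub hy
    rw [Finset.mem_singleton] at this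
    subst this
    exact Finset.mem_filter.1 hy
  have hkey : ∀ p ∈ (S.erase w).erase z, ∀ q ∈ S, q ≠ w → q ≠ p → G.Adj p q := fun p hp => by
    have hp' := hp
    simp only [Finset.mem_erase] at hp'
    exact (key p hp'.2.2 hp'.2.1 (hadj p hp)).2
  refine ⟨by simp, ⟨p, hp⟩, by simp, by simpa using hwz.2.ne', by simp, ?_, by simpa using hwz.2,
    ?_, by simp, ?_, by simpa using hadj⟩
  · ext x
    simp only [Finset.mem_insert, Finset.mem_union, Finset.mem_singleton, Finset.mem_erase]
    by_cases x = z <;> by_cases x = w <;> simp_all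
  · intro x hx
    refine hkey x hx z hwz.1 hwz.2.ne' ?_
    rintro rfl
    simp at hx
  · intro x hx y hy hxy
    simp only [Finset.mem_erase] at hy
    exact hkey x hx y hy.2.2 hy.2.1 hxy.symm

omit [DecidableEq V] in
lemma exists_pred_of_isChain {r : V → V → Prop} (h : (a :: l).IsChain r) (hx : x ∈ l) :
    ∃ y ∈ (a :: l).dropLast, r y x := by
  induction l generalizing a with
  | nil => simp at hx
  | cons b l ih =>
    rw [List.isChain_cons_cons] at h
    rcases List.mem_cons.1 hx with rfl | hx
    · exact ⟨a, by simp, h.1⟩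
    · obtain ⟨y, hy, hyx⟩ := ih h.2 hx
      exact ⟨y, by simp [hy], hyx⟩

/-- If the first endpoint of a Hamiltonian path sees exactly an initial part of the path, then
the last endpoint sees exactly the complementary final part. -/
lemma IsCritical.adj_last (hS : IsCritical G S) {P Q : List V}
    (h : IsSeg G a (P ++ z :: Q) b) (hl : Covers S (P ++ z :: Q)) (hP : P ≠ []) (hQ : Q ≠ [])
    (haz : G.Adj a z) (haP : ∀ x ∈ P, x ≠ a → G.Adj a x) (haQ : ∀ x ∈ Q, ¬ G.Adj a x) :
    G.Adj b z ∧ (∀ x ∈ Q, x ≠ b → G.Adj b x) ∧ ∀ x ∈ P, ¬ G.Adj b x := by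
  have h' : IsSeg G b (Q.reverse ++ z :: P.reverse) a := by simpa using h.reverse
  have hl' : Covers S (Q.reverse ++ z :: P.reverse) := hl.perm fun x => by
    simp [List.count_append, List.count_cons]; omega
  have hc := (hS.complement h' hl').2.2
  obtain ⟨P', rfl⟩ : ∃ P', P = a :: P' := by
    obtain ⟨t, ht⟩ := h.exists_cons
    cases P with
    | nil => simp at hP
    | cons c P => simp at ht; exact ⟨P, by rw [ht.1]⟩
  have hb : b ∈ Q := by
    obtain ⟨Q', q, rfl⟩ := (List.eq_nil_or_concat' Q).resolve_left hQ
    have := h.last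
    rw [← List.cons_append, ← List.append_assoc, List.getLast?_append] at this
    simp at this
    simp [this]
  have hQz : ∀ x ∈ Q.reverse ++ [z], x ≠ b → G.Adj b x := by
    intro x hx hxb
    have hc1 : (Q.reverse ++ [z]).IsChain _ := (hc : (_ ++ _ :: _).IsChain _).prefix
      ⟨(a :: P').reverse, by simp⟩
    obtain ⟨Q', hQ'⟩ : ∃ Q', Q.reverse = b :: Q' := by
      obtain ⟨t, ht⟩ := h'.exists_cons
      cases hq : Q.reverse with
      | nil => simp at hq; exact absurd hq hQ
      | cons c P => rw [hq] at ht; simp at ht; exact ⟨P, by rw [ht.1]⟩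
    rw [hQ'] at hx hc1
    rw [List.cons_append] at hx hc1
    obtain ⟨y, hy, hyx⟩ := exists_pred_of_isChain hc1 ((List.mem_cons.1 hx).resolve_left hxb)
    rw [← List.cons_append, List.dropLast_concat, ← hQ', List.mem_reverse] at hy
    exact hyx.2 (haQ y hy)
  refine ⟨hQz z (by simp) ?_, fun x hx => hQz x (by simp [hx]), ?_⟩
  · rintro rfl
    have := hl'.nodup
    rw [List.nodup_append] at this
    exact this.2.2 z (by simpa using hb) z (by simp) rfl
  · intro x hx
    have hc1 : (z :: (a :: P').reverse).IsChain _ := hc.suffix ⟨Q.reverse, rfl⟩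
    obtain ⟨y, hy, hyx⟩ := exists_pred_of_isChain hc1 (List.mem_reverse.2 hx)
    intro hbx
    refine hyx.1 hbx ?_
    rw [List.reverse_cons, ← List.cons_append, List.dropLast_concat] at hy
    rcases List.mem_cons.1 hy with rfl | hy
    · exact haz
    · rw [List.mem_reverse] at hy
      refine haP y (by simp [hy]) ?_
      rintro rfl
      have := hl.nodup
      simp [hy] at this

lemma IsCritical.adj_of_initial (hS : IsCritical G S) {P Q : List V}
    (h : IsSeg G a (P ++ z :: Q) b) (hl : Covers S (P ++ z :: Q)) (hP : P ≠ []) (hQ : Q ≠ [])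
    (haz : G.Adj a z) (haP : ∀ x ∈ P, x ≠ a → G.Adj a x) (haQ : ∀ x ∈ Q, ¬ G.Adj a x)
    (hx : x ∈ P) :
    G.Adj x z ∧ (∀ y ∈ P, y ≠ x → G.Adj x y) ∧ ∀ y ∈ Q, ¬ G.Adj x y := by
  obtain ⟨hbz, hbQ, hbP⟩ := hS.adj_last h hl hP hQ haz haP haQ
  obtain ⟨P₁, P₂, rfl⟩ := List.append_of_mem hx
  obtain ⟨g, N, hg⟩ : ∃ g N, P₂ ++ z :: Q = g :: N := by cases P₂ <;> simp
  have hag : G.Adj a g := by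
    cases P₂ with
    | nil =>
      simp only [List.nil_append, List.cons.injEq] at hg
      rwa [← hg.1]
    | cons c P₂ =>
      simp only [List.cons_append, List.cons.injEq] at hg
      obtain ⟨rfl, -⟩ := hg
      refine haP _ (by simp) ?_
      rintro rfl
      obtain ⟨t, ht⟩ := h.exists_cons
      have := hl.nodup
      cases P₁ with
      | nil => simp at ht; simp [ht.1] at this
      | cons d P₁ => simp at ht; simp [ht.1] at this
  rw [List.append_assoc, List.cons_append, hg] at h
  obtain ⟨h1, -, h2⟩ := h.split
  have hT := h1.reverse.append hag h2
  rw [← hg] at hT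
  have hT' : IsSeg G b (Q.reverse ++ z :: ((P₁ ++ [x]).reverse ++ P₂).reverse) x := by
    simpa using hT.reverse
  have := hS.adj_last hT' (hl.perm fun x => by
      simp [List.count_append, List.count_cons]; omega) (by simpa using hQ) (by simp) hbz
    (by simpa using hbQ) (fun y hy => hbP y (by simp at hy ⊢; tauto))
  refine ⟨this.1, fun y hy => this.2.1 y (by simp at hy ⊢; tauto), fun y hy => this.2.2 y (by simpa)⟩

lemma IsCritical.isCliquePair_of_initial (hS : IsCritical G S) {P Q : List V}
    (h : IsSeg G a (P ++ z :: Q) b) (hl : Covers S (P ++ z :: Q)) (hP : P ≠ []) (hQ : Q ≠ [])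
    (haz : G.Adj a z) (haP : ∀ x ∈ P, x ≠ a → G.Adj a x) (haQ : ∀ x ∈ Q, ¬ G.Adj a x) :
    IsCliquePair G S z P.toFinset Q.toFinset := by
  obtain ⟨hbz, hbQ, hbP⟩ := hS.adj_last h hl hP hQ haz haP haQ
  have h' : IsSeg G b (Q.reverse ++ z :: P.reverse) a := by simpa using h.reverse
  have hl' : Covers S (Q.reverse ++ z :: P.reverse) := hl.perm fun x => by
    simp [List.count_append, List.count_cons]; omega
  have h1 := fun x (hx : x ∈ P) => hS.adj_of_initial h hl hP hQ haz haP haQ hx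
  have h2 := fun x (hx : x ∈ Q) => hS.adj_of_initial h' hl' (by simpa using hQ) (by simpa using hP)
    hbz (by simpa using hbQ) (by simpa using hbP) (x := x) (by simpa using hx)
  have hnd := hl.nodup
  rw [List.nodup_append, List.nodup_cons] at hnd
  obtain ⟨n1, ⟨n2, n3⟩, n4⟩ := hnd
  refine ⟨by simpa using hP, by simpa using hQ, ?_, ?_, by simpa using n2, ?_, ?_, ?_, ?_, ?_, ?_⟩
  · rw [Finset.disjoint_left]
    intro x hx hx'
    simp only [List.mem_toFinset] at hx hx'
    exact n4 x hx x (by simp [hx']) rfl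
  · intro hz
    exact n4 z (by simpa using hz) z (by simp) rfl
  · ext x
    rw [← hl.mem]
    simp
    tauto
  · exact fun x hx => (h1 x (by simpa using hx)).1
  · exact fun x hx => (h2 x (by simpa using hx)).1
  · exact fun x hx y hy hxy => (h1 x (by simpa using hx)).2.1 y (by simpa using hy) hxy.symm
  · exact fun x hx y hy hxy => (h2 x (by simpa using hx)).2.1 y (by simpa using hy) hxy.symm
  · exact fun x hx y hy => (h1 x (by simpa using hx)).2.2 y (by simpa using hy)

omit [DecidableEq V] in
lemma exists_append_of_isChain (F : V → Prop) (l : List V)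
    (h : l.IsChain fun x y => F y → F x) :
    ∃ U W, l = U ++ W ∧ (∀ x ∈ U, F x) ∧ ∀ x ∈ W, ¬ F x := by
  induction l with
  | nil => exact ⟨[], [], by simp⟩
  | cons x l ih =>
    obtain ⟨U, W, rfl, hU, hW⟩ := ih h.tail
    by_cases hx : F x
    · exact ⟨x :: U, W, by simp, by simpa [hx] using hU, hW⟩
    · cases U with
      | nil => exact ⟨[], x :: W, by simp, by simp, by simpa [hx] using hW⟩
      | cons u U =>
        rw [List.cons_append, List.isChain_cons_cons] at h
        exact absurd (h.1 (hU u (by simp))) hx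

/-- The two kinds of graphs that miss the bound of Ore's theorem by one and have no
Hamiltonian cycle. -/
lemma IsCritical.structure (hS : IsCritical G S) :
    (∃ J, IsUnbalanced G S J) ∨ ∃ z A B, IsCliquePair G S z A B := by
  by_cases hpend : ∃ w ∈ S, ∃ z, ∀ y ∈ S, G.Adj w y → y = z
  · obtain ⟨w, hw, z, hz⟩ := hpend
    exact Or.inr ⟨z, _, _, hS.isCliquePair_of_pendant hw hz⟩
  push Not at hpend
  obtain ⟨a, l, b, h, hl⟩ := hS.exists_seg
  obtain ⟨hab, -, -⟩ := hS.complement h hl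
  by_cases hc : ∀ x y L R, l = L ++ x :: y :: R → G.Adj a y → x = a ∨ G.Adj a x
  · right
    obtain ⟨t, rfl⟩ := h.exists_cons
    have hat : a ∉ t := (List.nodup_cons.1 hl.nodup).1
    have hct : t.IsChain fun x y => G.Adj a y → G.Adj a x := by
      rw [List.isChain_iff_forall_rel_of_append_cons_cons]
      rintro x y L R rfl hy
      refine (hc x y (a :: L) R rfl hy).resolve_left ?_
      rintro rfl
      simp at hat
    obtain ⟨U, W, rfl, hU, hW⟩ := exists_append_of_isChain _ _ hct
    have hne : a ≠ b := by
      rintro rfl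
      have := h.eq_singleton hl.nodup
      have h1 := hl.length
      rw [this] at h1
      have := hS.three_le
      simp at h1
      omega
    have hb : b ∈ W := by
      have := h.last_mem
      simp only [List.mem_cons, List.mem_append, hne.symm, false_or] at this
      exact this.resolve_left fun h => hab (hU b h)
    obtain ⟨U, z, rfl⟩ : ∃ U' z, U = U' ++ [z] := by
      refine (List.eq_nil_or_concat' U).resolve_left ?_
      rintro rfl
      cases W with
      | nil => simp at hb
      | cons c W =>
        have := (IsSeg.split (L := []) h).2.1
        exact hW c (by simp) this
    refine ⟨z, _, _, hS.isCliquePair_of_initial (P := a :: U) (Q := W) (by simpa using h)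
      (by simpa using hl) (by simp) (List.ne_nil_of_mem hb) (hU z (by simp)) ?_ hW⟩
    intro x hx hxa
    exact hU x (List.mem_append_left _ (by simpa [hxa] using hx))
  · left
    push Not at hc
    obtain ⟨x, y, L, R, rfl, hay, hxa, hax⟩ := hc
    obtain ⟨M, q, rfl⟩ : ∃ M q, L = M ++ [q] := by
      refine (List.eq_nil_or_concat' L).resolve_left ?_
      rintro rfl
      obtain ⟨t, ht⟩ := h.exists_cons
      simp at ht
      exact hxa ht.1
    rw [List.append_assoc, List.cons_append, List.nil_append] at h hl
    have hbq : G.Adj b q := by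
      have := hS.complement_adj h hl
      tauto
    obtain ⟨h1, -, h2⟩ := h.split
    obtain ⟨-, -, h3⟩ := IsSeg.split (L := []) h2
    have hxS : x ∈ S := hl.mem.1 (by simp)
    obtain ⟨z, hzS, hxz, -⟩ := hpend x hxS x
    exact ⟨_, hS.isUnbalanced ⟨a, y, h1.append hbq.symm h3.reverse, hay.symm⟩ (hl.perm fun z => by
      simp [List.count_append, List.count_cons]; omega) hzS hxz fun z _ => hpend x hxS z⟩

end Critical

section Walks

variable {G : SimpleGraph V} {a b : V} {l : List V}

lemma IsSeg.exists_walk (h : IsSeg G a l b) : ∃ p : G.Walk a b, p.support = l := by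
  obtain ⟨h1, h2, h3⟩ := h
  have hne : l ≠ [] := by rintro rfl; simp at h2
  obtain rfl : l.head hne = a := by simpa [List.head?_eq_some_head hne] using h2
  obtain rfl : l.getLast hne = b := by simpa [List.getLast?_eq_some_getLast hne] using h3
  exact ⟨Walk.ofSupport l hne h1, Walk.support_ofSupport hne h1⟩

lemma isSeg_support (p : G.Walk a b) : IsSeg G a p.support b := by
  refine ⟨p.isChain_adj_support, ?_, ?_⟩
  · rw [List.head?_eq_some_head p.support_ne_nil, p.head_support]
  · rw [List.getLast?_eq_some_getLast p.support_ne_nil, p.getLast_support]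

lemma IsClosedList.exists_isCycle (h : IsClosedList G l) (hl : l.Nodup) (h3 : 3 ≤ l.length) :
    ∃ (v : V) (c : G.Walk v v), c.IsCycle ∧ ∀ x, x ∈ c.support ↔ x ∈ l := by
  obtain ⟨a, b, h, hba⟩ := h
  obtain ⟨p, rfl⟩ := h.exists_walk
  refine ⟨b, Walk.cons hba p, ?_, ?_⟩
  · rw [Walk.isCycle_iff_isPath_tail_and_le_length]
    refine ⟨by simpa [Walk.isPath_def] using hl, ?_⟩
    rw [Walk.length_support] at h3
    simpa using h3
  · intro x
    simp only [Walk.support_cons, List.mem_cons, or_iff_right_iff_imp]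
    rintro rfl
    exact p.end_mem_support

lemma exists_isClosedList {v : V} {c : G.Walk v v} (hc : c.IsCycle) :
    ∃ l : List V, l.Nodup ∧ IsClosedList G l ∧ ∀ x, x ∈ l ↔ x ∈ c.support := by
  cases c with
  | nil => simp at hc
  | cons h p =>
    rw [Walk.cons_isCycle_iff] at hc
    refine ⟨p.support, hc.1.support_nodup, ⟨_, _, isSeg_support p, h⟩, fun x => ?_⟩
    simp only [Walk.support_cons, List.mem_cons, iff_or_self]
    rintro rfl
    exact p.end_mem_support

variable [Fintype V] [DecidableEq V] {X T : Finset V} {k : ℕ}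

omit [Fintype V] in
lemma isHamiltonianCycle_of_forall_mem {v : V} {c : G.Walk v v} (hc : c.IsCycle)
    (h : ∀ x, x ∈ c.support) : c.IsHamiltonianCycle := by
  rw [Walk.isHamiltonianCycle_iff_isCycle_and_support_count_tail_eq_one]
  refine ⟨hc, fun x => List.count_eq_one_of_mem hc.support_nodup ?_⟩
  have := h x
  rw [← c.cons_tail_support] at this
  rcases List.mem_cons.1 this with rfl | h
  · exact Walk.end_mem_tail_support hc.not_nil
  · exact h

lemma isHForceSet_of_forall (hX : X.Nonempty)
    (h : ∀ l : List V, l.Nodup → IsClosedList G l → (∀ x ∈ X, x ∈ l) → ∀ x, x ∈ l) :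
    IsHForceSet G X := by
  refine ⟨hX, fun v c hc hXc => ?_⟩
  obtain ⟨l, hl, hcl, hmem⟩ := exists_isClosedList hc
  refine isHamiltonianCycle_of_forall_mem hc fun x => (hmem x).1 ?_
  exact h l hl hcl (fun x hx => (hmem x).2 (hXc x hx)) x

lemma exists_notMem_of_covers (hX : IsHForceSet G X) (hl : Covers T l)
    (hc : IsClosedList G l) (h3 : 3 ≤ T.card) (hT : T ≠ Finset.univ) : ∃ x ∈ X, x ∉ T := by
  by_contra hcon
  push Not at hcon
  obtain ⟨v, c, hcyc, hmem⟩ := hc.exists_isCycle hl.nodup (by rwa [hl.length])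
  have := hX.2 v c hcyc fun x hx => (hmem x).2 (hl.mem.2 (hcon x hx))
  exact hT (Finset.eq_univ_of_forall fun x => hl.mem.1 ((hmem x).1 (this.mem_support x)))

lemma mem_of_covers_erase (hX : IsHForceSet G X) (hn : 4 ≤ Fintype.card V)
    (hl : Covers (Finset.univ.erase a) l) (hc : IsClosedList G l) : a ∈ X := by
  have hcard : (Finset.univ.erase a).card = Fintype.card V - 1 := by
    rw [Finset.card_erase_of_mem (Finset.mem_univ a), Finset.card_univ]
  obtain ⟨x, hx, hxa⟩ := exists_notMem_of_covers hX hl hc (by omega) fun h => by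
    rw [h, Finset.card_univ] at hcard; omega
  obtain rfl : x = a := by simpa using hxa
  exact hx

lemma hForce_eq_of (hX : IsHForceSet G X) (h : ∀ Y, IsHForceSet G Y → X.card ≤ Y.card) :
    hForce G = X.card := by
  refine le_antisymm (Nat.sInf_le ⟨X, hX, rfl⟩) (le_csInf ⟨_, X, hX, rfl⟩ ?_)
  rintro k ⟨Y, hY, rfl⟩
  exact h Y hY

end Walks

section Constructions

variable [DecidableEq V] {G : SimpleGraph V} {A B S T I J : Finset V} {a b u v x : V}
  {l l' : List V}

lemma Covers.append (h : Covers S l) (h' : Covers T l') (hd : Disjoint S T) :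
    Covers (S ∪ T) (l ++ l') := by
  refine covers_of_nodup (h.nodup.append h'.nodup fun x hx hx' => ?_) fun x => ?_
  · exact Finset.disjoint_left.1 hd (h.mem.1 hx) (h'.mem.1 hx')
  · simp [h.mem, h'.mem]

lemma Covers.cons (h : Covers S l) (hx : x ∉ S) : Covers (insert x S) (x :: l) :=
  covers_of_nodup (List.nodup_cons.2 ⟨by rwa [h.mem], h.nodup⟩) fun y => by simp [h.mem]

lemma exists_seg_of_clique (hT : T.Nonempty) (h : ∀ x ∈ T, ∀ y ∈ T, x ≠ y → G.Adj x y) :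
    ∃ a ∈ T, ∃ b ∈ T, ∃ l, IsSeg G a l b ∧ Covers T l := by
  induction hT using Finset.Nonempty.cons_induction with
  | singleton x =>
    exact ⟨x, by simp, x, by simp, [x], IsSeg.single x, covers_of_nodup (by simp) (by simp)⟩
  | cons x T hx hT ih =>
    simp only [Finset.cons_eq_insert] at *
    obtain ⟨a, ha, b, hb, l, hl, hc⟩ := ih fun y hy z hz => h y (by simp [hy]) z (by simp [hz])
    exact ⟨x, by simp, b, by simp [hb], x :: l,
      hl.cons (h x (by simp) a (by simp [ha]) (by rintro rfl; exact hx ha)), hc.cons hx⟩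

lemma exists_seg_of_join (k : ℕ) (hI : I.card = k + 1) (hJ : J.card = k + 1)
    (h : ∀ x ∈ I, ∀ y ∈ J, G.Adj x y) :
    ∃ a ∈ I, ∃ b ∈ J, ∃ l, IsSeg G a l b ∧ Covers (I ∪ J) l := by
  have hd : ∀ x ∈ I, x ∉ J := fun x hx hx' => (h x hx x hx').ne rfl
  induction k generalizing I J with
  | zero =>
    obtain ⟨x, rfl⟩ := Finset.card_eq_one.1 hI
    obtain ⟨y, rfl⟩ := Finset.card_eq_one.1 hJ
    have hxy := h x (by simp) y (by simp)
    exact ⟨x, by simp, y, by simp, [x, y], (IsSeg.single y).cons hxy,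
      covers_of_nodup (by simpa using hxy.ne) (by simp)⟩
  | succ k ih =>
    obtain ⟨x, hx⟩ := Finset.card_pos.1 (by omega : 0 < I.card)
    obtain ⟨y, hy⟩ := Finset.card_pos.1 (by omega : 0 < J.card)
    obtain ⟨a, ha, b, hb, l, hl, hc⟩ := ih (I := I.erase x) (J := J.erase y)
      (by rw [Finset.card_erase_of_mem hx]; omega) (by rw [Finset.card_erase_of_mem hy]; omega)
      (fun p hp q hq => h p (Finset.mem_of_mem_erase hp) q (Finset.mem_of_mem_erase hq))
      (fun p hp hp' => hd p (Finset.mem_of_mem_erase hp) (Finset.mem_of_mem_erase hp'))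
    have hxy := h x hx y hy
    refine ⟨x, hx, b, Finset.mem_of_mem_erase hb, x :: y :: l,
      (hl.cons (h a (Finset.mem_of_mem_erase ha) y hy).symm).cons hxy, ?_⟩
    have h1 := (hc.cons (x := y) (by simp; exact fun _ h => hd y h hy)).cons (x := x)
      (by simp [hxy.ne, hd x hx])
    convert h1 using 1
    ext p
    simp only [Finset.mem_insert, Finset.mem_union, Finset.mem_erase]
    by_cases p = x <;> by_cases p = y <;> simp_all

/-- Two disjoint cliques with two further vertices joined to everything have a Hamiltonian
cycle. -/
lemma exists_closed_of_cliques (hA : A.Nonempty) (hB : B.Nonempty) (hd : Disjoint A B)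
    (hcA : ∀ x ∈ A, ∀ y ∈ A, x ≠ y → G.Adj x y) (hcB : ∀ x ∈ B, ∀ y ∈ B, x ≠ y → G.Adj x y)
    (huv : u ≠ v) (hu : ∀ x ∈ A ∪ B, G.Adj x u) (hv : ∀ x ∈ A ∪ B, G.Adj x v) :
    ∃ l, Covers (insert u (insert v (A ∪ B))) l ∧ IsClosedList G l := by
  obtain ⟨a, ha, a', ha', l, hl, hlA⟩ := exists_seg_of_clique hA hcA
  obtain ⟨b, hb, b', hb', l', hl', hlB⟩ := exists_seg_of_clique hB hcB
  have hvAB : v ∉ A ∪ B := fun h => (hv v h).ne rfl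
  have huAB : u ∉ insert v (A ∪ B) := fun h => by
    rcases Finset.mem_insert.1 h with h | h
    · exact huv h
    · exact (hu u h).ne rfl
  refine ⟨u :: (l ++ v :: l'), (((hlA.append hlB hd).cons hvAB).cons huAB).perm fun z => ?_, u, b',
    (hl.append (hv a' (by simp [ha'])) (hl'.cons (hv b (by simp [hb])).symm)).cons
      (hu a (by simp [ha])).symm, hu b' (by simp [hb'])⟩
  simp [List.count_append, List.count_cons]
  omega

end Constructions

section ForceNumber

variable [Fintype V] [DecidableEq V] {G : SimpleGraph V} {X Y A B J : Finset V}
  {a b v x y z : V} {l : List V}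

lemma degree_eq_degIn_erase (v x : V) :
    G.degree x = degIn G (Finset.univ.erase v) x + if G.Adj x v then 1 else 0 := by
  have h : G.degree x = (Finset.univ.filter (G.Adj x)).card := by
    rw [← G.card_neighborFinset_eq_degree]
    congr 1
    ext; simp
  rw [h, degIn, ← Finset.insert_erase (Finset.mem_univ v), Finset.filter_insert,
    Finset.erase_insert (Finset.notMem_erase v _)]
  split_ifs
  · rw [Finset.card_insert_of_notMem (by simp)]
  · rfl

lemma isCritical_erase (hn : 5 ≤ Fintype.card V) (hG : IsOTG G)
    (h : ∀ l, Covers (Finset.univ.erase v) l → ¬IsClosedList G l) :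
    IsCritical G (Finset.univ.erase v) := by
  have hcard : (Finset.univ.erase v).card = Fintype.card V - 1 := by
    rw [Finset.card_erase_of_mem (Finset.mem_univ v), Finset.card_univ]
  refine ⟨by omega, fun x _ y _ hxy hadj => ?_, h⟩
  have h1 := hG x y hxy hadj
  rw [degree_eq_degIn_erase v x, degree_eq_degIn_erase v y] at h1
  split_ifs at h1 <;> omega

lemma hForce_eq_card (hn : 5 ≤ Fintype.card V)
    (h : ∀ v, ∃ l, Covers (Finset.univ.erase v) l ∧ IsClosedList G l) :
    hForce G = Fintype.card V := by
  have : Nonempty V := Fintype.card_pos_iff.1 (by omega)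
  rw [← Finset.card_univ]
  refine hForce_eq_of (isHForceSet_of_forall Finset.univ_nonempty
    fun l _ _ hl x => hl x (Finset.mem_univ x)) fun Y hY => Finset.card_le_card fun x _ => ?_
  obtain ⟨l, hl, hc⟩ := h x
  exact mem_of_covers_erase hY (by omega) hl hc

omit [Fintype V] in
/-- A set spanning no edges has at most half of the vertices of a cycle. -/
lemma two_mul_card_le_length (hl : l.Nodup) (hc : IsClosedList G l) (hX : ∀ x ∈ X, x ∈ l)
    (hI : ∀ x ∈ X, ∀ y ∈ X, ¬G.Adj x y) : 2 * X.card ≤ l.length := by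
  obtain ⟨a, b, hs, hba⟩ := hc
  have h := (countP_add_countP_le (· ∈ X) (· ∈ X) b l
    ((hs.cons hba).chain.imp fun p q hpq hp => hI p hp.2 q hp.1 hpq)).1
  have hp (P : V → Bool) : (b :: l).dropLast.countP P = l.countP P := by
    obtain ⟨t, rfl⟩ := hs.exists_concat
    rw [← List.cons_append, List.dropLast_concat]
    simp [List.countP_append, List.countP_cons]
  have hq := card_filter_eq_countP (S := X) (P := (· ∈ X)) hl fun x hx => by simp [hx, hX x hx]
  have hf (_ : DecidablePred (· ∈ X)) : X.filter (· ∈ X) = X := by ext; simp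
  rw [hf] at hq
  rw [hp] at h
  omega

lemma exists_closed_of_join {I : Finset V} {k : ℕ} (hI : I.card = k + 2) (hJ : J.card = k + 2)
    (h : ∀ x ∈ I, ∀ y ∈ J, G.Adj x y) (hu : Finset.univ = I ∪ J) (hx : x ∈ I) (hy : y ∈ J) :
    ∃ l, Covers ((Finset.univ.erase x).erase y) l ∧ IsClosedList G l := by
  obtain ⟨a, ha, b, hb, l, hl, hc⟩ := exists_seg_of_join (I := I.erase x) (J := J.erase y) k
    (by rw [Finset.card_erase_of_mem hx]; omega) (by rw [Finset.card_erase_of_mem hy]; omega)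
    (fun p hp q hq => h p (Finset.mem_of_mem_erase hp) q (Finset.mem_of_mem_erase hq))
  refine ⟨l, ?_, a, b, hl, (h a (Finset.mem_of_mem_erase ha) b (Finset.mem_of_mem_erase hb)).symm⟩
  convert hc using 1
  have hd : ∀ p ∈ I, p ∉ J := fun p hp hp' => (h p hp p hp').ne rfl
  ext p
  have : p ∈ I ∪ J := hu ▸ Finset.mem_univ p
  simp only [Finset.mem_erase, Finset.mem_union, Finset.mem_univ] at this ⊢
  have := hd x hx
  have h2 := hd y
  grind

lemma IsUnbalanced.two_mul_hForce (hn : 5 ≤ Fintype.card V) (hG : IsOTG G)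
    (h : IsUnbalanced G (Finset.univ.erase v) J) : 2 * hForce G = Fintype.card V := by
  obtain ⟨hsub, hcard, hadj⟩ := h
  rw [Finset.card_erase_of_mem (Finset.mem_univ v), Finset.card_univ] at hcard
  have hvJ : v ∉ J := fun hv => by simpa using hsub hv
  set I := (insert v J)ᶜ with hIdef
  have hcJ : (insert v J).card = J.card + 1 := Finset.card_insert_of_notMem hvJ
  have hcI : I.card = J.card + 1 := by rw [hIdef, Finset.card_compl]; omega
  have hmem : ∀ x, x ∈ I ↔ x ≠ v ∧ x ∉ J := by simp [hIdef]
  have hdeg : ∀ x ∈ I, degIn G (Finset.univ.erase v) x = J.card := fun x hx => by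
    rw [hmem] at hx
    rw [degIn]
    congr 1
    ext y
    simp only [Finset.mem_filter]
    refine ⟨fun hy => (hadj x (by simp [hx.1]) hx.2 y hy.1).1 hy.2, fun hy => ⟨hsub hy, ?_⟩⟩
    exact (hadj x (by simp [hx.1]) hx.2 y (hsub hy)).2 hy
  have hind : ∀ x ∈ I, ∀ y ∈ I, ¬G.Adj x y := fun x hx y hy hxy => by
    rw [hmem] at hx hy
    exact hy.2 ((hadj x (by simp [hx.1]) hx.2 y (by simp [hy.1])).1 hxy)
  have hv : ∀ x ∈ I, G.Adj x v := fun x hx => by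
    obtain ⟨y, hy, hyx⟩ := Finset.exists_mem_ne (by omega : 1 < I.card) x
    have h1 := hG x y hyx.symm (hind x hx y hy)
    rw [degree_eq_degIn_erase v x, degree_eq_degIn_erase v y, hdeg x hx, hdeg y hy] at h1
    by_contra hxv
    rw [if_neg hxv] at h1
    split_ifs at h1 <;> omega
  have hjoin : ∀ x ∈ I, ∀ y ∈ insert v J, G.Adj x y := fun x hx y hy => by
    rcases Finset.mem_insert.1 hy with rfl | hy
    · exact hv x hx
    · have hx' := (hmem x).1 hx
      exact (hadj x (by simp [hx'.1]) hx'.2 y (hsub hy)).2 hy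
  have huniv : Finset.univ = I ∪ insert v J := by
    rw [hIdef, Finset.union_comm, Finset.union_compl]
  have hforce : IsHForceSet G I := by
    refine isHForceSet_of_forall (Finset.card_pos.1 (by omega)) fun l hl hc hX x => ?_
    have h1 := two_mul_card_le_length hl hc hX hind
    rw [← List.mem_toFinset, Finset.eq_univ_of_card l.toFinset]
    · simp
    · have := l.toFinset.card_le_univ
      rw [List.toFinset_card_of_nodup hl] at this ⊢
      omega
  rw [hForce_eq_of hforce fun Y hY => ?_]
  · omega
  by_cases hIY : I ⊆ Y
  · exact Finset.card_le_card hIY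
  by_cases hJY : insert v J ⊆ Y
  · exact (by omega : I.card ≤ (insert v J).card).trans (Finset.card_le_card hJY)
  obtain ⟨x, hx, hxY⟩ := Finset.not_subset.1 hIY
  obtain ⟨y, hy, hyY⟩ := Finset.not_subset.1 hJY
  obtain ⟨l, hl, hc⟩ := exists_closed_of_join (k := J.card - 1) (by omega) (by omega) hjoin huniv
    hx hy
  have hxy := (hjoin x hx y hy).ne
  have hT : ((Finset.univ.erase x).erase y).card = Fintype.card V - 2 := by
    rw [Finset.card_erase_of_mem (by simp [hxy.symm]), Finset.card_erase_of_mem (by simp),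
      Finset.card_univ]
    omega
  obtain ⟨p, hp, hpT⟩ := exists_notMem_of_covers hY hl hc (by omega) fun h => by
    rw [h, Finset.card_univ] at hT; omega
  have : p = y ∨ p = x := by
    by_contra hcon
    exact hpT (by simp_all)
  rcases this with rfl | rfl <;> contradiction

omit [Fintype V] in
/-- No chain meets two sets between which there are no edges while staying in their union. -/
lemma not_isChain_of_not_adj (hd : Disjoint A B) (hn : ∀ x ∈ A, ∀ y ∈ B, ¬G.Adj x y)
    (ha : a ∈ A) (hb : b ∈ B) (hal : a ∈ l) (hbl : b ∈ l) (hl : ∀ x ∈ l, x ∈ A ∪ B) :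
    ¬l.IsChain G.Adj := by
  intro h
  have h1 : l.IsChain fun x y => x ∈ A ↔ y ∈ A := by
    refine List.IsChain.imp_of_mem_imp (fun x y hx hy hxy => ?_) h
    have h1 := Finset.mem_union.1 (hl x hx)
    have h2 := Finset.mem_union.1 (hl y hy)
    have h3 := hn x
    have h4 := hn y
    have h5 := Finset.disjoint_left.1 hd
    have := hxy.symm
    grind
  have : IsTrans V (fun x y : V => x ∈ A ↔ y ∈ A) := ⟨fun _ _ _ => Iff.trans⟩
  have : Std.Symm (fun x y : V => x ∈ A ↔ y ∈ A) := ⟨fun _ _ => Iff.symm⟩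
  have h2 : a ∈ A ↔ b ∈ A := List.Pairwise.forall_of_forall
    (R := fun x y => x ∈ A ↔ y ∈ A) (fun _ _ => Iff.rfl) h1.pairwise hal hbl
  exact Finset.disjoint_left.1 hd (h2.1 ha) hb

omit [Fintype V] in
lemma mem_of_isClosedList (hd : Disjoint A B) (hn : ∀ x ∈ A, ∀ y ∈ B, ¬G.Adj x y)
    (ha : a ∈ A) (hb : b ∈ B) (hx : x ∉ A ∪ B) (hu : ∀ p, p = x ∨ p = y ∨ p ∈ A ∪ B)
    (hl : l.Nodup) (hc : IsClosedList G l) (hAB : ∀ p ∈ A ∪ B, p ∈ l) : y ∈ l := by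
  by_contra hy
  have hal := hAB a (by simp [ha])
  have hbl := hAB b (by simp [hb])
  by_cases hxl : x ∈ l
  · obtain ⟨L, R, rfl⟩ := List.append_of_mem hxl
    obtain ⟨_, h, _⟩ := hc.rotate
    have hax : a ≠ x := by rintro rfl; exact hx (by simp [ha])
    have hbx : b ≠ x := by rintro rfl; exact hx (by simp [hb])
    refine not_isChain_of_not_adj (l := R ++ L) hd hn ha hb (by simp_all; tauto)
      (by simp_all; tauto) (fun p hp => ?_) h.chain.of_cons
    rw [List.nodup_middle, List.nodup_cons] at hl
    have := hu p
    have h1 : p ≠ x := by rintro rfl; exact hl.1 (by simp_all)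
    have h2 : p ≠ y := by rintro rfl; exact hy (by simp_all)
    tauto
  · obtain ⟨_, _, h, _⟩ := hc
    refine not_isChain_of_not_adj hd hn ha hb hal hbl (fun p hp => ?_) h.chain
    have := hu p
    have h1 : p ≠ x := by rintro rfl; exact hxl hp
    have h2 : p ≠ y := by rintro rfl; exact hy hp
    tauto

/-- If `G` consists of two disjoint cliques joined to two further vertices, then deleting a vertex
of one of the cliques leaves a Hamiltonian graph. -/
lemma exists_closed_erase_of_cliques (hn : 5 ≤ Fintype.card V) (hd : Disjoint A B)
    (hcA : ∀ x ∈ A, ∀ y ∈ A, x ≠ y → G.Adj x y) (hcB : ∀ x ∈ B, ∀ y ∈ B, x ≠ y → G.Adj x y)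
    (hB : B.Nonempty) (hxy : x ≠ y) (hx : ∀ p ∈ A ∪ B, G.Adj p x) (hy : ∀ p ∈ A ∪ B, G.Adj p y)
    (hu : Finset.univ = insert x (insert y (A ∪ B))) (ha : a ∈ A) :
    ∃ l, Covers (Finset.univ.erase a) l ∧ IsClosedList G l := by
  have hax := (hx a (by simp [ha])).ne
  have hay := (hy a (by simp [ha])).ne
  have haB := Finset.disjoint_left.1 hd ha
  have herase : Finset.univ.erase a = insert x (insert y (A.erase a ∪ B)) := by
    rw [hu, Finset.erase_insert_of_ne hax.symm, Finset.erase_insert_of_ne hay.symm,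
      Finset.erase_union_distrib, Finset.erase_eq_of_notMem haB]
  rw [herase]
  by_cases hA : (A.erase a).Nonempty
  · refine exists_closed_of_cliques hA hB (hd.mono_left (Finset.erase_subset a A))
      (fun p hp q hq => hcA p (Finset.mem_of_mem_erase hp) q (Finset.mem_of_mem_erase hq)) hcB hxy
      (fun p hp => hx p ?_) fun p hp => hy p ?_
    all_goals exact Finset.union_subset_union_left (Finset.erase_subset a A) hp
  · obtain ⟨b, hb⟩ := hB
    rw [Finset.not_nonempty_iff_eq_empty] at hA
    have h1 : Fintype.card V ≤ B.card + 3 := by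
      have h2 := Finset.card_insert_le x (insert y (A ∪ B))
      have h3 := Finset.card_insert_le y (A ∪ B)
      have h4 := Finset.card_union_le A B
      have h5 := Finset.card_erase_of_mem ha
      rw [← hu, Finset.card_univ] at h2
      rw [hA, Finset.card_empty] at h5
      omega
    have hB' : (B.erase b).Nonempty := by
      rw [← Finset.card_pos, Finset.card_erase_of_mem hb]; omega
    have h2 : A.erase a ∪ B = {b} ∪ B.erase b := by
      rw [hA, Finset.empty_union, ← Finset.insert_eq, Finset.insert_erase hb]
    rw [h2]
    refine exists_closed_of_cliques (by simp) hB' (by simp) (by simp)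
      (fun p hp q hq => hcB p (Finset.mem_of_mem_erase hp) q (Finset.mem_of_mem_erase hq)) hxy
      (fun p hp => hx p ?_) fun p hp => hy p ?_
    all_goals
      rw [← h2, hA, Finset.empty_union] at hp
      exact Finset.mem_union_right A hp

lemma IsCliquePair.degIn_le (h : IsCliquePair G (Finset.univ.erase v) z A B) (ha : a ∈ A) :
    degIn G (Finset.univ.erase v) a ≤ A.card := by
  have h1 : (Finset.univ.erase v).filter (G.Adj a) ⊆ insert z (A.erase a) := fun p hp => by
    rw [h.eq_insert, Finset.mem_filter] at hp
    have := h.not_adj a ha p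
    have := hp.2.ne
    simp only [Finset.mem_insert, Finset.mem_union, Finset.mem_erase] at hp ⊢
    tauto
  refine (Finset.card_le_card h1).trans ((Finset.card_insert_le _ _).trans ?_)
  rw [Finset.card_erase_of_mem ha]
  have := Finset.card_pos.2 ⟨a, ha⟩
  omega

omit [Fintype V] in
lemma IsCliquePair.symm {S : Finset V} (h : IsCliquePair G S z A B) : IsCliquePair G S z B A where
  left_nonempty := h.right_nonempty
  right_nonempty := h.left_nonempty
  disjoint := h.disjoint.symm
  not_mem_left := h.not_mem_right
  not_mem_right := h.not_mem_left
  eq_insert := by rw [h.eq_insert, Finset.union_comm]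
  adj_left := h.adj_right
  adj_right := h.adj_left
  clique_left := h.clique_right
  clique_right := h.clique_left
  not_adj := fun x hx y hy hxy => h.not_adj y hy x hx hxy.symm

lemma IsCliquePair.hForce_eq (hn : 5 ≤ Fintype.card V) (hG : IsOTG G)
    (h : IsCliquePair G (Finset.univ.erase v) z A B) : hForce G = Fintype.card V - 2 := by
  have hz : z ∉ A ∪ B := by simp [h.not_mem_left, h.not_mem_right]
  have hvz : v ∉ insert z (A ∪ B) := by rw [← h.eq_insert]; simp
  have huniv : Finset.univ = insert v (insert z (A ∪ B)) := by
    rw [← h.eq_insert, Finset.insert_erase (Finset.mem_univ v)]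
  have hcard : Fintype.card V = (A ∪ B).card + 2 := by
    rw [← Finset.card_univ, huniv, Finset.card_insert_of_notMem hvz,
      Finset.card_insert_of_notMem hz]
  have hcAB := Finset.card_union_of_disjoint h.disjoint
  have hv : ∀ a ∈ A, ∀ b ∈ B, G.Adj a v ∧ G.Adj b v := fun a ha b hb => by
    have hab : a ≠ b := by rintro rfl; exact Finset.disjoint_left.1 h.disjoint ha hb
    have h1 := hG a b hab (h.not_adj a ha b hb)
    rw [degree_eq_degIn_erase v a, degree_eq_degIn_erase v b] at h1
    have h2 := h.degIn_le ha
    have h3 := h.symm.degIn_le hb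
    split_ifs at h1 with h4 h5 <;> first | exact ⟨h4, h5⟩ | omega
  obtain ⟨a, ha⟩ := h.left_nonempty
  obtain ⟨b, hb⟩ := h.right_nonempty
  have hv' : ∀ p ∈ A ∪ B, G.Adj p v := fun p hp => by
    rcases Finset.mem_union.1 hp with hp | hp
    · exact (hv p hp b hb).1
    · exact (hv a ha p hp).2
  have hz' : ∀ p ∈ A ∪ B, G.Adj p z := fun p hp => by
    rcases Finset.mem_union.1 hp with hp | hp
    · exact h.adj_left p hp
    · exact h.adj_right p hp
  have hmem : ∀ p, p = v ∨ p = z ∨ p ∈ A ∪ B := fun p => by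
    have := Finset.mem_univ p
    rwa [huniv, Finset.mem_insert, Finset.mem_insert] at this
  have hforce : IsHForceSet G (A ∪ B) := by
    refine isHForceSet_of_forall ⟨a, by simp [ha]⟩ fun l hl hc hX p => ?_
    rcases hmem p with rfl | rfl | hp
    · exact mem_of_isClosedList h.disjoint h.not_adj ha hb hz (fun p => by have := hmem p; tauto)
        hl hc hX
    · exact mem_of_isClosedList h.disjoint h.not_adj ha hb
        (fun hv => hvz (Finset.mem_insert_of_mem hv)) hmem hl hc hX
    · exact hX p hp
  rw [hForce_eq_of hforce fun Y hY => Finset.card_le_card fun p hp => ?_]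
  · omega
  have hvz' : v ≠ z := by rintro rfl; simp at hvz
  obtain ⟨l, hl, hc⟩ : ∃ l, Covers (Finset.univ.erase p) l ∧ IsClosedList G l := by
    rcases Finset.mem_union.1 hp with hp | hp
    · exact exists_closed_erase_of_cliques hn h.disjoint h.clique_left h.clique_right
        ⟨b, hb⟩ hvz' hv' hz' huniv hp
    · rw [Finset.union_comm] at hv' hz' huniv
      exact exists_closed_erase_of_cliques hn h.disjoint.symm h.clique_right h.clique_left
        ⟨a, ha⟩ hvz' hv' hz' huniv hp
  exact mem_of_covers_erase hY (by omega) hl hc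

end ForceNumber

end HForce

/-- For an OTG `G` with `n ≥ 5` vertices, the H-force number is `n - 2`, `n / 2`, or `n`. -/
theorem stmt_8 {V : Type*} [Fintype V] [DecidableEq V] (G : SimpleGraph V)
    (hn : 5 ≤ Fintype.card V) (hOTG : IsOTG G) :
    hForce G = Fintype.card V - 2 ∨ 2 * hForce G = Fintype.card V ∨
      hForce G = Fintype.card V := by
  by_cases h : ∀ v, ∃ l, HForce.Covers (Finset.univ.erase v) l ∧ HForce.IsClosedList G l
  · exact Or.inr (Or.inr (HForce.hForce_eq_card hn h))
  push Not at h
  obtain ⟨v, hv⟩ := h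
  rcases (HForce.isCritical_erase hn hOTG hv).structure with ⟨J, hJ⟩ | ⟨z, A, B, hAB⟩
  · exact Or.inr (Or.inl (hJ.two_mul_hForce hn hOTG))
  · exact Or.inl (hAB.hForce_eq hn hOTG)
end
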